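/- Let W be irreducible and let g ∈ W be a regular element of order d. Then for every W-orbit C of reflecting hyperplanes, the minimal number n_C(g) of factors from C^ref in any reflection factorization of g satisfies e_C·ω_C/d ≥ n_C(g) ≥ l_R(g) − (|R| + |A| − e_C·ω_C)/d; equivalently, d·n_C(g) ≤ e_C·ω_C and d·l_R(g) ≤ d·n_C(g) + |R| + |A| − e_C·ω_C. -/

import Mathlib

open scoped BigOperators

noncomputable section

/-- `χ` is an irreducible complex character of the group `G`. -/
def IsIrredChar (G : Type*) [Group G] (χ : G → ℂ) : Prop :=
  ∃ (n : ℕ) (ρ : Representation ℂ G (Fin n → ℂ)),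
    0 < n ∧
    (∀ U : Submodule ℂ (Fin n → ℂ), (∀ g : G, U.map (ρ g) ≤ U) → U = ⊥ ∨ U = ⊤) ∧
    ∀ g : G, χ g = LinearMap.trace ℂ (Fin n → ℂ) (ρ g)

variable {V : Type*} [AddCommGroup V] [Module ℂ V]

/-- The fixed space `ker (w - id)` of an invertible linear map `w`. -/
def fixedSpace (w : (V →ₗ[ℂ] V)ˣ) : Submodule ℂ V :=
  LinearMap.ker ((w : V →ₗ[ℂ] V) - LinearMap.id)

/-- `w` is a reflection: its fixed space is a hyperplane (codimension 1). -/
def IsReflection (w : (V →ₗ[ℂ] V)ˣ) : Prop :=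
  Module.finrank ℂ V = Module.finrank ℂ (fixedSpace w) + 1

/-- The linear map underlying an element of `W`. -/
def toLin (W : Subgroup (V →ₗ[ℂ] V)ˣ) (w : W) : V →ₗ[ℂ] V :=
  ((w : (V →ₗ[ℂ] V)ˣ) : V →ₗ[ℂ] V)

/-- The set of reflections of `W`. -/
def refls (W : Subgroup (V →ₗ[ℂ] V)ˣ) : Set W :=
  {t | IsReflection (t : (V →ₗ[ℂ] V)ˣ)}

/-- The arrangement of reflecting hyperplanes of `W`. -/
def arrangement (W : Subgroup (V →ₗ[ℂ] V)ˣ) : Set (Submodule ℂ V) :=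
  {H | ∃ t : W, t ∈ refls W ∧ H = fixedSpace (t : (V →ₗ[ℂ] V)ˣ)}

/-- The pointwise stabilizer of a subspace `H` in `W`. -/
def ptStab (W : Subgroup (V →ₗ[ℂ] V)ˣ) (H : Submodule ℂ V) : Set W :=
  {w | ∀ v ∈ H, toLin W w v = v}

/-- The `W`-orbit of a hyperplane `H`. -/
def orbitOf (W : Subgroup (V →ₗ[ℂ] V)ˣ) (H : Submodule ℂ V) : Set (Submodule ℂ V) :=
  {H' | ∃ w : W, H' = H.map (toLin W w)}

/-- The reflections of `W` whose hyperplane lies in the orbit of `H`. -/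
def Cref (W : Subgroup (V →ₗ[ℂ] V)ˣ) (H : Submodule ℂ V) : Set W :=
  {t | t ∈ refls W ∧ fixedSpace (t : (V →ₗ[ℂ] V)ˣ) ∈ orbitOf W H}

/-- `g ∈ W` is a regular element of order `d`: it has a nonzero eigenvector,
with eigenvalue a primitive `d`-th root of unity, lying on no reflecting hyperplane. -/
def IsRegularElt (W : Subgroup (V →ₗ[ℂ] V)ˣ) (g : W) (d : ℕ) : Prop :=
  orderOf g = d ∧ ∃ (ζ : ℂ) (v : V), v ≠ 0 ∧ IsPrimitiveRoot ζ d ∧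
    toLin W g v = ζ • v ∧ ∀ H ∈ arrangement W, v ∉ H

/-- The action of `W` on `V` is irreducible. -/
def IsIrredAction (W : Subgroup (V →ₗ[ℂ] V)ˣ) : Prop :=
  ∀ U : Submodule ℂ V, (∀ w : W, U.map (toLin W w) ≤ U) → U = ⊥ ∨ U = ⊤

/-- `f` is a length-`l` reflection factorization of `g`. -/
def IsReflFac (W : Subgroup (V →ₗ[ℂ] V)ˣ) (g : W) (l : ℕ) (f : Fin l → W) : Prop :=
  (∀ i, f i ∈ refls W) ∧ (List.ofFn f).prod = g

/-- `l` is the reflection length of `g`: the minimal length of a reflection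
factorization of `g`. -/
def IsReflLength (W : Subgroup (V →ₗ[ℂ] V)ˣ) (g : W) (l : ℕ) : Prop :=
  (∃ f : Fin l → W, IsReflFac W g l f) ∧
    ∀ (k : ℕ) (f : Fin k → W), IsReflFac W g k f → l ≤ k

open Classical in
/-- `n` is the minimal number of factors whose hyperplane lies in the orbit `C`,
over all reflection factorizations of `g` (of any length). -/
def IsMinOrbitCount (W : Subgroup (V →ₗ[ℂ] V)ˣ) (g : W)
    (C : Set (Submodule ℂ V)) (n : ℕ) : Prop :=
  (∃ (N : ℕ) (f : Fin N → W), IsReflFac W g N f ∧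
      (Finset.univ.filter fun i => fixedSpace (f i : (V →ₗ[ℂ] V)ˣ) ∈ C).card = n) ∧
  ∀ (N : ℕ) (f : Fin N → W), IsReflFac W g N f →
      n ≤ (Finset.univ.filter fun i => fixedSpace (f i : (V →ₗ[ℂ] V)ˣ) ∈ C).card

set_option linter.unusedSectionVars false
set_option linter.unusedSimpArgs false
set_option linter.unusedVariables false

namespace KZ

section GroupAlgebra

variable {G : Type*} [Group G] {A B C : Type*} [CommRing A] [CommRing B] [CommRing C]
  [Algebra ℂ A] [Algebra ℂ B] [Algebra ℂ C]

theorem ga_ext {F F' : MonoidAlgebra A G} (h : ∀ w, F.coeff w = F'.coeff w) : F = F' :=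
  MonoidAlgebra.coeff_injective (Finsupp.ext h)

/-- apply a linear map to all coefficients -/
def cmap (ψ : A →ₗ[ℂ] B) : MonoidAlgebra A G →ₗ[ℂ] MonoidAlgebra B G where
  toFun F := MonoidAlgebra.ofCoeff (F.coeff.mapRange ψ (map_zero ψ))
  map_add' F F' := by
    apply ga_ext; intro w; simp
  map_smul' c F := by
    apply ga_ext; intro w; simp

@[simp] theorem coeff_cmap (ψ : A →ₗ[ℂ] B) (F : MonoidAlgebra A G) (w : G) :
    (cmap ψ F).coeff w = ψ (F.coeff w) := by
  simp [cmap]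

theorem cmap_comp (ψ : A →ₗ[ℂ] B) (ψ' : B →ₗ[ℂ] C) (F : MonoidAlgebra A G) :
    cmap ψ' (cmap ψ F) = cmap (ψ' ∘ₗ ψ) F := by
  apply ga_ext; intro w; simp

theorem cmap_id (F : MonoidAlgebra A G) : cmap (LinearMap.id) F = F := by
  apply ga_ext; intro w; simp

@[simp] theorem cmap_single (ψ : A →ₗ[ℂ] B) (w : G) (a : A) :
    cmap ψ (MonoidAlgebra.single w a) = MonoidAlgebra.single w (ψ a) := by
  classical
  apply ga_ext; intro u
  simp only [coeff_cmap, MonoidAlgebra.coeff_single, Finsupp.single_apply]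
  split_ifs <;> simp

/-- constants -/
def cst (A : Type*) [CommRing A] [Algebra ℂ A] : MonoidAlgebra ℂ G →ₗ[ℂ] MonoidAlgebra A G :=
  cmap (Algebra.linearMap ℂ A)

@[simp] theorem coeff_cst (F : MonoidAlgebra ℂ G) (w : G) :
    (cst A F).coeff w = algebraMap ℂ A (F.coeff w) := by
  simp [cst]

/-- group elements -/
abbrev el (A : Type*) [CommRing A] (w : G) : MonoidAlgebra A G := MonoidAlgebra.single w 1

theorem cst_el (w : G) : cst A (el ℂ w) = el A w := by
  simp [cst, el]

variable [Fintype G]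

theorem coeff_mul' (F F' : MonoidAlgebra A G) (w : G) :
    (F * F').coeff w = ∑ u, F.coeff u * F'.coeff (u⁻¹ * w) := by
  rw [MonoidAlgebra.coeff_mul_apply_left, Finsupp.sum_fintype]
  simp

theorem cmap_mul_bilin (ψ : A →ₗ[ℂ] B) (F F' : MonoidAlgebra A G) (w : G) :
    (cmap ψ (F * F')).coeff w = ∑ u, ψ (F.coeff u * F'.coeff (u⁻¹ * w)) := by
  simp [coeff_mul', map_sum]

theorem cmap_mul (ψ : A →ₐ[ℂ] B) (F F' : MonoidAlgebra A G) :
    cmap ψ.toLinearMap (F * F') = cmap ψ.toLinearMap F * cmap ψ.toLinearMap F' := by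
  apply ga_ext; intro w
  simp [coeff_mul', map_sum]

theorem cmap_one (ψ : A →ₐ[ℂ] B) :
    cmap ψ.toLinearMap (1 : MonoidAlgebra A G) = 1 := by
  simp [MonoidAlgebra.one_def]

theorem cmap_cst_mul (ψ : A →ₗ[ℂ] B) (a : MonoidAlgebra ℂ G) (F : MonoidAlgebra A G) :
    cmap ψ (cst A a * F) = cst B a * cmap ψ F := by
  apply ga_ext; intro w
  rw [cmap_mul_bilin]
  simp only [coeff_mul', coeff_cst, coeff_cmap, ← Algebra.smul_def, map_smul]

theorem cmap_mul_cst (ψ : A →ₗ[ℂ] B) (a : MonoidAlgebra ℂ G) (F : MonoidAlgebra A G) :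
    cmap ψ (F * cst A a) = cmap ψ F * cst B a := by
  apply ga_ext; intro w
  rw [cmap_mul_bilin]
  simp only [coeff_mul', coeff_cst, coeff_cmap, mul_comm _ (algebraMap ℂ _ _),
    ← Algebra.smul_def, map_smul]

theorem cst_mul (a b : MonoidAlgebra ℂ G) : cst A (a * b) = cst A a * cst A b :=
  cmap_mul (Algebra.ofId ℂ A) a b

theorem cst_one : cst A (1 : MonoidAlgebra ℂ G) = 1 := cmap_one (Algebra.ofId ℂ A)

theorem cmap_cst (ψ : A →ₐ[ℂ] B) (a : MonoidAlgebra ℂ G) :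
    cmap ψ.toLinearMap (cst A a) = cst B a := by
  apply ga_ext; intro w; simp

theorem cst_injective [Nontrivial A] : Function.Injective (cst A : MonoidAlgebra ℂ G →ₗ[ℂ] _) := by
  intro a b h
  apply ga_ext; intro w
  have := congrArg (fun F => F.coeff w) h
  simpa using this

theorem cmap_der (ψ : A →ₗ[ℂ] A) (hψ : ∀ a b, ψ (a * b) = ψ a * b + a * ψ b)
    (F F' : MonoidAlgebra A G) :
    cmap ψ (F * F') = cmap ψ F * F' + F * cmap ψ F' := by
  apply ga_ext; intro w
  simp [coeff_mul', map_sum, hψ, Finset.sum_add_distrib]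

theorem cmap_smul_der (ψ : A →ₗ[ℂ] A) (hψ : ∀ a b, ψ (a * b) = ψ a * b + a * ψ b)
    (a : A) (F : MonoidAlgebra A G) :
    cmap ψ (a • F) = ψ a • F + a • cmap ψ F := by
  apply ga_ext; intro w
  simp [hψ]

theorem cmap_smul (ψ : A →ₐ[ℂ] B) (a : A) (F : MonoidAlgebra A G) :
    cmap ψ.toLinearMap (a • F) = ψ a • cmap ψ.toLinearMap F := by
  apply ga_ext; intro w
  simp

/-- elements with all coefficients in `T` -/
def XS (T : Submodule ℂ A) : Submodule ℂ (MonoidAlgebra A G) where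
  carrier := {F | ∀ w, F.coeff w ∈ T}
  add_mem' := by
    intro F F' h h' w
    simpa using T.add_mem (h w) (h' w)
  zero_mem' := by intro w; simp
  smul_mem' := by
    intro c F h w
    simpa using T.smul_mem c (h w)

theorem mem_XS {T : Submodule ℂ A} {F : MonoidAlgebra A G} : F ∈ XS T ↔ ∀ w, F.coeff w ∈ T :=
  Iff.rfl

theorem XS_mono {T T' : Submodule ℂ A} (h : T ≤ T') : (XS T : Submodule ℂ (MonoidAlgebra A G)) ≤ XS T' :=
  fun _ hF w => h (hF w)

theorem XS_mul {T T' T'' : Submodule ℂ A} (h : ∀ a ∈ T, ∀ b ∈ T', a * b ∈ T'')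
    {F F' : MonoidAlgebra A G} (hF : F ∈ XS T) (hF' : F' ∈ XS T') : F * F' ∈ XS T'' := by
  intro w
  rw [coeff_mul']
  exact T''.sum_mem fun u _ => h _ (hF _) _ (hF' _)

theorem XS_smul {T T' : Submodule ℂ A} {a : A} (h : ∀ b ∈ T, a * b ∈ T')
    {F : MonoidAlgebra A G} (hF : F ∈ XS T) : a • F ∈ XS T' := by
  intro w
  simpa using h _ (hF w)

theorem XS_cmap {T : Submodule ℂ A} {T' : Submodule ℂ B} {ψ : A →ₗ[ℂ] B} (h : ∀ b ∈ T, ψ b ∈ T')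
    {F : MonoidAlgebra A G} (hF : F ∈ XS T) : cmap ψ F ∈ XS T' := by
  intro w
  simpa using h _ (hF w)

theorem XS_cst_mul {T : Submodule ℂ A} (a : MonoidAlgebra ℂ G)
    {F : MonoidAlgebra A G} (hF : F ∈ XS T) : cst A a * F ∈ XS T := by
  intro w
  rw [coeff_mul']
  refine T.sum_mem fun u _ => ?_
  rw [coeff_cst, ← Algebra.smul_def]
  exact T.smul_mem _ (hF _)

theorem XS_mul_cst {T : Submodule ℂ A} (a : MonoidAlgebra ℂ G)
    {F : MonoidAlgebra A G} (hF : F ∈ XS T) : F * cst A a ∈ XS T := by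
  intro w
  rw [coeff_mul']
  refine T.sum_mem fun u _ => ?_
  rw [coeff_cst, mul_comm, ← Algebra.smul_def]
  exact T.smul_mem _ (hF _)

theorem XS_el_mul {T : Submodule ℂ A} (u : G)
    {F : MonoidAlgebra A G} (hF : F ∈ XS T) : el A u * F ∈ XS T := by
  rw [← cst_el]; exact XS_cst_mul _ hF

theorem XS_cst {T : Submodule ℂ A} (h1 : (1 : A) ∈ T) (a : MonoidAlgebra ℂ G) : cst A a ∈ XS T := by
  intro w
  rw [coeff_cst, Algebra.algebraMap_eq_smul_one]
  exact T.smul_mem _ h1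

end GroupAlgebra

end KZ

namespace KZ

section Poly

open MvPolynomial

variable {ι : Type*} [Fintype ι] (b : Module.Basis ι ℂ V)

/-- the linear polynomial attached to a linear form -/
def lin (f : Module.Dual ℂ V) : MvPolynomial ι ℂ := ∑ i, C (f (b i)) * X i

/-- evaluation at a vector -/
def evp (x : V) : MvPolynomial ι ℂ →ₐ[ℂ] ℂ := aeval (fun i => b.repr x i)

theorem evp_lin (x : V) (f : Module.Dual ℂ V) : evp b x (lin b f) = f x := by
  conv_rhs => rw [← b.sum_repr x, map_sum]
  simp [evp, lin, mul_comm]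

theorem lin_add (f f' : Module.Dual ℂ V) : lin b (f + f') = lin b f + lin b f' := by
  simp [lin, add_mul, Finset.sum_add_distrib]

theorem lin_smul (c : ℂ) (f : Module.Dual ℂ V) : lin b (c • f) = C c * lin b f := by
  simp [lin, mul_assoc, Finset.mul_sum]

theorem lin_sub (f f' : Module.Dual ℂ V) : lin b (f - f') = lin b f - lin b f' := by
  simp [lin, sub_mul, Finset.sum_sub_distrib]

theorem lin_coord (i : ι) : lin b (b.coord i) = X i := by
  classical
  simp [lin, Module.Basis.coord_apply, Finsupp.single_apply, Finset.sum_ite_eq]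

/-- composition with a linear map -/
def sbs (u : V →ₗ[ℂ] V) : MvPolynomial ι ℂ →ₐ[ℂ] MvPolynomial ι ℂ :=
  aeval (fun i => lin b (b.coord i ∘ₗ u))

theorem sbs_X (u : V →ₗ[ℂ] V) (i : ι) : sbs b u (X i) = lin b (b.coord i ∘ₗ u) := by
  simp [sbs]

theorem sbs_lin (u : V →ₗ[ℂ] V) (f : Module.Dual ℂ V) : sbs b u (lin b f) = lin b (f ∘ₗ u) := by
  have h1 : sbs b u (lin b f) = ∑ i, C (f (b i)) * lin b (b.coord i ∘ₗ u) := by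
    simp only [lin, map_sum, map_mul, algHom_C, sbs_X]
    rfl
  rw [h1]
  have h2 : f ∘ₗ u = ∑ i, f (b i) • (b.coord i ∘ₗ u) := by
    ext x
    simp only [LinearMap.comp_apply, LinearMap.sum_apply, LinearMap.smul_apply,
      Module.Basis.coord_apply]
    conv_lhs => rw [← b.sum_repr (u x), map_sum]
    simp [mul_comm]
  rw [h2]
  have h3 : ∀ s : Finset ι, lin b (∑ i ∈ s, f (b i) • (b.coord i ∘ₗ u)) =
      ∑ i ∈ s, C (f (b i)) * lin b (b.coord i ∘ₗ u) := by
    classical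
    intro s
    induction s using Finset.induction_on with
    | empty => simp [lin]
    | insert a s ha ih => rw [Finset.sum_insert ha, Finset.sum_insert ha, lin_add, lin_smul, ih]
  rw [h3]

theorem evp_sbs (u : V →ₗ[ℂ] V) (x : V) (p : MvPolynomial ι ℂ) :
    evp b x (sbs b u p) = evp b (u x) p := by
  have : (evp b x).comp (sbs b u) = evp b (u x) := by
    apply MvPolynomial.algHom_ext
    intro i
    simp only [AlgHom.comp_apply, sbs_X, evp_lin]
    simp [evp]
  exact DFunLike.congr_fun this p

theorem sbs_comp (u u' : V →ₗ[ℂ] V) (p : MvPolynomial ι ℂ) :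
    sbs b u' (sbs b u p) = sbs b (u ∘ₗ u') p := by
  have : (sbs b u').comp (sbs b u) = sbs b (u ∘ₗ u') := by
    apply MvPolynomial.algHom_ext
    intro i
    simp only [AlgHom.comp_apply, sbs_X, sbs_lin]
    rfl
  exact DFunLike.congr_fun this p

theorem sbs_id (p : MvPolynomial ι ℂ) : sbs b LinearMap.id p = p := by
  have : sbs b LinearMap.id = AlgHom.id ℂ _ := by
    apply MvPolynomial.algHom_ext
    intro i
    simp only [sbs_X, LinearMap.comp_id, lin_coord, AlgHom.id_apply]
  rw [this]; rfl

/-- directional derivative -/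
def dR (y : V) : Derivation ℂ (MvPolynomial ι ℂ) (MvPolynomial ι ℂ) :=
  mkDerivation ℂ (fun i => C (b.repr y i))

theorem dR_X (y : V) (i : ι) : dR b y (X i) = C (b.repr y i) := by
  simp [dR]

theorem dR_C (y : V) (c : ℂ) : dR b y (C c) = 0 := by
  simp [dR]

theorem dR_mul (y : V) (p q : MvPolynomial ι ℂ) :
    dR b y (p * q) = dR b y p * q + p * dR b y q := by
  rw [Derivation.leibniz]
  simp only [smul_eq_mul]; ring

theorem dR_lin (y : V) (f : Module.Dual ℂ V) : dR b y (lin b f) = C (f y) := by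
  conv_rhs => rw [← b.sum_repr y, map_sum, map_sum]
  simp [lin, map_sum, dR_mul, dR_C, dR_X, mul_comm]

theorem dR_basis [DecidableEq ι] (i : ι) (p : MvPolynomial ι ℂ) : dR b (b i) p = pderiv i p := by
  have : dR b (b i) = pderiv i := by
    apply MvPolynomial.derivation_ext
    intro j
    rw [dR_X, pderiv_X]
    simp [Finsupp.single_apply, Pi.single_apply]
    split_ifs with h h' h' <;> simp_all
  rw [this]

theorem dR_eq_sum [DecidableEq ι] (y : V) (p : MvPolynomial ι ℂ) :
    dR b y p = ∑ i, C (b.repr y i) * pderiv i p := by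
  have : dR b y = ∑ i, b.repr y i • pderiv i := by
    apply MvPolynomial.derivation_ext
    intro j
    rw [dR_X]
    have : (∑ i, b.repr y i • pderiv i : Derivation ℂ (MvPolynomial ι ℂ) (MvPolynomial ι ℂ)) (X j)
      = ∑ i, (b.repr y i • pderiv i : Derivation ℂ (MvPolynomial ι ℂ) (MvPolynomial ι ℂ)) (X j) := by
      rw [← Derivation.coeFnAddMonoidHom_apply, map_sum, Finset.sum_apply]; rfl
    rw [this]
    simp [pderiv_X, Pi.single_apply, smul_eq_C_mul]
  rw [this, ← Derivation.coeFnAddMonoidHom_apply, map_sum, Finset.sum_apply]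
  simp [smul_eq_C_mul]

theorem dR_add (y y' : V) (p : MvPolynomial ι ℂ) : dR b (y + y') p = dR b y p + dR b y' p := by
  classical
  simp [dR_eq_sum, add_mul, Finset.sum_add_distrib]

theorem dR_smul (c : ℂ) (y : V) (p : MvPolynomial ι ℂ) : dR b (c • y) p = C c * dR b y p := by
  classical
  simp [dR_eq_sum, Finset.mul_sum, mul_assoc]

theorem dR_comm (y y' : V) (p : MvPolynomial ι ℂ) :
    dR b y (dR b y' p) = dR b y' (dR b y p) := by
  induction p using MvPolynomial.induction_on with
  | C a => simp [dR_C]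
  | add p q hp hq => simp [hp, hq]
  | mul_X p i hp =>
    simp only [dR_mul, map_add, hp, dR_X, dR_C]; ring

theorem sbs_dR (u u' : V →ₗ[ℂ] V) (h : u ∘ₗ u' = LinearMap.id) (y : V) (p : MvPolynomial ι ℂ) :
    sbs b u (dR b y p) = dR b (u' y) (sbs b u p) := by
  induction p using MvPolynomial.induction_on with
  | C a => simp [dR_C, algHom_C]
  | add p q hp hq => simp [hp, hq]
  | mul_X p i hp =>
    have h1 : u (u' y) = y := DFunLike.congr_fun h y
    simp only [dR_mul, map_add, map_mul, hp, dR_X, sbs_X, dR_lin, algHom_C, LinearMap.comp_apply, h1,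
      Module.Basis.coord_apply]
    rfl

theorem dR_degree (y : V) (p : MvPolynomial ι ℂ) :
    dR b y p = 0 ∨ (dR b y p).totalDegree + 1 ≤ p.totalDegree := by
  classical
  by_cases h0 : dR b y p = 0
  · exact Or.inl h0
  right
  have key : ∀ m ∈ (dR b y p).support, (m.sum fun _ e => e) + 1 ≤ p.totalDegree := by
    intro m hm
    rw [mem_support_iff, dR_eq_sum, coeff_sum] at hm
    obtain ⟨i, _, hi⟩ := Finset.exists_ne_zero_of_sum_ne_zero hm
    rw [coeff_C_mul, coeff_pderiv] at hi
    have h2 : coeff (m + Finsupp.single i 1) p ≠ 0 := by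
      intro h; rw [h] at hi; simp at hi
    have := le_totalDegree (mem_support_iff.2 h2)
    rwa [Finsupp.sum_add_index' (by simp) (by simp), Finsupp.sum_single_index rfl] at this
  obtain ⟨m, hm⟩ := support_nonempty.2 h0
  have h1 := key m hm
  have : (dR b y p).totalDegree ≤ p.totalDegree - 1 :=
    Finset.sup_le fun m hm => by have := key m hm; omega
  omega

theorem eq_C_of_dR (p : MvPolynomial ι ℂ) (h : ∀ y, dR b y p = 0) : ∃ c, p = C c := by
  classical
  refine ⟨coeff 0 p, ?_⟩
  ext m
  rw [coeff_C]
  split_ifs with hm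
  · rw [hm]
  · have : ∃ i, m i ≠ 0 := by
      by_contra hcon
      push Not at hcon
      exact hm (Finsupp.ext fun i => by simp [hcon i])
    obtain ⟨i, hi⟩ := this
    have h1 := h (b i)
    rw [dR_basis] at h1
    have h2 := congrArg (coeff (m - Finsupp.single i 1)) h1
    rw [coeff_pderiv] at h2
    have h3 : m - Finsupp.single i 1 + Finsupp.single i 1 = m := by
      apply tsub_add_cancel_of_le
      rw [Finsupp.single_le_iff]; omega
    rw [h3] at h2
    simp only [coeff_zero, mul_eq_zero] at h2
    rcases h2 with h2 | h2
    · exact h2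
    · exfalso
      exact Nat.cast_add_one_ne_zero _ h2

theorem lin_ne_zero {f : Module.Dual ℂ V} (hf : f ≠ 0) : lin b f ≠ 0 := by
  intro h
  apply hf
  ext x
  rw [← evp_lin b x f, h]; simp

theorem lin_totalDegree {f : Module.Dual ℂ V} (hf : f ≠ 0) : (lin b f).totalDegree = 1 := by
  classical
  have hle : (lin b f).totalDegree ≤ 1 := by
    refine (totalDegree_finsetSum _ _).trans (Finset.sup_le fun i _ => ?_)
    refine (totalDegree_mul _ _).trans ?_
    simp
  by_contra hne
  have h0 : (lin b f).totalDegree = 0 := by omega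
  rw [totalDegree_eq_zero_iff_eq_C] at h0
  obtain ⟨x, hx⟩ : ∃ x, f x ≠ 0 := by
    by_contra hcon; push Not at hcon; exact hf (LinearMap.ext hcon)
  have h1 := dR_lin b x f
  rw [h0, dR_C] at h1
  exact hx (by simpa using h1.symm)

theorem lin_prime {f : Module.Dual ℂ V} (hf : f ≠ 0) : Prime (lin b f) := by
  apply Irreducible.prime
  apply irreducible_of_totalDegree_eq_one (lin_totalDegree b hf)
  intro x hx
  rw [isUnit_iff_ne_zero]
  rintro rfl
  apply lin_ne_zero b hf
  ext m
  simpa using hx m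

theorem not_lin_dvd {f f' : Module.Dual ℂ V} {x : V} (hx : f x = 0) (hx' : f' x ≠ 0) :
    ¬ lin b f ∣ lin b f' := by
  rintro ⟨q, hq⟩
  apply hx'
  rw [← evp_lin b x f', hq, map_mul, evp_lin, hx, zero_mul]

/-- if `u` acts trivially on `ker f` then it acts trivially modulo `f` -/
theorem lin_dvd_sbs_sub {f : Module.Dual ℂ V} {u : V →ₗ[ℂ] V} (hu : ∀ x, f x = 0 → u x = x)
    (p : MvPolynomial ι ℂ) : lin b f ∣ sbs b u p - p := by
  induction p using MvPolynomial.induction_on with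
  | C a => simp [algHom_C]
  | add p q hp hq =>
    rw [map_add]
    have := dvd_add hp hq
    convert this using 1; ring
  | mul_X p i hp =>
    have h1 : lin b f ∣ sbs b u (X i) - X i := by
      rw [sbs_X]
      rw [← lin_coord b i, ← lin_sub]
      have h2 : ∃ c : ℂ, b.coord i ∘ₗ u - b.coord i = c • f := by
        have hk : LinearMap.ker f ≤ LinearMap.ker (b.coord i ∘ₗ u - b.coord i) := by
          intro x hx
          rw [LinearMap.mem_ker] at hx ⊢
          simp [hu x hx]
        by_cases hf : f = 0
        · refine ⟨0, ?_⟩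
          rw [hf] at hk
          ext x
          have := hk (show x ∈ LinearMap.ker (0 : Module.Dual ℂ V) by simp)
          simpa using this
        · obtain ⟨x, hx⟩ : ∃ x, f x ≠ 0 := by
            by_contra hcon; push Not at hcon; exact hf (LinearMap.ext hcon)
          refine ⟨(b.coord i ∘ₗ u - b.coord i) x / f x, ?_⟩
          ext z
          have h3 : z - (f z / f x) • x ∈ LinearMap.ker f := by
            rw [LinearMap.mem_ker]; simp [hx]
          have h4 := hk h3
          rw [LinearMap.mem_ker, map_sub, map_smul, sub_eq_zero] at h4
          rw [h4, LinearMap.smul_apply]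
          simp only [smul_eq_mul]; field_simp
      obtain ⟨c, hc⟩ := h2
      rw [hc, lin_smul]
      exact Dvd.intro_left _ rfl
    rw [map_mul]
    have : sbs b u p * sbs b u (X i) - p * X i =
      (sbs b u p - p) * sbs b u (X i) + p * (sbs b u (X i) - X i) := by ring
    rw [this]
    exact dvd_add (Dvd.dvd.mul_right hp _) (Dvd.dvd.mul_left h1 _)

end Poly

end KZ

namespace KZ

section Frac

open MvPolynomial

variable {ι : Type*} [Fintype ι] (b : Module.Basis ι ℂ V)
variable (K : Type*) [Field K] [Algebra (MvPolynomial ι ℂ) K] [IsFractionRing (MvPolynomial ι ℂ) K]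
  [Algebra ℂ K] [IsScalarTower ℂ (MvPolynomial ι ℂ) K]

/-- the inclusion of polynomials in rational functions -/
def al : MvPolynomial ι ℂ →+* K := algebraMap (MvPolynomial ι ℂ) K

theorem al_def (p : MvPolynomial ι ℂ) : algebraMap (MvPolynomial ι ℂ) K p = al K p := rfl

theorem al_inj : Function.Injective (al (ι := ι) K) :=
  IsFractionRing.injective (MvPolynomial ι ℂ) K

variable {K} in
theorem al_ne_zero {p : MvPolynomial ι ℂ} (h : p ≠ 0) : al K p ≠ 0 := fun h' =>
  h (al_inj K (by simpa using h'))

theorem al_C (c : ℂ) : al (ι := ι) K (C c) = algebraMap ℂ K c := by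
  rw [IsScalarTower.algebraMap_apply ℂ (MvPolynomial ι ℂ) K]; rfl

/-- The algebra hom version of `al`. -/
def alh : MvPolynomial ι ℂ →ₐ[ℂ] K := IsScalarTower.toAlgHom ℂ _ K

theorem alh_apply (p : MvPolynomial ι ℂ) : alh K p = al K p := rfl

theorem alh_inj : Function.Injective (alh (ι := ι) K) := al_inj K

variable {K} in
theorem exists_frac (f : K) : ∃ p q : MvPolynomial ι ℂ, q ≠ 0 ∧ f * al K q = al K p := by
  obtain ⟨p, q, hq, rfl⟩ := IsFractionRing.div_surjective (A := MvPolynomial ι ℂ) f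
  have hq0 : q ≠ 0 := nonZeroDivisors.ne_zero hq
  refine ⟨p, q, hq0, ?_⟩
  rw [al_def, al_def, div_mul_cancel₀]
  exact al_ne_zero hq0

/-- uniqueness of (twisted) derivations -/
theorem der_ext (σ : K →+* K) (δ : K →+ K) (hδ : ∀ f g, δ (f * g) = δ f * σ g + σ f * δ g)
    (h0 : ∀ p : MvPolynomial ι ℂ, δ (al K p) = 0) (f : K) : δ f = 0 := by
  obtain ⟨p, q, hq, h⟩ := exists_frac (ι := ι) f
  have h1 := hδ f (al K q)
  rw [h, h0, h0, mul_zero, add_zero] at h1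
  have h2 : σ (al K q) ≠ 0 := (map_ne_zero σ).2 (al_ne_zero hq)
  exact (mul_eq_zero.1 h1.symm).resolve_right h2

/-- ring homs to dual numbers from a derivation -/
def dualHom (y : V) : MvPolynomial ι ℂ →+* TrivSqZeroExt K K where
  toFun p := TrivSqZeroExt.inl (al K p) + TrivSqZeroExt.inr (al K (dR b y p))
  map_one' := by
    have : dR b y (1 : MvPolynomial ι ℂ) = 0 := Derivation.map_one_eq_zero _
    ext <;> simp [this]
  map_mul' p q := by
    ext
    · simp
    · simp [dR_mul]; ring
  map_zero' := by ext <;> simp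
  map_add' p q := by ext <;> simp

theorem dualHom_isUnit (y : V) (q : nonZeroDivisors (MvPolynomial ι ℂ)) :
    IsUnit (dualHom b K y q) := by
  rw [TrivSqZeroExt.isUnit_iff_isUnit_fst, isUnit_iff_ne_zero]
  have : (dualHom b K y q).fst = al K (q : MvPolynomial ι ℂ) := by simp [dualHom]
  rw [this]
  exact al_ne_zero (nonZeroDivisors.ne_zero q.2)

def dualLift (y : V) : K →+* TrivSqZeroExt K K :=
  IsLocalization.lift (M := nonZeroDivisors (MvPolynomial ι ℂ)) (dualHom_isUnit b K y)

theorem dualLift_al (y : V) (p : MvPolynomial ι ℂ) :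
    dualLift b K y (al K p) = dualHom b K y p :=
  IsLocalization.lift_eq _ _

theorem dualLift_fst (y : V) (f : K) : (dualLift b K y f).fst = f := by
  have : (TrivSqZeroExt.fstHom ℂ K K : TrivSqZeroExt K K →+* K).comp (dualLift b K y) = RingHom.id K := by
    apply IsLocalization.ringHom_ext (nonZeroDivisors (MvPolynomial ι ℂ))
    apply RingHom.ext
    intro p
    simp [al_def, dualLift_al, dualHom]
  exact DFunLike.congr_fun this f

/-- directional derivative on rational functions -/
def dK (y : V) : K →ₗ[ℂ] K where
  toFun f := (dualLift b K y f).snd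
  map_add' f g := by simp
  map_smul' c f := by
    rw [Algebra.smul_def, ← al_C (ι := ι), map_mul, dualLift_al, TrivSqZeroExt.snd_mul, dualLift_fst]
    simp [dualHom, dR_C]
    rw [Algebra.smul_def, ← al_C (ι := ι)]

theorem dK_mul (y : V) (f g : K) : dK b K y (f * g) = dK b K y f * g + f * dK b K y g := by
  change (dualLift b K y (f * g)).snd = (dualLift b K y f).snd * g + f * (dualLift b K y g).snd
  rw [map_mul, TrivSqZeroExt.snd_mul, dualLift_fst, dualLift_fst]
  simp; ring

theorem dK_al (y : V) (p : MvPolynomial ι ℂ) : dK b K y (al K p) = al K (dR b y p) := by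
  change (dualLift b K y (al K p)).snd = _
  rw [dualLift_al]; simp [dualHom]

theorem dK_add (y y' : V) (f : K) : dK b K (y + y') f = dK b K y f + dK b K y' f := by
  have := der_ext (ι := ι) K (RingHom.id K)
    ((dK b K (y + y')).toAddMonoidHom - (dK b K y).toAddMonoidHom - (dK b K y').toAddMonoidHom)
    (by intro f g; simp [dK_mul]; ring) (by intro p; simp [dK_al, dR_add]) f
  simp at this
  linear_combination this

theorem dK_smul (c : ℂ) (y : V) (f : K) : dK b K (c • y) f = algebraMap ℂ K c * dK b K y f := by
  have := der_ext (ι := ι) K (RingHom.id K)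
    ((dK b K (c • y)).toAddMonoidHom - (c • dK b K y).toAddMonoidHom)
    (by intro f g; simp [dK_mul, Algebra.smul_def]; ring)
    (by intro p; simp [dK_al, dR_smul, Algebra.smul_def, al_C]) f
  simp [Algebra.smul_def] at this
  linear_combination this

theorem dK_comm (y y' : V) (f : K) : dK b K y (dK b K y' f) = dK b K y' (dK b K y f) := by
  have := der_ext (ι := ι) K (RingHom.id K)
    ((dK b K y ∘ₗ dK b K y').toAddMonoidHom - (dK b K y' ∘ₗ dK b K y).toAddMonoidHom)
    (by intro f g; simp [dK_mul]; ring)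
    (by intro p; simp [dK_al, dR_comm b y y']) f
  simp at this
  linear_combination this

theorem sbs_inj' (u u' : V →ₗ[ℂ] V) (h : u ∘ₗ u' = LinearMap.id) :
    Function.Injective ((alh K).comp (sbs b u)) := by
  intro p q hpq
  have h1 : sbs b u p = sbs b u q := alh_inj K hpq
  have h2 := congrArg (sbs b u') h1
  rwa [sbs_comp, sbs_comp, h, sbs_id, sbs_id] at h2

/-- substitution of an invertible linear map -/
def sbK (u u' : V →ₗ[ℂ] V) (h : u ∘ₗ u' = LinearMap.id) : K →ₐ[ℂ] K :=
  IsFractionRing.liftAlgHom (A := MvPolynomial ι ℂ) (sbs_inj' b K u u' h)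

theorem sbK_al (u u' : V →ₗ[ℂ] V) (h : u ∘ₗ u' = LinearMap.id) (p : MvPolynomial ι ℂ) :
    sbK b K u u' h (al K p) = al K (sbs b u p) := by
  rw [sbK, IsFractionRing.liftAlgHom_apply, ← al_def, IsFractionRing.lift_algebraMap]
  rfl

theorem sbK_dK (u u' : V →ₗ[ℂ] V) (h : u ∘ₗ u' = LinearMap.id) (y : V) (f : K) :
    sbK b K u u' h (dK b K y f) = dK b K (u' y) (sbK b K u u' h f) := by
  have := der_ext (ι := ι) K (sbK b K u u' h).toRingHom
    (((sbK b K u u' h).toLinearMap ∘ₗ dK b K y).toAddMonoidHom -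
      (dK b K (u' y) ∘ₗ (sbK b K u u' h).toLinearMap).toAddMonoidHom)
    (by intro f g; simp [dK_mul]; ring)
    (by intro p; simp [dK_al, sbK_al, sbs_dR b u u' h]) f
  simp at this
  linear_combination this

theorem algHomK_ext {A A' : K →ₐ[ℂ] K} (h : ∀ p : MvPolynomial ι ℂ, A (al K p) = A' (al K p)) :
    A = A' := by
  have : (A : K →+* K) = (A' : K →+* K) := IsFractionRing.ringHom_ext (A := MvPolynomial ι ℂ) h
  ext f
  exact DFunLike.congr_fun this f

/-! ### degree filtration -/

/-- rational functions of degree at most `k` -/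
def Dg (ι : Type*) [Fintype ι] (K : Type*) [Field K] [Algebra (MvPolynomial ι ℂ) K]
    [IsFractionRing (MvPolynomial ι ℂ) K] [Algebra ℂ K] [IsScalarTower ℂ (MvPolynomial ι ℂ) K]
    (k : ℤ) : Submodule ℂ K where
  carrier := {f | ∃ p q : MvPolynomial ι ℂ, q ≠ 0 ∧ f * al K q = al K p ∧
    (p = 0 ∨ (p.totalDegree : ℤ) ≤ q.totalDegree + k)}
  add_mem' := by
    rintro f g ⟨p, q, hq, h, hd⟩ ⟨p', q', hq', h', hd'⟩
    refine ⟨p * q' + p' * q, q * q', mul_ne_zero hq hq', ?_, ?_⟩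
    · simp only [map_mul, map_add, ← h, ← h']; ring
    · rw [totalDegree_mul_of_isDomain hq hq']
      have h1 : p * q' = 0 ∨ ((p * q').totalDegree : ℤ) ≤ q.totalDegree + q'.totalDegree + k := by
        rcases hd with rfl | hd
        · left; simp
        · right
          have : ((p * q').totalDegree : ℤ) ≤ p.totalDegree + q'.totalDegree := by
            exact_mod_cast totalDegree_mul p q'
          linarith
      have h2 : p' * q = 0 ∨ ((p' * q).totalDegree : ℤ) ≤ q.totalDegree + q'.totalDegree + k := by
        rcases hd' with rfl | hd'
        · left; simp
        · right
          have : ((p' * q).totalDegree : ℤ) ≤ p'.totalDegree + q.totalDegree := by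
            exact_mod_cast totalDegree_mul p' q
          linarith
      push_cast
      rcases h1 with h1 | h1
      · rw [h1, zero_add]; exact h2
      rcases h2 with h2 | h2
      · rw [h2, add_zero]; exact Or.inr h1
      right
      have : ((p * q' + p' * q).totalDegree : ℤ) ≤
          max ((p * q').totalDegree : ℤ) ((p' * q).totalDegree : ℤ) := by
        exact_mod_cast totalDegree_add (p * q') (p' * q)
      exact this.trans (max_le h1 h2)
  zero_mem' := ⟨0, 1, one_ne_zero, by simp, Or.inl rfl⟩
  smul_mem' := by
    rintro c f ⟨p, q, hq, h, hd⟩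
    refine ⟨C c * p, q, hq, ?_, ?_⟩
    · rw [Algebra.smul_def, map_mul, al_C, mul_assoc, h]
    · rcases hd with rfl | hd
      · left; simp
      · right
        have := totalDegree_mul (C c) p
        simp only [totalDegree_C, zero_add] at this
        have : ((C c * p).totalDegree : ℤ) ≤ p.totalDegree := by exact_mod_cast this
        linarith

theorem Dg_mul {j k : ℤ} {f g : K} (hf : f ∈ Dg ι K j) (hg : g ∈ Dg ι K k) :
    f * g ∈ Dg ι K (j + k) := by
  obtain ⟨p, q, hq, h, hd⟩ := hf
  obtain ⟨p', q', hq', h', hd'⟩ := hg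
  refine ⟨p * p', q * q', mul_ne_zero hq hq', ?_, ?_⟩
  · simp only [map_mul, ← h, ← h']; ring
  · rcases hd with rfl | hd
    · left; simp
    rcases hd' with rfl | hd'
    · left; simp
    right
    rw [totalDegree_mul_of_isDomain hq hq']
    have : ((p * p').totalDegree : ℤ) ≤ p.totalDegree + p'.totalDegree := by
      exact_mod_cast totalDegree_mul p p'
    push_cast; linarith

theorem Dg_mono {j k : ℤ} (h : j ≤ k) : Dg ι K j ≤ Dg ι K k := by
  rintro f ⟨p, q, hq, h, hd⟩
  exact ⟨p, q, hq, h, hd.imp id (fun h => by linarith)⟩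

theorem Dg_al {k : ℤ} {p : MvPolynomial ι ℂ} (h : (p.totalDegree : ℤ) ≤ k) : al K p ∈ Dg ι K k :=
  ⟨p, 1, one_ne_zero, by simp, Or.inr (by simpa using h)⟩

theorem Dg_al_iff {k : ℤ} {p : MvPolynomial ι ℂ} (h : al K p ∈ Dg ι K k) :
    p = 0 ∨ (p.totalDegree : ℤ) ≤ k := by
  obtain ⟨p', q, hq, h, hd⟩ := h
  rw [← map_mul] at h
  have h1 := al_inj K h
  by_cases hp : p = 0
  · exact Or.inl hp
  rcases hd with rfl | hd
  · exact absurd h1 (mul_ne_zero hp hq)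
  right
  rw [← h1, totalDegree_mul_of_isDomain hp hq] at hd
  push_cast at hd; linarith

theorem Dg_inv {q : MvPolynomial ι ℂ} (hq : q ≠ 0) : (al K q)⁻¹ ∈ Dg ι K (-q.totalDegree) :=
  ⟨1, q, hq, by rw [inv_mul_cancel₀ (al_ne_zero hq)]; simp, Or.inr (by simp)⟩

theorem Dg_one : (1 : K) ∈ Dg ι K 0 := by
  have := Dg_al (ι := ι) K (k := 0) (p := 1) (by simp)
  simpa using this

theorem Dg_dK {k : ℤ} {f : K} (hf : f ∈ Dg ι K k) (y : V) : dK b K y f ∈ Dg ι K (k - 1) := by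
  obtain ⟨p, q, hq, h, hd⟩ := hf
  have h1 := congrArg (dK b K y) h
  rw [dK_mul, dK_al, dK_al] at h1
  have hq' := al_ne_zero (K := K) hq
  -- dK f = (al dp - f al dq)/al q
  have h2 : dK b K y f = (al K (dR b y p) + (-1 : ℂ) • (f * al K (dR b y q))) * (al K q)⁻¹ := by
    rw [eq_mul_inv_iff_mul_eq₀ hq', ← h1]; simp
  rw [h2]
  have e : k - 1 = (q.totalDegree + k - 1) + (-q.totalDegree : ℤ) := by ring
  rw [e]
  refine Dg_mul K ((Dg ι K _).add_mem ?_ ((Dg ι K _).smul_mem _ ?_)) (Dg_inv K hq)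
  · rcases dR_degree b y p with h0 | h0
    · rw [h0, map_zero]; exact Submodule.zero_mem _
    · rcases hd with rfl | hd
      · simp
      · apply Dg_al
        have : ((dR b y p).totalDegree : ℤ) + 1 ≤ p.totalDegree := by exact_mod_cast h0
        linarith
  · rcases dR_degree b y q with h0 | h0
    · rw [h0, map_zero, mul_zero]; exact Submodule.zero_mem _
    · have e2 : (q.totalDegree + k - 1 : ℤ) = k + (q.totalDegree - 1) := by ring
      rw [e2]
      refine Dg_mul K ⟨p, q, hq, h, hd⟩ (Dg_al K ?_)
      have : ((dR b y q).totalDegree : ℤ) + 1 ≤ q.totalDegree := by exact_mod_cast h0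
      linarith

/-! ### polynomials inside rational functions -/

/-- the polynomials as a subspace of `K` -/
def Rs (ι : Type*) [Fintype ι] (K : Type*) [Field K] [Algebra (MvPolynomial ι ℂ) K]
    [IsFractionRing (MvPolynomial ι ℂ) K] [Algebra ℂ K] [IsScalarTower ℂ (MvPolynomial ι ℂ) K] :
    Submodule ℂ K := LinearMap.range (alh (ι := ι) K).toLinearMap

theorem mem_Rs {f : K} : f ∈ Rs ι K ↔ ∃ p : MvPolynomial ι ℂ, al K p = f := Iff.rfl

theorem Rs_al (p : MvPolynomial ι ℂ) : al K p ∈ Rs ι K := ⟨p, rfl⟩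

theorem Rs_mul {f g : K} (hf : f ∈ Rs ι K) (hg : g ∈ Rs ι K) : f * g ∈ Rs ι K := by
  obtain ⟨p, rfl⟩ := hf
  obtain ⟨q, rfl⟩ := hg
  exact ⟨p * q, by simp⟩

theorem Rs_one : (1 : K) ∈ Rs ι K := ⟨1, by simp⟩

theorem Rs_dK {f : K} (hf : f ∈ Rs ι K) (y : V) : dK b K y f ∈ Rs ι K := by
  obtain ⟨p, rfl⟩ := hf
  exact ⟨dR b y p, (dK_al b K y p).symm⟩

/-- a rational function all of whose derivatives are polynomial is polynomial -/
theorem Rs_of_dK {f : K} (h : ∀ y, dK b K y f ∈ Rs ι K) : f ∈ Rs ι K := by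
  set q : MvPolynomial ι ℂ := (IsFractionRing.den (MvPolynomial ι ℂ) f : MvPolynomial ι ℂ) with hqdef
  set p : MvPolynomial ι ℂ := IsFractionRing.num (MvPolynomial ι ℂ) f with hpdef
  have hq : q ≠ 0 := nonZeroDivisors.ne_zero (IsFractionRing.den (MvPolynomial ι ℂ) f).2
  have hq' := al_ne_zero (K := K) hq
  have hf : f * al K q = al K p := by
    have := IsFractionRing.mk'_num_den (MvPolynomial ι ℂ) f
    rw [IsLocalization.mk'_eq_iff_eq_mul] at this
    rw [← al_def, ← al_def, this]
  have hrel : IsRelPrime p q := IsFractionRing.num_den_reduced (MvPolynomial ι ℂ) f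
  have hdq : ∀ y, dR b y q = 0 := by
    intro y
    obtain ⟨r, hr⟩ := mem_Rs K |>.1 (h y)
    have h1 := congrArg (dK b K y) hf
    rw [dK_mul, dK_al, dK_al, ← hr] at h1
    have h2 : al K (p * dR b y q) = al K (q * (dR b y p - r * q)) := by
      simp only [map_mul, map_sub, ← h1, ← hf]; ring
    have h3 : q ∣ p * dR b y q := ⟨_, al_inj K h2⟩
    have h4 : q ∣ dR b y q := hrel.symm.dvd_of_dvd_mul_left h3
    rcases dR_degree b y q with h0 | h0
    · exact h0
    · by_contra hne
      obtain ⟨t, ht⟩ := h4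
      have ht0 : t ≠ 0 := by rintro rfl; simp at ht; exact hne ht
      rw [ht, totalDegree_mul_of_isDomain hq ht0] at h0
      omega
  obtain ⟨c, hc⟩ := eq_C_of_dR b q hdq
  have hc0 : c ≠ 0 := by rintro rfl; simp at hc; exact hq hc
  refine ⟨C c⁻¹ * p, ?_⟩
  change al K _ = f
  rw [map_mul, ← hf, hc, al_C, al_C]
  rw [map_inv₀]
  have : (algebraMap ℂ K c) ≠ 0 := by simpa using hc0
  field_simp

theorem const_of_dK {f : K} (h : ∀ y, dK b K y f = 0) : ∃ c : ℂ, f = algebraMap ℂ K c := by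
  obtain ⟨p, rfl⟩ := mem_Rs K |>.1 (Rs_of_dK b K (f := f) (fun y => by rw [h y]; exact Submodule.zero_mem _))
  obtain ⟨c, rfl⟩ := eq_C_of_dR b p (fun y => by
    have := h y
    rw [dK_al] at this
    exact al_inj K (by simpa using this))
  exact ⟨c, al_C K c⟩

end Frac

end KZ

namespace KZ

section Loc

open MvPolynomial

variable {ι : Type*} [Fintype ι] (b : Module.Basis ι ℂ V)
variable (K : Type*) [Field K] [Algebra (MvPolynomial ι ℂ) K] [IsFractionRing (MvPolynomial ι ℂ) K]
  [Algebra ℂ K] [IsScalarTower ℂ (MvPolynomial ι ℂ) K]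

/-- rational functions vanishing to order at least `k` along `π = 0` -/
def Ok {π : MvPolynomial ι ℂ} (hπ : Prime π) (k : ℕ) : Submodule ℂ K where
  carrier := {f | ∃ a c : MvPolynomial ι ℂ, ¬ π ∣ c ∧ f * al K c = al K (π ^ k * a)}
  add_mem' := by
    rintro f g ⟨a, c, hc, h⟩ ⟨a', c', hc', h'⟩
    refine ⟨a * c' + a' * c, c * c', fun hd => (hπ.dvd_or_dvd hd).elim hc hc', ?_⟩
    simp only [map_mul, map_add] at h h' ⊢
    linear_combination h * al K c' + h' * al K c
  zero_mem' := ⟨0, 1, fun h => hπ.not_unit (isUnit_of_dvd_one h), by simp⟩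
  smul_mem' := by
    rintro z f ⟨a, c, hc, h⟩
    refine ⟨C z * a, c, hc, ?_⟩
    rw [Algebra.smul_def]
    simp only [map_mul, al_C] at h ⊢
    linear_combination h * algebraMap ℂ K z

variable {K} {π : MvPolynomial ι ℂ} (hπ : Prime π)

theorem Ok_al (p : MvPolynomial ι ℂ) : al K p ∈ Ok K hπ 0 :=
  ⟨p, 1, fun h => hπ.not_unit (isUnit_of_dvd_one h), by simp⟩

theorem Ok_one : (1 : K) ∈ Ok K hπ 0 := by simpa using Ok_al (K := K) hπ 1

theorem Ok_mul {j k : ℕ} {f g : K} (hf : f ∈ Ok K hπ j) (hg : g ∈ Ok K hπ k) :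
    f * g ∈ Ok K hπ (j + k) := by
  obtain ⟨a, c, hc, h⟩ := hf
  obtain ⟨a', c', hc', h'⟩ := hg
  refine ⟨a * a', c * c', fun hd => (hπ.dvd_or_dvd hd).elim hc hc', ?_⟩
  simp only [map_mul, map_pow] at h h' ⊢
  rw [pow_add]
  linear_combination h * g * al K c' + h' * al K π ^ j * al K a

theorem Ok_mul0 {k : ℕ} {f g : K} (hf : f ∈ Ok K hπ 0) (hg : g ∈ Ok K hπ k) :
    f * g ∈ Ok K hπ k := by
  simpa using Ok_mul hπ hf hg

theorem Ok_anti {j k : ℕ} (h : k ≤ j) : Ok K hπ j ≤ Ok K hπ k := by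
  rintro f ⟨a, c, hc, h'⟩
  refine ⟨π ^ (j - k) * a, c, hc, ?_⟩
  rw [h', ← mul_assoc, ← pow_add]
  congr 3; omega

theorem Ok_pow (k : ℕ) : al K π ^ k ∈ Ok K hπ k :=
  ⟨1, 1, fun h => hπ.not_unit (isUnit_of_dvd_one h), by simp⟩

theorem Ok_pi : al K π ∈ Ok K hπ 1 := by simpa using Ok_pow (K := K) hπ 1

theorem Ok_iff {k : ℕ} {f : K} : f ∈ Ok K hπ k ↔ ∃ g ∈ Ok K hπ 0, f = al K π ^ k * g := by
  constructor
  · rintro ⟨a, c, hc, h⟩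
    have hc0 : al K c ≠ 0 := al_ne_zero (by rintro rfl; exact hc (dvd_zero _))
    refine ⟨al K a / al K c, ⟨a, c, hc, ?_⟩, ?_⟩
    · simp [div_mul_cancel₀ _ hc0]
    · field_simp
      simpa [mul_comm] using h
  · rintro ⟨g, hg, rfl⟩
    simpa using Ok_mul hπ (Ok_pow hπ k) hg

theorem Ok_cancel {j k : ℕ} {f : K} (h : al K π ^ j * f ∈ Ok K hπ (j + k)) : f ∈ Ok K hπ k := by
  obtain ⟨g, hg, h⟩ := (Ok_iff hπ).1 h
  refine (Ok_iff hπ).2 ⟨g, hg, ?_⟩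
  have : al K π ^ j ≠ 0 := pow_ne_zero _ (al_ne_zero hπ.ne_zero)
  apply mul_left_cancel₀ this
  rw [h]; ring

theorem Ok_inv {q : MvPolynomial ι ℂ} (hq : ¬ π ∣ q) : (al K q)⁻¹ ∈ Ok K hπ 0 := by
  refine ⟨1, q, hq, ?_⟩
  rw [inv_mul_cancel₀ (al_ne_zero (by rintro rfl; exact hq (dvd_zero _)))]
  simp

theorem Ok_al_dvd {k : ℕ} {p : MvPolynomial ι ℂ} (h : al K p ∈ Ok K hπ k) : π ^ k ∣ p := by
  obtain ⟨a, c, hc, h⟩ := h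
  rw [← map_mul] at h
  have h1 := al_inj K h
  exact hπ.pow_dvd_of_dvd_mul_right k hc ⟨a, h1⟩

theorem Ok_const {c : ℂ} (h : algebraMap ℂ K c ∈ Ok K hπ 1) : c = 0 := by
  rw [← al_C (ι := ι)] at h
  have h1 := Ok_al_dvd hπ h
  rw [pow_one] at h1
  by_contra hc
  apply hπ.not_unit
  exact isUnit_of_dvd_unit h1 ((Ne.isUnit hc).map C)

theorem Ok_Rs {f : K} (hf : f ∈ Rs ι K) : f ∈ Ok K hπ 0 := by
  obtain ⟨p, rfl⟩ := hf
  exact Ok_al hπ p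

theorem Ok_dK0 (y : V) {f : K} (hf : f ∈ Ok K hπ 0) : dK b K y f ∈ Ok K hπ 0 := by
  obtain ⟨a, c, hc, h⟩ := hf
  refine ⟨dR b y a * c - a * dR b y c, c * c, fun hd => (hπ.dvd_or_dvd hd).elim hc hc, ?_⟩
  rw [pow_zero, one_mul] at h ⊢
  have h1 := congrArg (dK b K y) h
  rw [dK_mul, dK_al, dK_al] at h1
  simp only [map_mul, map_sub]
  linear_combination h1 * al K c - al K (dR b y c) * h

theorem dK_pow (y : V) (f : K) (k : ℕ) :
    dK b K y (f ^ (k + 1)) = (k + 1) * f ^ k * dK b K y f := by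
  induction k with
  | zero => simp
  | succ k ih => rw [pow_succ, dK_mul, ih]; push_cast; ring

theorem Ok_Rs_div {k : ℕ} {f : K} (hf : f ∈ Ok K hπ 0) (h : al K π ^ k * f ∈ Rs ι K) :
    f ∈ Rs ι K := by
  obtain ⟨r, hr⟩ := (mem_Rs K).1 h
  have h1 : al K r ∈ Ok K hπ k := by
    rw [hr]; exact (Ok_iff hπ).2 ⟨f, hf, rfl⟩
  obtain ⟨q, rfl⟩ := Ok_al_dvd hπ h1
  refine ⟨q, ?_⟩
  change al K q = f
  have : al K π ^ k ≠ 0 := pow_ne_zero _ (al_ne_zero hπ.ne_zero)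
  apply mul_left_cancel₀ this
  rw [← hr]; simp

theorem Rs_of_prod {I : Type*} {p : I → MvPolynomial ι ℂ} (hp : ∀ i, Prime (p i)) (s : Finset I)
    {k : ℕ} {f : K} (hf : ∀ i ∈ s, f ∈ Ok K (hp i) 0) (h : al K (∏ i ∈ s, p i) ^ k * f ∈ Rs ι K) :
    f ∈ Rs ι K := by
  classical
  induction s using Finset.induction_on with
  | empty => simpa using h
  | insert i s hi ih =>
    apply ih (fun j hj => hf j (Finset.mem_insert_of_mem hj))
    apply Ok_Rs_div (hp i) (k := k)
    · refine Ok_mul0 (hp i) ?_ (hf i (Finset.mem_insert_self _ _))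
      rw [← map_pow]; exact Ok_al _ _
    · rw [Finset.prod_insert hi, map_mul, mul_pow, mul_assoc] at h
      exact h

section lin

variable {f : Module.Dual ℂ V} (hf : Prime (lin b f))

theorem Ok_euler {y : V} (hy : f y = 1) {k : ℕ} {g : K} (hg : g ∈ Ok K hf k) :
    al K (lin b f) * dK b K y g - (k : ℂ) • g ∈ Ok K hf (k + 1) := by
  obtain ⟨g, hg1, rfl⟩ := (Ok_iff hf).1 hg
  refine (Ok_iff hf).2 ⟨dK b K y g, Ok_dK0 b hf y hg1, ?_⟩
  rw [dK_mul, Algebra.smul_def]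
  cases k with
  | zero =>
    have : dK b K y 1 = 0 := by
      have := dK_al b K y 1
      rwa [Derivation.map_one_eq_zero, map_zero, map_one] at this
    simp [this]
  | succ k =>
    rw [dK_pow, dK_al, dR_lin, hy]
    simp
    ring

theorem Ok_dK_h {y : V} (hy : f y = 0) {k : ℕ} {g : K} (hg : g ∈ Ok K hf k) :
    dK b K y g ∈ Ok K hf k := by
  obtain ⟨g, hg1, rfl⟩ := (Ok_iff hf).1 hg
  refine (Ok_iff hf).2 ⟨dK b K y g, Ok_dK0 b hf y hg1, ?_⟩
  rw [dK_mul]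
  cases k with
  | zero =>
    have : dK b K y 1 = 0 := by
      have := dK_al b K y 1
      rwa [Derivation.map_one_eq_zero, map_zero, map_one] at this
    simp [this]
  | succ k =>
    rw [dK_pow, dK_al, dR_lin, hy]
    simp

variable {u u' : V →ₗ[ℂ] V} (h : u ∘ₗ u' = LinearMap.id) (hu : ∀ x, f x = 0 → u x = x)

include hu in
theorem Ok_sbK0 {g : K} (hg : g ∈ Ok K hf 0) :
    sbK b K u u' h g ∈ Ok K hf 0 ∧ sbK b K u u' h g - g ∈ Ok K hf 1 := by
  obtain ⟨a, c, hc, hac⟩ := hg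
  rw [pow_zero, one_mul] at hac
  have h1 := congrArg (sbK b K u u' h) hac
  rw [map_mul, sbK_al, sbK_al] at h1
  obtain ⟨c', hc'⟩ := lin_dvd_sbs_sub b hu c
  obtain ⟨a', ha'⟩ := lin_dvd_sbs_sub b hu a
  have hnd : ¬ lin b f ∣ sbs b u c := by
    intro hd
    apply hc
    have : c = sbs b u c - lin b f * c' := by rw [← hc']; ring
    rw [this]
    exact dvd_sub hd (dvd_mul_right _ _)
  refine ⟨⟨sbs b u a, sbs b u c, hnd, by simpa using h1⟩,
    ⟨a' * c - a * c', c * sbs b u c, fun hd => (hf.dvd_or_dvd hd).elim hc hnd, ?_⟩⟩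
  have e1 : al K (sbs b u a) - al K a = al K (lin b f) * al K a' := by
    rw [← map_sub, ha', map_mul]
  have e2 : al K (sbs b u c) - al K c = al K (lin b f) * al K c' := by
    rw [← map_sub, hc', map_mul]
  simp only [map_mul, map_sub, pow_one]
  linear_combination h1 * al K c - hac * al K (sbs b u c) + e1 * al K c - e2 * al K a

include hu in
theorem Ok_sbK {c : ℂ} (hc : f ∘ₗ u = c • f) {k : ℕ} {g : K} (hg : g ∈ Ok K hf k) :
    sbK b K u u' h g - c ^ k • g ∈ Ok K hf (k + 1) := by
  obtain ⟨g, hg1, rfl⟩ := (Ok_iff hf).1 hg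
  obtain ⟨-, h2⟩ := Ok_sbK0 b hf h hu hg1
  have h3 := (Ok K hf (k + 1)).smul_mem (c ^ k) (Ok_mul hf (Ok_pow hf k) h2)
  convert h3 using 1
  rw [map_mul, map_pow, sbK_al, sbs_lin, hc, lin_smul, map_mul, al_C]
  simp only [Algebra.smul_def, map_pow]
  ring

include hu in
theorem Ok_sbK_mem {c : ℂ} (hc : f ∘ₗ u = c • f) {k : ℕ} {g : K} (hg : g ∈ Ok K hf k) :
    sbK b K u u' h g ∈ Ok K hf k := by
  have := (Ok K hf k).add_mem (Ok_anti hf (Nat.le_succ k) (Ok_sbK b hf h hu hc hg))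
    ((Ok K hf k).smul_mem (c ^ k) hg)
  simpa using this

end lin

/-! ### localization at a polynomial -/

/-- fractions with denominator a power of `δ` -/
def Rd (K : Type*) [Field K] [Algebra (MvPolynomial ι ℂ) K] [IsFractionRing (MvPolynomial ι ℂ) K]
    [Algebra ℂ K] [IsScalarTower ℂ (MvPolynomial ι ℂ) K] (δ : MvPolynomial ι ℂ) :
    Submodule ℂ K where
  carrier := {f | ∃ k : ℕ, al K δ ^ k * f ∈ Rs ι K}
  add_mem' := by
    rintro f g ⟨k, h⟩ ⟨j, h'⟩
    refine ⟨k + j, ?_⟩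
    have h1 := Rs_mul K (Rs_al K (δ ^ j)) h
    have h2 := Rs_mul K (Rs_al K (δ ^ k)) h'
    convert (Rs ι K).add_mem h1 h2 using 1
    simp only [map_pow]; ring
  zero_mem' := ⟨0, by simp⟩
  smul_mem' := by
    rintro c f ⟨k, h⟩
    exact ⟨k, by rw [mul_smul_comm]; exact (Rs ι K).smul_mem c h⟩

variable {δ : MvPolynomial ι ℂ}

theorem Rd_Rs {f : K} (hf : f ∈ Rs ι K) : f ∈ Rd K δ := ⟨0, by simpa using hf⟩

theorem Rd_mul {f g : K} (hf : f ∈ Rd K δ) (hg : g ∈ Rd K δ) : f * g ∈ Rd K δ := by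
  obtain ⟨k, h⟩ := hf
  obtain ⟨j, h'⟩ := hg
  refine ⟨k + j, ?_⟩
  convert Rs_mul K h h' using 1
  ring

theorem Rd_inv {q : MvPolynomial ι ℂ} (hδ : δ ≠ 0) (hq : q ∣ δ) : (al K q)⁻¹ ∈ Rd K δ := by
  obtain ⟨r, rfl⟩ := hq
  refine ⟨1, r, ?_⟩
  have : al K q ≠ 0 := al_ne_zero (left_ne_zero_of_mul hδ)
  change al K r = _
  rw [map_mul]; field_simp

theorem Rd_dK (hδ : δ ≠ 0) (y : V) {f : K} (hf : f ∈ Rd K δ) : dK b K y f ∈ Rd K δ := by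
  obtain ⟨k, h⟩ := hf
  refine ⟨k + 1 + 1, ?_⟩
  have h1 := Rs_dK b K h y
  have h2 := Rs_mul K (Rs_al K (δ * δ)) h1
  have h3 := Rs_mul K (Rs_al K (C (k : ℂ) * (dR b y δ * δ))) h
  convert (Rs ι K).sub_mem h2 h3 using 1
  rw [dK_mul]
  cases k with
  | zero =>
    have : dK b K y 1 = 0 := by
      have := dK_al b K y 1
      rwa [Derivation.map_one_eq_zero, map_zero, map_one] at this
    simp [this]; left; ring
  | succ k =>
    rw [dK_pow, dK_al]
    simp
    ring

theorem Rd_prod {I : Type*} {p : I → MvPolynomial ι ℂ} (hp : ∀ i, Prime (p i)) (s : Finset I)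
    {f : K} (hf : ∀ i ∈ s, f ∈ Ok K (hp i) 0) (h : f ∈ Rd K (∏ i ∈ s, p i)) :
    f ∈ Rs ι K := by
  obtain ⟨k, h⟩ := h
  exact Rs_of_prod hp s hf h

theorem Rd_Ok (hδ : ¬ π ∣ δ) {f : K} (h : f ∈ Rd K δ) : f ∈ Ok K hπ 0 := by
  obtain ⟨k, r, hr⟩ := h
  refine ⟨r, δ ^ k, fun hd => hδ (hπ.dvd_of_dvd_pow hd), ?_⟩
  change al K r = _ at hr
  rw [pow_zero, one_mul, hr, map_pow, mul_comm]

end Loc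

end KZ

namespace KZ

section Hyp

variable {W : Subgroup (V →ₗ[ℂ] V)ˣ}

theorem tl_mul (w w' : W) : toLin W (w * w') = toLin W w ∘ₗ toLin W w' := rfl

theorem tl_one : toLin W 1 = LinearMap.id := rfl

theorem tl_inv (w : W) : toLin W w ∘ₗ toLin W w⁻¹ = LinearMap.id := by
  rw [← tl_mul, mul_inv_cancel, tl_one]

theorem tl_inv' (w : W) : toLin W w⁻¹ ∘ₗ toLin W w = LinearMap.id := by
  rw [← tl_mul, inv_mul_cancel, tl_one]

theorem tl_inv_apply (w : W) (x : V) : toLin W w (toLin W w⁻¹ x) = x :=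
  LinearMap.congr_fun (tl_inv w) x

theorem tl_inv_apply' (w : W) (x : V) : toLin W w⁻¹ (toLin W w x) = x :=
  LinearMap.congr_fun (tl_inv' w) x

theorem tl_ext {w w' : W} (h : ∀ x, toLin W w x = toLin W w' x) : w = w' := by
  apply Subtype.ext
  apply Units.ext
  exact LinearMap.ext h

theorem mem_fixedSpace (w : W) (x : V) :
    x ∈ fixedSpace (w : (V →ₗ[ℂ] V)ˣ) ↔ toLin W w x = x := by
  rw [fixedSpace, LinearMap.mem_ker, LinearMap.sub_apply, sub_eq_zero]
  rfl

theorem fixedSpace_conj (w t : W) : fixedSpace ((w * t * w⁻¹ : W) : (V →ₗ[ℂ] V)ˣ) =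
    (fixedSpace (t : (V →ₗ[ℂ] V)ˣ)).map (toLin W w) := by
  ext x
  rw [mem_fixedSpace, Submodule.mem_map, tl_mul, tl_mul]
  constructor
  · intro h
    refine ⟨toLin W w⁻¹ x, ?_, tl_inv_apply w x⟩
    rw [mem_fixedSpace]
    have := congrArg (toLin W w⁻¹) h
    simpa [tl_inv_apply'] using this
  · rintro ⟨y, hy, rfl⟩
    rw [mem_fixedSpace] at hy
    simp [tl_inv_apply', hy]

theorem tl_injective (w : W) : Function.Injective (toLin W w) :=
  Function.LeftInverse.injective (g := toLin W w⁻¹) (tl_inv_apply' w)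

theorem refls_conj {t : W} (w : W) (ht : t ∈ refls W) : w * t * w⁻¹ ∈ refls W := by
  unfold refls IsReflection at *
  simp only [Set.mem_setOf_eq] at *
  rw [fixedSpace_conj, ht]
  congr 1
  exact (Submodule.equivMapOfInjective _ (tl_injective w) _).finrank_eq

/-- hyperplanes -/
abbrev Ar (W : Subgroup (V →ₗ[ℂ] V)ˣ) := {H : Submodule ℂ V // H ∈ arrangement W}

/-- action on hyperplanes -/
def mv (w : W) (H : Ar W) : Ar W :=
  ⟨H.1.map (toLin W w), by
    obtain ⟨t, ht, h⟩ := H.2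
    exact ⟨w * t * w⁻¹, refls_conj w ht, by rw [fixedSpace_conj, h]⟩⟩

theorem mv_mul (w w' : W) (H : Ar W) : mv (w * w') H = mv w (mv w' H) := by
  apply Subtype.ext
  simp only [mv, tl_mul, Submodule.map_comp]

theorem mv_one (H : Ar W) : mv (1 : W) H = H := by
  apply Subtype.ext
  simp only [mv, tl_one, Submodule.map_id]

theorem mv_inv (w : W) (H : Ar W) : mv w (mv w⁻¹ H) = H := by
  rw [← mv_mul, mul_inv_cancel, mv_one]

theorem mv_inv' (w : W) (H : Ar W) : mv w⁻¹ (mv w H) = H := by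
  rw [← mv_mul, inv_mul_cancel, mv_one]

/-- the hyperplane of a reflection -/
def hyp (t : refls W) : Ar W := ⟨fixedSpace (t.1 : (V →ₗ[ℂ] V)ˣ), t.1, t.2, rfl⟩

theorem hyp_surj : Function.Surjective (hyp (W := W)) := by
  rintro ⟨H, t, ht, rfl⟩
  exact ⟨⟨t, ht⟩, rfl⟩

instance [Finite W] : Finite (Ar W) := Finite.of_surjective _ hyp_surj

theorem ptStab_mv (w : W) (H : Ar W) (s : W) :
    s ∈ ptStab W (mv w H).1 ↔ w⁻¹ * s * w ∈ ptStab W H.1 := by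
  simp only [ptStab, Set.mem_setOf_eq, mv, Submodule.mem_map, forall_exists_index, and_imp,
    forall_apply_eq_imp_iff₂, tl_mul, LinearMap.comp_apply]
  refine forall₂_congr fun x _ => ?_
  constructor
  · intro h; rw [h, tl_inv_apply']
  · intro h
    have := congrArg (toLin W w) h
    rwa [tl_inv_apply] at this

variable [FiniteDimensional ℂ V]

theorem exists_frm (H : Ar W) : ∃ f : Module.Dual ℂ V, f ≠ 0 ∧ LinearMap.ker f = H.1 := by
  obtain ⟨H, t, ht, rfl⟩ := H
  have ht' : Module.finrank ℂ V = Module.finrank ℂ (fixedSpace (t : (V →ₗ[ℂ] V)ˣ)) + 1 := ht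
  have hne : fixedSpace (t : (V →ₗ[ℂ] V)ˣ) < ⊤ := by
    rw [lt_top_iff_ne_top]
    intro h
    rw [h, finrank_top] at ht'
    omega
  obtain ⟨f, hf0, hf⟩ := Submodule.exists_le_ker_of_lt_top _ hne
  refine ⟨f, hf0, ?_⟩
  symm
  apply Submodule.eq_of_le_of_finrank_eq hf
  have := Module.Dual.finrank_ker_add_one_of_ne_zero hf0
  omega

/-- linear form defining a hyperplane -/
def frm (H : Ar W) : Module.Dual ℂ V := (exists_frm H).choose

theorem frm_ne (H : Ar W) : frm H ≠ 0 := (exists_frm H).choose_spec.1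

theorem frm_iff (H : Ar W) (x : V) : frm H x = 0 ↔ x ∈ H.1 := by
  rw [← (exists_frm H).choose_spec.2]; rfl

theorem frm_prop (H : Ar W) (f : Module.Dual ℂ V) (hf : ∀ x, frm H x = 0 → f x = 0) :
    ∃ c : ℂ, f = c • frm H := by
  obtain ⟨y, hy⟩ : ∃ y, frm H y ≠ 0 := by
    by_contra h; push Not at h; exact frm_ne H (LinearMap.ext h)
  refine ⟨f y / frm H y, ?_⟩
  ext x
  have := hf (x - (frm H x / frm H y) • y) (by simp [div_mul_cancel₀ _ hy])
  simp only [map_sub, map_smul, smul_eq_mul, sub_eq_zero] at this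
  rw [this]; simp; field_simp

theorem frm_ex (H : Ar W) : ∃ y, frm H y = 1 := by
  obtain ⟨y, hy⟩ : ∃ y, frm H y ≠ 0 := by
    by_contra h; push Not at h; exact frm_ne H (LinearMap.ext h)
  exact ⟨(frm H y)⁻¹ • y, by simp [hy]⟩

theorem frm_sep {H H' : Ar W} (h : H ≠ H') : ∃ x, frm H x = 0 ∧ frm H' x ≠ 0 := by
  by_contra hc
  push Not at hc
  obtain ⟨c, hc'⟩ := frm_prop H (frm H') hc
  have hc0 : c ≠ 0 := by rintro rfl; exact frm_ne H' (by simpa using hc')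
  apply h
  apply Subtype.ext
  ext x
  rw [← frm_iff, ← frm_iff, hc']
  simp [hc0]

/-- pointwise stabilizer as a subgroup -/
def stb (H : Ar W) : Subgroup W where
  carrier := ptStab W H.1
  mul_mem' := by
    intro s t hs ht x hx
    rw [tl_mul, LinearMap.comp_apply, ht x hx, hs x hx]
  one_mem' := fun x _ => rfl
  inv_mem' := by
    intro s hs x hx
    have := tl_inv_apply' s x
    rwa [hs x hx] at this

theorem mem_stb (H : Ar W) (s : W) : s ∈ stb H ↔ ∀ x, frm H x = 0 → toLin W s x = x := by
  simp only [frm_iff]; rfl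

theorem stb_frm (H : Ar W) {y : V} (hy : frm H y = 1) {s : W} (hs : s ∈ stb H) (x : V) :
    frm H (toLin W s x) = frm H (toLin W s y) * frm H x := by
  rw [mem_stb] at hs
  have h1 := hs (x - frm H x • y) (by simp [hy])
  have h2 : toLin W s x = frm H x • toLin W s y + (x - frm H x • y) := by
    rw [← h1]; simp
  have h3 := congrArg (frm H) h2
  simpa [hy, mul_comm] using h3

/-- local cyclic data at a hyperplane -/
theorem exists_loc [Finite W] (H : Ar W) : ∃ (s : W) (ξ : ℂ) (y : V), frm H y = 1 ∧
    toLin W s y = ξ • y ∧ IsPrimitiveRoot ξ (orderOf s) ∧ stb H = Subgroup.zpowers s := by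
  obtain ⟨y, hy⟩ := frm_ex H
  let χ : stb H →* ℂ :=
    { toFun := fun s => frm H (toLin W s.1 y)
      map_one' := by simpa [tl_one] using hy
      map_mul' := fun s t => by
        change frm H (toLin W (s.1 * t.1) y) = _
        rw [tl_mul, LinearMap.comp_apply, stb_frm H hy s.2] }
  have hχ : ∀ s, χ s = frm H (toLin W s.1 y) := fun s => rfl
  have hinj1 : ∀ s : stb H, χ s = 1 → s = 1 := by
    intro s hs
    set h := toLin W s.1 y - y with hh
    have hh0 : frm H h = 0 := by rw [hh, map_sub, ← hχ, hs, hy, sub_self]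
    have hsh : toLin W s.1 h = h := (mem_stb H s.1).1 s.2 h hh0
    have hpow : ∀ n : ℕ, toLin W (s.1 ^ n) y = y + (n : ℂ) • h := by
      intro n
      induction n with
      | zero => simp [tl_one]
      | succ n ih =>
        rw [pow_succ', tl_mul, LinearMap.comp_apply, ih, map_add, map_smul, hsh]
        have : toLin W s.1 y = y + h := by rw [hh]; abel
        rw [this]; push_cast; module
    have h1 := hpow (orderOf s.1)
    rw [pow_orderOf_eq_one, tl_one, LinearMap.id_apply] at h1
    have h2 : (orderOf s.1 : ℂ) • h = 0 := by simpa using h1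
    have h3 : h = 0 := by
      refine (smul_eq_zero.1 h2).resolve_left ?_
      exact_mod_cast (orderOf_pos s.1).ne'
    apply Subtype.ext
    apply tl_ext
    intro x
    have h4 := (mem_stb H s.1).1 s.2 (x - frm H x • y) (by simp [hy])
    rw [map_sub, map_smul] at h4
    have h5 : toLin W s.1 y = y := by rw [← sub_eq_zero]; exact h3
    rw [h5] at h4
    simpa [tl_one] using h4
  have hinj : Function.Injective χ := by
    intro s t hst
    have : χ (s * t⁻¹) = 1 := by
      have h1 : χ (t * t⁻¹) = 1 := by rw [mul_inv_cancel, map_one]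
      rw [map_mul] at h1 ⊢
      rw [hst, h1]
    exact mul_inv_eq_one.1 (hinj1 _ this)
  have hcyc : IsCyclic (stb H) := isCyclic_of_injective_ringHom χ hinj
  obtain ⟨s, hs⟩ := hcyc.exists_generator
  have hzp : stb H = Subgroup.zpowers s.1 := by
    apply le_antisymm
    · intro t ht
      obtain ⟨n, hn⟩ := Subgroup.mem_zpowers_iff.1 (hs ⟨t, ht⟩)
      rw [Subgroup.mem_zpowers_iff]
      exact ⟨n, by simpa using congrArg Subtype.val hn⟩
    · rw [Subgroup.zpowers_le]; exact s.2
  have hord : orderOf (χ s) = orderOf s.1 := by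
    rw [orderOf_injective χ hinj, Subgroup.orderOf_coe]
  have hne : χ s ≠ 1 := by
    intro h1
    have hs1 := hinj1 s h1
    obtain ⟨t, ht, hHt⟩ := H.2
    have htm : t ∈ stb H := by
      intro x hx
      rw [hHt] at hx
      exact (mem_fixedSpace t x).1 hx
    have : t = 1 := by
      obtain ⟨n, hn⟩ := Subgroup.mem_zpowers_iff.1 (hs ⟨t, htm⟩)
      rw [hs1, one_zpow] at hn
      exact (congrArg Subtype.val hn).symm
    apply frm_ne H
    ext x
    rw [LinearMap.zero_apply, frm_iff, hHt, mem_fixedSpace, this]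
    rfl
  have hne' : χ s - 1 ≠ 0 := sub_ne_zero.2 hne
  set h := toLin W s.1 y - χ s • y with hh
  have hh0 : frm H h = 0 := by rw [hh, map_sub, map_smul, ← hχ, hy]; simp
  have hsh : toLin W s.1 h = h := (mem_stb H s.1).1 s.2 h hh0
  refine ⟨s.1, χ s, y + (χ s - 1)⁻¹ • h, by simp [hy, hh0], ?_, ?_, hzp⟩
  · have : toLin W s.1 y = χ s • y + h := by rw [hh]; abel
    rw [map_add, map_smul, hsh, this]
    have e1 : (1 : ℂ) + (χ s - 1)⁻¹ = χ s * (χ s - 1)⁻¹ := by field_simp; ring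
    rw [smul_add, smul_smul, ← e1, add_smul, one_smul, add_assoc]
  · rw [← hord]; exact IsPrimitiveRoot.orderOf _

end Hyp

end KZ

namespace KZ

section Conn

open MvPolynomial

variable [FiniteDimensional ℂ V] {W : Subgroup (V →ₗ[ℂ] V)ˣ} [Fintype W]
variable {ι : Type*} [Fintype ι] (b : Module.Basis ι ℂ V)
variable (K : Type*) [Field K] [Algebra (MvPolynomial ι ℂ) K] [IsFractionRing (MvPolynomial ι ℂ) K]
  [Algebra ℂ K] [IsScalarTower ℂ (MvPolynomial ι ℂ) K]

/-- linear form of a hyperplane, as a polynomial -/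
def pl (H : Ar W) : MvPolynomial ι ℂ := lin b (frm H)

theorem pl_prime (H : Ar W) : Prime (pl b H) := lin_prime b (frm_ne H)

theorem pl_ne (H : Ar W) : al K (pl b H) ≠ 0 := al_ne_zero (pl_prime b H).ne_zero

theorem pl_not_dvd {H H' : Ar W} (h : H ≠ H') : ¬ pl b H ∣ pl b H' := by
  obtain ⟨x, hx, hx'⟩ := frm_sep h
  exact not_lin_dvd b hx hx'

/-- action of the group on functions -/
def act (w : W) : K →ₐ[ℂ] K := sbK b K (toLin W w⁻¹) (toLin W w) (tl_inv' w)

theorem act_al (w : W) (p : MvPolynomial ι ℂ) : act b K w (al K p) = al K (sbs b (toLin W w⁻¹) p) :=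
  sbK_al _ _ _ _ _ _

theorem act_mul (w w' : W) (f : K) : act b K (w * w') f = act b K w (act b K w' f) := by
  have : act b K (w * w') = (act b K w).comp (act b K w') := by
    apply algHomK_ext (ι := ι)
    intro p
    simp only [AlgHom.comp_apply, act_al, sbs_comp, mul_inv_rev, tl_mul]
  rw [this]; rfl

theorem act_one (f : K) : act b K (1 : W) f = f := by
  have : act b K (1 : W) = AlgHom.id ℂ K := by
    apply algHomK_ext (ι := ι)
    intro p
    simp only [act_al, AlgHom.id_apply, inv_one, tl_one, sbs_id]
  rw [this]; rfl

theorem act_dK (w : W) (y : V) (f : K) :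
    act b K w (dK b K y f) = dK b K (toLin W w y) (act b K w f) := sbK_dK _ _ _ _ _ _ _

/-- coefficientwise action -/
def ca (w : W) : MonoidAlgebra K W →ₗ[ℂ] MonoidAlgebra K W := cmap (act b K w).toLinearMap

theorem ca_mul (w : W) (F G : MonoidAlgebra K W) : ca b K w (F * G) = ca b K w F * ca b K w G :=
  cmap_mul _ _ _

theorem ca_cst (w : W) (a : MonoidAlgebra ℂ W) : ca b K w (cst K a) = cst K a := cmap_cst _ _

theorem ca_smul (w : W) (a : K) (F : MonoidAlgebra K W) :
    ca b K w (a • F) = act b K w a • ca b K w F := cmap_smul _ _ _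

theorem ca_el (w u : W) : ca b K w (el K u) = el K u := by
  rw [← cst_el, ca_cst]

theorem ca_ca (w w' : W) (F : MonoidAlgebra K W) :
    ca b K (w * w') F = ca b K w (ca b K w' F) := by
  apply ga_ext; intro u; simp [ca, act_mul]

theorem ca_one (F : MonoidAlgebra K W) : ca b K (1 : W) F = F := by
  apply ga_ext; intro u; simp [ca, act_one]

/-- coefficientwise derivative -/
def cd (y : V) : MonoidAlgebra K W →ₗ[ℂ] MonoidAlgebra K W := cmap (dK b K y)

theorem ca_cd (w : W) (y : V) (F : MonoidAlgebra K W) :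
    ca b K w (cd b K y F) = cd b K (toLin W w y) (ca b K w F) := by
  apply ga_ext; intro u; simp [ca, cd, act_dK]

theorem cd_mul (y : V) (F G : MonoidAlgebra K W) :
    cd b K y (F * G) = cd b K y F * G + F * cd b K y G := cmap_der _ (dK_mul b K y) _ _

theorem cd_smul (y : V) (a : K) (F : MonoidAlgebra K W) :
    cd b K y (a • F) = dK b K y a • F + a • cd b K y F := cmap_smul_der _ (dK_mul b K y) _ _

theorem cd_cst_mul (y : V) (a : MonoidAlgebra ℂ W) (F : MonoidAlgebra K W) :
    cd b K y (cst K a * F) = cst K a * cd b K y F := cmap_cst_mul _ _ _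

theorem cd_el_mul (y : V) (w : W) (F : MonoidAlgebra K W) :
    cd b K y (el K w * F) = el K w * cd b K y F := by
  rw [← cst_el, cd_cst_mul]

theorem dK_one (y : V) : dK b K y 1 = 0 := by
  have := dK_al b K y 1
  rwa [Derivation.map_one_eq_zero, map_zero, map_one] at this

theorem cd_cst (y : V) (a : MonoidAlgebra ℂ W) : cd b K y (cst K a) = 0 := by
  apply ga_ext; intro u
  simp [cd, Algebra.algebraMap_eq_smul_one, dK_one]

theorem cd_comm (y y' : V) (F : MonoidAlgebra K W) :
    cd b K y (cd b K y' F) = cd b K y' (cd b K y F) := by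
  apply ga_ext; intro u; simp [cd]; rw [dK_comm]

theorem cd_add (y y' : V) (F : MonoidAlgebra K W) :
    cd b K (y + y') F = cd b K y F + cd b K y' F := by
  apply ga_ext; intro u; simp [cd, dK_add]

theorem cd_csmul (c : ℂ) (y : V) (F : MonoidAlgebra K W) :
    cd b K (c • y) F = c • cd b K y F := by
  apply ga_ext; intro u; simp [cd, dK_smul, Algebra.smul_def]

/-- the twisted action on group algebra valued functions -/
def st (w : W) : MonoidAlgebra K W →ₗ[ℂ] MonoidAlgebra K W :=
  LinearMap.mulLeft ℂ (el K w) ∘ₗ ca b K w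

theorem st_apply (w : W) (F : MonoidAlgebra K W) : st b K w F = el K w * ca b K w F := rfl

theorem el_mul (w w' : W) : el K (w * w') = el K w * el K w' := by
  simp [el, MonoidAlgebra.single_mul_single]

theorem st_st (w w' : W) (F : MonoidAlgebra K W) :
    st b K (w * w') F = st b K w (st b K w' F) := by
  simp only [st_apply, ca_mul, ca_el, ca_ca, el_mul, mul_assoc]

theorem st_one (F : MonoidAlgebra K W) : st b K (1 : W) F = F := by
  rw [st_apply, ca_one]
  exact one_mul F

theorem st_mul (w : W) (F G : MonoidAlgebra K W) :
    st b K w (F * G) = st b K w F * ca b K w G := by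
  simp only [st_apply, ca_mul, mul_assoc]

open Classical in
/-- `∑ (1 - s)` over the pointwise stabilizer -/
def PP (H : Ar W) : MonoidAlgebra ℂ W := ∑ s : W, if s ∈ stb H then 1 - el ℂ s else 0

theorem PP_conj (w : W) (H : Ar W) : el ℂ w * PP H = PP (mv w H) * el ℂ w := by
  classical
  rw [PP, PP, Finset.mul_sum, Finset.sum_mul]
  refine Fintype.sum_equiv (MulAut.conj w).toEquiv _ _ (fun s => ?_)
  have : (MulAut.conj w).toEquiv s ∈ stb (mv w H) ↔ s ∈ stb H := by
    change (MulAut.conj w).toEquiv s ∈ ptStab W (mv w H).1 ↔ s ∈ ptStab W H.1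
    rw [ptStab_mv]
    simp [mul_assoc]
  by_cases h : s ∈ stb H
  · rw [if_pos h, if_pos (this.2 h)]
    simp [mul_sub, sub_mul, MonoidAlgebra.single_mul_single]
  · rw [if_neg h, if_neg (fun h' => h (this.1 h'))]
    simp

/-- logarithmic derivative of the linear form -/
def lgd (H : Ar W) (y : V) : K := algebraMap ℂ K (frm H y) * (al K (pl b H))⁻¹

theorem lgd_add (H : Ar W) (y y' : V) : lgd b K H (y + y') = lgd b K H y + lgd b K H y' := by
  simp [lgd, add_mul]

theorem lgd_smul (H : Ar W) (c : ℂ) (y : V) : lgd b K H (c • y) = c • lgd b K H y := by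
  simp [lgd, Algebra.smul_def, mul_assoc]

theorem lgd_mul_pl (H : Ar W) (y : V) : al K (pl b H) * lgd b K H y = algebraMap ℂ K (frm H y) := by
  have := pl_ne b K H
  rw [lgd]; field_simp

theorem act_lgd (w : W) (H : Ar W) (y : V) :
    act b K w (lgd b K H y) = lgd b K (mv w H) (toLin W w y) := by
  obtain ⟨c, hc⟩ := frm_prop (mv w H) (frm H ∘ₗ toLin W w⁻¹) (by
    intro x hx
    rw [frm_iff] at hx
    obtain ⟨z, hz, rfl⟩ := hx
    rw [LinearMap.comp_apply, tl_inv_apply', frm_iff]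
    exact hz)
  have hc0 : c ≠ 0 := by
    rintro rfl
    apply frm_ne H
    ext x
    have := LinearMap.congr_fun hc (toLin W w x)
    simpa [tl_inv_apply'] using this
  have h1 : frm H y = c * frm (mv w H) (toLin W w y) := by
    have := LinearMap.congr_fun hc (toLin W w y)
    simpa [tl_inv_apply'] using this
  have h2 : act b K w (al K (pl b H)) = algebraMap ℂ K c * al K (pl b (mv w H)) := by
    rw [act_al, pl, sbs_lin, hc, lin_smul, map_mul, al_C]; rfl
  have h3 := pl_ne b K (mv w H)
  have h4 : algebraMap ℂ K c ≠ 0 := by simpa using hc0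
  rw [lgd, lgd, map_mul, map_inv₀, h2, AlgHom.commutes, h1, map_mul]
  field_simp

theorem dK_lgd (H : Ar W) (y y' : V) : dK b K y (lgd b K H y') = dK b K y' (lgd b K H y) := by
  have h0 := pl_ne b K H
  have key : ∀ y y' : V, al K (pl b H) * (al K (pl b H) * dK b K y (lgd b K H y')) =
      - (algebraMap ℂ K (frm H y) * algebraMap ℂ K (frm H y')) := by
    intro y y'
    have h1 := congrArg (dK b K y) (lgd_mul_pl b K H y')
    rw [dK_mul, dK_al, pl, dR_lin, al_C, Algebra.algebraMap_eq_smul_one (frm H y'), map_smul,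
      dK_one, smul_zero] at h1
    have h2 := lgd_mul_pl b K H y'
    rw [pl] at h2 ⊢
    linear_combination h1 * al K (lin b (frm H)) - algebraMap ℂ K (frm H y) * h2
  apply mul_left_cancel₀ h0
  apply mul_left_cancel₀ h0
  rw [key, key]; ring

variable (S : Finset (Ar W))

/-- connection form -/
def om (y : V) : MonoidAlgebra K W := ∑ H ∈ S, lgd b K H y • cst K (PP H)

theorem om_add (y y' : V) : om b K S (y + y') = om b K S y + om b K S y' := by
  simp [om, lgd_add, add_smul, Finset.sum_add_distrib]

theorem om_smul (c : ℂ) (y : V) : om b K S (c • y) = c • om b K S y := by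
  simp [om, lgd_smul, Finset.smul_sum]

/-- the connection -/
def nb (y : V) : MonoidAlgebra K W →ₗ[ℂ] MonoidAlgebra K W :=
  cd b K y - LinearMap.mulLeft ℂ (om b K S y)

theorem nb_apply (y : V) (F : MonoidAlgebra K W) :
    nb b K S y F = cd b K y F - om b K S y * F := rfl

theorem nb_mul (y : V) (F G : MonoidAlgebra K W) :
    nb b K S y (F * G) = nb b K S y F * G + F * cd b K y G := by
  simp only [nb_apply, cd_mul, sub_mul, mul_assoc]; abel

theorem nb_smul (y : V) (a : K) (F : MonoidAlgebra K W) :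
    nb b K S y (a • F) = dK b K y a • F + a • nb b K S y F := by
  simp only [nb_apply, cd_smul, mul_smul_comm, smul_sub]; abel

theorem nb_add (y y' : V) (F : MonoidAlgebra K W) :
    nb b K S (y + y') F = nb b K S y F + nb b K S y' F := by
  simp only [nb_apply, cd_add, om_add, add_mul]; abel

theorem nb_csmul (c : ℂ) (y : V) (F : MonoidAlgebra K W) :
    nb b K S (c • y) F = c • nb b K S y F := by
  simp only [nb_apply, cd_csmul, om_smul, smul_mul_assoc, smul_sub]

section equivariance

variable {S} (hS : ∀ (w : W) (H : Ar W), H ∈ S → mv w H ∈ S)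
include hS

theorem om_conj (w : W) (y : V) :
    el K w * ca b K w (om b K S y) = om b K S (toLin W w y) * el K w := by
  rw [om, om, map_sum, Finset.mul_sum, Finset.sum_mul]
  refine Finset.sum_nbij' (mv w) (mv w⁻¹) (fun H h => hS w H h) (fun H h => hS _ H h)
    (fun H _ => mv_inv' w H) (fun H _ => mv_inv w H) (fun H _ => ?_)
  rw [ca_smul, ca_cst, act_lgd, mul_smul_comm, smul_mul_assoc, ← cst_el, ← cst_mul, ← cst_mul,
    PP_conj]

theorem st_nb (w : W) (y : V) (F : MonoidAlgebra K W) :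
    st b K w (nb b K S y F) = nb b K S (toLin W w y) (st b K w F) := by
  rw [nb_apply, nb_apply, map_sub]
  simp only [st_apply, ca_mul, ca_cd, cd_el_mul]
  rw [← mul_assoc, om_conj b K hS, mul_assoc]

end equivariance

/-! ### degree and denominators of the connection -/

theorem lgd_Dg (H : Ar W) (y : V) : lgd b K H y ∈ Dg ι K (-1) := by
  have := Dg_inv (K := K) (pl_prime b H).ne_zero
  rw [show (pl b H).totalDegree = 1 from lin_totalDegree b (frm_ne H)] at this
  rw [lgd, ← Algebra.smul_def]
  exact Submodule.smul_mem _ _ (by simpa using this)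

theorem om_Dg (y : V) : om b K S y ∈ XS (Dg ι K (-1)) := by
  refine Submodule.sum_mem _ fun H _ => ?_
  refine XS_smul (T := Dg ι K 0) (fun f hf => ?_) (XS_cst (Dg_one K) _)
  simpa using Dg_mul K (lgd_Dg b K H y) hf

theorem nb_Dg (y : V) {k : ℤ} {F : MonoidAlgebra K W} (hF : F ∈ XS (Dg ι K k)) :
    nb b K S y F ∈ XS (Dg ι K (k - 1)) := by
  refine Submodule.sub_mem _ (XS_cmap (fun f hf => Dg_dK b K hf y) hF) ?_
  refine XS_mul (fun f hf g hg => ?_) (om_Dg b K S y) hF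
  have := Dg_mul K hf hg
  rwa [show (-1 : ℤ) + k = k - 1 by ring] at this

/-- product of the linear forms -/
def Dl : MvPolynomial ι ℂ := ∏ H ∈ S, pl b H

theorem Dl_ne : Dl b S ≠ 0 := Finset.prod_ne_zero_iff.2 fun H _ => (pl_prime b H).ne_zero

theorem om_Rd (y : V) : om b K S y ∈ XS (Rd K (Dl b S)) := by
  refine Submodule.sum_mem _ fun H hH => ?_
  refine XS_smul (T := Rs ι K) (fun f hf => ?_) (XS_cst (Rs_one K) _)
  refine Rd_mul ?_ (Rd_Rs hf)
  rw [lgd, ← Algebra.smul_def]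
  exact Submodule.smul_mem _ _ (Rd_inv (Dl_ne b S) (Finset.dvd_prod_of_mem _ hH))

theorem nb_Rd (y : V) {F : MonoidAlgebra K W} (hF : F ∈ XS (Rd K (Dl b S))) :
    nb b K S y F ∈ XS (Rd K (Dl b S)) := by
  refine Submodule.sub_mem _ (XS_cmap (fun f hf => Rd_dK b (Dl_ne b S) y hf) hF) ?_
  exact XS_mul (fun f hf g hg => Rd_mul hf hg) (om_Rd b K S y) hF

theorem XS_Rs_of {F : MonoidAlgebra K W} (hF : F ∈ XS (Rd K (Dl b S)))
    (h : ∀ H ∈ S, F ∈ XS (Ok K (pl_prime b H) 0)) : F ∈ XS (Rs ι K) := by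
  intro w
  exact Rd_prod (fun H : Ar W => pl_prime b H) S (fun H hH => h H hH w) (hF w)

theorem XS_zero_of {k : ℤ} (hk : k < 0) {F : MonoidAlgebra K W} (hF : F ∈ XS (Rs ι K))
    (h : F ∈ XS (Dg ι K k)) : F = 0 := by
  apply ga_ext; intro w
  obtain ⟨p, hp⟩ := (mem_Rs K).1 (hF w)
  have h1 := h w
  rw [← hp] at h1
  rcases Dg_al_iff K h1 with h2 | h2
  · rw [← hp, h2]; simp
  · have : (0 : ℤ) ≤ p.totalDegree := by positivity
    omega

/-! ### flatness -/

theorem lgd_Ok {H H' : Ar W} (h : H ≠ H') (y : V) : lgd b K H' y ∈ Ok K (pl_prime b H) 0 := by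
  rw [lgd, ← Algebra.smul_def]
  exact Submodule.smul_mem _ _ (Ok_inv _ (pl_not_dvd b h))

open Classical in
/-- the connection form without the term at `H` -/
def omr (H : Ar W) (y : V) : MonoidAlgebra K W := om b K (S.erase H) y

theorem omr_Ok (H : Ar W) (y : V) : omr b K S H y ∈ XS (Ok K (pl_prime b H) 0) := by
  classical
  refine Submodule.sum_mem _ fun H' hH' => ?_
  refine XS_smul (T := Ok K (pl_prime b H) 0) (fun f hf => ?_) (XS_cst (Ok_one _) _)
  exact Ok_mul0 _ (lgd_Ok b K (Finset.ne_of_mem_erase hH').symm y) hf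

theorem om_eq_omr {H : Ar W} (hH : H ∈ S) (y : V) :
    om b K S y = lgd b K H y • cst K (PP H) + omr b K S H y := by
  classical
  rw [om, omr, om]
  exact (Finset.add_sum_erase S (fun H => lgd b K H y • cst K (PP H)) hH).symm

theorem om_eq_omr_h {H : Ar W} {y : V} (hy : frm H y = 0) :
    om b K S y = omr b K S H y := by
  classical
  by_cases hH : H ∈ S
  · rw [om_eq_omr b K S hH, lgd, hy]; simp
  · rw [omr, Finset.erase_eq_of_notMem hH]

theorem act_Ok {H : Ar W} {s : W} (hs : s ∈ stb H) {f : K} (hf : f ∈ Ok K (pl_prime b H) 0) :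
    act b K s f ∈ Ok K (pl_prime b H) 0 ∧ act b K s f - f ∈ Ok K (pl_prime b H) 1 :=
  Ok_sbK0 b (pl_prime b H) _ ((mem_stb H s⁻¹).1 ((stb H).inv_mem hs)) hf

variable {S} (hS : ∀ (w : W) (H : Ar W), H ∈ S → mv w H ∈ S)
include hS

theorem om_PP_comm {H : Ar W} {h : V} (hh : frm H h = 0) :
    cst K (PP H) * om b K S h - om b K S h * cst K (PP H) ∈ XS (Ok K (pl_prime b H) 1) := by
  classical
  have hom : om b K S h ∈ XS (Ok K (pl_prime b H) 0) := by
    rw [om_eq_omr_h b K S hh]; exact omr_Ok b K S H h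
  have key : ∀ s : W, s ∈ stb H →
      el K s * om b K S h - om b K S h * el K s ∈ XS (Ok K (pl_prime b H) 1) := by
    intro s hs
    have h1 := om_conj b K hS s h
    rw [(mem_stb H s).1 hs h hh] at h1
    rw [← h1, ← mul_sub]
    refine XS_el_mul _ ?_
    intro w
    have := Submodule.neg_mem _ (act_Ok b K hs (hom w)).2
    simpa [ca] using this
  rw [PP, map_sum, Finset.sum_mul, Finset.mul_sum, ← Finset.sum_sub_distrib]
  refine Submodule.sum_mem _ fun s _ => ?_
  split_ifs with hs
  · have := Submodule.neg_mem _ (key s hs)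
    rw [map_sub, cst_one, cst_el]
    convert this using 1
    noncomm_ring
  · simp

theorem om_comm (y y' : V) : om b K S y * om b K S y' = om b K S y' * om b K S y := by
  rw [← sub_eq_zero]
  apply XS_zero_of (ι := ι) (k := -2) K (by norm_num)
  · apply XS_Rs_of b K S
    · exact Submodule.sub_mem _
        (XS_mul (fun f hf g hg => Rd_mul hf hg) (om_Rd b K S y) (om_Rd b K S y'))
        (XS_mul (fun f hf g hg => Rd_mul hf hg) (om_Rd b K S y') (om_Rd b K S y))
    · intro H hH
      set h := frm H y • y' - frm H y' • y with hh
      have hh0 : frm H h = 0 := by simp [hh, mul_comm]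
      have hc := om_PP_comm b K hS hh0
      have e1 : om b K S h = frm H y • omr b K S H y' - frm H y' • omr b K S H y := by
        rw [om_eq_omr_h b K S hh0, hh, omr, sub_eq_add_neg, om_add, om_smul, ← neg_smul, om_smul,
          neg_smul, ← sub_eq_add_neg]
        rfl
      have e2 : om b K S y * om b K S y' - om b K S y' * om b K S y =
          (al K (pl b H))⁻¹ • (cst K (PP H) * om b K S h - om b K S h * cst K (PP H)) +
          (omr b K S H y * omr b K S H y' - omr b K S H y' * omr b K S H y) := by
        rw [e1, om_eq_omr b K S hH y, om_eq_omr b K S hH y', lgd, lgd]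
        simp only [add_mul, mul_add, sub_mul, mul_sub, smul_mul_assoc, mul_smul_comm,
          ← algebraMap_smul K (frm H y), ← algebraMap_smul K (frm H y')]
        module
      rw [e2]
      refine Submodule.add_mem _ ?_ (Submodule.sub_mem _
        (XS_mul (fun f hf g hg => Ok_mul0 _ hf hg) (omr_Ok b K S H y) (omr_Ok b K S H y'))
        (XS_mul (fun f hf g hg => Ok_mul0 _ hf hg) (omr_Ok b K S H y') (omr_Ok b K S H y)))
      refine XS_smul (fun f hf => ?_) hc
      apply Ok_cancel (j := 1)
      rw [pow_one, mul_inv_cancel_left₀ (pl_ne b K H)]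
      exact hf
  · have e : (-2 : ℤ) = -1 + -1 := by norm_num
    rw [e]
    exact Submodule.sub_mem _
        (XS_mul (fun f hf g hg => Dg_mul K hf hg) (om_Dg b K S y) (om_Dg b K S y'))
        (XS_mul (fun f hf g hg => Dg_mul K hf hg) (om_Dg b K S y') (om_Dg b K S y))

theorem nb_comm (y y' : V) (F : MonoidAlgebra K W) :
    nb b K S y (nb b K S y' F) = nb b K S y' (nb b K S y F) := by
  have h1 : cd b K y (om b K S y') = cd b K y' (om b K S y) := by
    simp only [om, map_sum, cd_smul, cd_cst, smul_zero, add_zero, dK_lgd b K _ y y']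
  simp only [nb_apply, map_sub, cd_mul, mul_sub, ← mul_assoc, om_comm b K hS y y',
    cd_comm b K y y', h1]
  abel

end Conn

end KZ

namespace KZ

section Local

open Polynomial

variable {X : Type*} [AddCommGroup X] [Module ℂ X]

open Classical in
/-- local exponents -/
def nn (η : ℂ) (e : ℕ) (c : ℂ) (k : ℕ) : ℤ := if c = η ^ k then k else k - e

/-- a regular singular operator with a filtration -/
structure LocSys (N σ : X →ₗ[ℂ] X) (fil : ℕ → Submodule ℂ X) (e : ℕ) (η : ℂ) : Prop where
  epos : 0 < e
  prim : IsPrimitiveRoot η e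
  anti : ∀ k, fil (k + 1) ≤ fil k
  comm : ∀ F, N (σ F) = σ (N F)
  per : ∀ F, (σ ^ e) F = F
  sfil : ∀ k, ∀ F ∈ fil k, σ F ∈ fil k
  nfil : ∀ k, ∀ F ∈ fil k, N F ∈ fil k
  loc : ∀ c : ℂ, c ^ e = 1 → ∀ k, ∀ F ∈ fil k, σ F = c • F →
    N F - (nn η e c k : ℂ) • F ∈ fil (k + 1)

theorem nn_inj {η : ℂ} {e : ℕ} (h : η ^ e = 1) (c : ℂ) : Function.Injective (nn η e c) := by
  have key : ∀ j k : ℕ, c = η ^ j → c ≠ η ^ k → (j : ℤ) ≠ k - e := by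
    intro j k h1 h2 h3
    apply h2
    have : k = j + e := by omega
    rw [this, pow_add, h, mul_one, h1]
  intro j k hjk
  unfold nn at hjk
  split_ifs at hjk with h1 h2 h2
  · exact_mod_cast hjk
  · exact absurd hjk (key j k h1 h2)
  · exact absurd hjk.symm (key k j h2 h1)
  · omega

theorem aeval_mem {N : X →ₗ[ℂ] X} {T : Submodule ℂ X} (h : ∀ F ∈ T, N F ∈ T) (p : ℂ[X]) :
    ∀ F ∈ T, aeval N p F ∈ T := by
  induction p using Polynomial.induction_on' with
  | add p q hp hq =>
    intro F hF
    rw [map_add, LinearMap.add_apply]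
    exact T.add_mem (hp F hF) (hq F hF)
  | monomial n a =>
    intro F hF
    rw [aeval_monomial, Module.End.mul_apply, Module.algebraMap_end_apply]
    apply T.smul_mem
    induction n with
    | zero => simpa using hF
    | succ n ih => rw [pow_succ', Module.End.mul_apply]; exact h _ ih

theorem aeval_comm {N A : X →ₗ[ℂ] X} (h : ∀ F, N (A F) = A (N F)) (p : ℂ[X]) (F : X) :
    aeval N p (A F) = A (aeval N p F) := by
  induction p using Polynomial.induction_on' with
  | add p q hp hq => rw [map_add, LinearMap.add_apply, hp, hq, ← map_add]; rfl
  | monomial n a =>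
    simp only [aeval_monomial, Module.End.mul_apply, Module.algebraMap_end_apply]
    rw [map_smul]
    congr 1
    induction n with
    | zero => simp
    | succ n ih => rw [pow_succ', Module.End.mul_apply, ih, h]; rfl

theorem aeval_congr {N : X →ₗ[ℂ] X} {T : Submodule ℂ X} (h : ∀ F ∈ T, N F ∈ T) {a : ℂ} {F : X}
    (hF : N F - a • F ∈ T) (p : ℂ[X]) : aeval N p F - p.eval a • F ∈ T := by
  obtain ⟨q, hq⟩ := X_sub_C_dvd_sub_C_eval (a := a) (p := p)
  have h1 : aeval N p F - p.eval a • F = aeval N q (N F - a • F) := by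
    have h2 : aeval N p = aeval N (q * (Polynomial.X - C a)) + aeval N (C (p.eval a)) := by
      rw [← map_add, mul_comm, ← hq, sub_add_cancel]
    rw [h2]
    simp [Module.algebraMap_end_apply, aeval_C]
  rw [h1]
  exact aeval_mem h q _ hF

namespace LocSys

variable {N σ : X →ₗ[ℂ] X} {fil : ℕ → Submodule ℂ X} {e : ℕ} {η : ℂ} (L : LocSys N σ fil e η)
include L

theorem anti' {j k : ℕ} (h : j ≤ k) : fil k ≤ fil j := antitone_nat_of_succ_le L.anti h

theorem eig_sum {k : ℕ} {F : X} (hF : F ∈ fil k) (T : Submodule ℂ X)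
    (h : ∀ c : ℂ, c ^ e = 1 → ∀ G ∈ fil k, σ G = c • G → G ∈ T) : F ∈ T := by
  have hη : η ^ e = 1 := L.prim.pow_eq_one
  have hη0 : η ≠ 0 := L.prim.ne_zero L.epos.ne'
  have hs : ∀ i, (σ ^ i) F ∈ fil k := by
    intro i
    induction i with
    | zero => simpa using hF
    | succ i ih => rw [pow_succ', Module.End.mul_apply]; exact L.sfil k _ ih
  set G : ℕ → X := fun w => ∑ i ∈ Finset.range e, ((η⁻¹) ^ w) ^ i • (σ ^ i) F with hG
  have hGm : ∀ w, G w ∈ fil k := fun w =>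
    Submodule.sum_mem _ fun i _ => Submodule.smul_mem _ _ (hs i)
  have hGe : ∀ w, σ (G w) = η ^ w • G w := by
    intro w
    have h1 : (η⁻¹ ^ w) ^ e = 1 := by rw [← pow_mul, mul_comm, pow_mul, inv_pow, hη]; simp
    have h2 := Finset.sum_range_succ (fun i => ((η⁻¹) ^ w) ^ i • (σ ^ i) F) e
    rw [Finset.sum_range_succ', h1, L.per] at h2
    simp only [pow_zero, one_smul, Module.End.one_apply] at h2
    have h3 := add_right_cancel h2
    have h4 : ∑ i ∈ Finset.range e, σ ((η⁻¹ ^ w) ^ i • (σ ^ i) F) =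
      η ^ w • ∑ i ∈ Finset.range e, (η⁻¹ ^ w) ^ (i + 1) • (σ ^ (i + 1)) F := by
      rw [Finset.smul_sum]
      refine Finset.sum_congr rfl fun i _ => ?_
      rw [map_smul, smul_smul, pow_succ' σ, Module.End.mul_apply, pow_succ' (η⁻¹ ^ w), ← mul_assoc,
        ← mul_pow, mul_inv_cancel₀ hη0, one_pow, one_mul]
    change σ (∑ i ∈ Finset.range e, ((η⁻¹) ^ w) ^ i • (σ ^ i) F) =
      η ^ w • ∑ i ∈ Finset.range e, ((η⁻¹) ^ w) ^ i • (σ ^ i) F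
    rw [map_sum, h4, h3]
  have hsum : ∑ w ∈ Finset.range e, G w = (e : ℂ) • F := by
    rw [hG, Finset.sum_comm]
    rw [Finset.sum_eq_single_of_mem 0 (Finset.mem_range.2 L.epos)]
    · simp [← Nat.cast_smul_eq_nsmul ℂ]
    · intro i hi hi0
      rw [← Finset.sum_smul]
      have : ∑ w ∈ Finset.range e, (η⁻¹ ^ w) ^ i = 0 := by
        have h1 : ∀ w, (η⁻¹ ^ w) ^ i = (η⁻¹ ^ i) ^ w := fun w => by rw [← pow_mul, ← pow_mul, mul_comm]
        simp only [h1]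
        have h2 : η⁻¹ ^ i ≠ 1 := fun h2 =>
          L.prim.inv.pow_ne_one_of_pos_of_lt hi0 (Finset.mem_range.1 hi) h2
        rw [geom_sum_eq h2, ← pow_mul, mul_comm, pow_mul, inv_pow, hη]
        simp
      rw [this, zero_smul]
  have he : (e : ℂ) ≠ 0 := by exact_mod_cast L.epos.ne'
  have : F = (e : ℂ)⁻¹ • ∑ w ∈ Finset.range e, G w := by
    rw [hsum, smul_smul, inv_mul_cancel₀ he, one_smul]
  rw [this]
  refine T.smul_mem _ (T.sum_mem fun w _ => h (η ^ w) ?_ _ (hGm w) (hGe w))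
  rw [← pow_mul, mul_comm, pow_mul, hη, one_pow]

theorem prod_mem {c : ℂ} (hc : c ^ e = 1) {k0 : ℕ} {F : X} (hF : F ∈ fil k0) (hσ : σ F = c • F)
    {m : ℕ} (hm : k0 ≤ m) :
    aeval N (∏ k ∈ Finset.Ico k0 m, (Polynomial.X - C (nn η e c k : ℂ))) F ∈ fil m := by
  induction m, hm using Nat.le_induction with
  | base => simpa using hF
  | succ m hm ih =>
    rw [Finset.prod_Ico_succ_top hm, mul_comm, map_mul, Module.End.mul_apply]
    set G := aeval N (∏ k ∈ Finset.Ico k0 m, (Polynomial.X - C (nn η e c k : ℂ))) F with hG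
    have hσG : σ G = c • G := by
      rw [hG, ← aeval_comm L.comm, hσ, map_smul]
    have := L.loc c hc m G ih hσG
    rw [map_sub, aeval_X, aeval_C, LinearMap.sub_apply, Module.algebraMap_end_apply]
    exact this

theorem U1 {F : X} (hF : F ∈ fil e) (m : ℕ) :
    aeval N (∏ l ∈ Finset.range m, (Polynomial.X - C (l : ℂ))) F ∈ fil m := by
  classical
  rcases le_total m e with hm | hm
  · exact L.anti' hm (aeval_mem (L.nfil e) _ _ hF)
  refine L.eig_sum hF ((fil m).comap (aeval N (∏ l ∈ Finset.range m, (Polynomial.X - C (l : ℂ)))))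
    (fun c hc G hG hσ => ?_)
  rw [Submodule.mem_comap]
  have h1 := L.prod_mem hc hG hσ hm
  set f : ℕ → ℕ := fun k => (nn η e c k).toNat with hf
  have hpos : ∀ k ∈ Finset.Ico e m, (f k : ℤ) = nn η e c k ∧ f k < m := by
    intro k hk
    rw [Finset.mem_Ico] at hk
    have : 0 ≤ nn η e c k ∧ nn η e c k < m := by
      unfold nn; split_ifs <;> constructor <;> omega
    simp only [hf]; omega
  have hinj : Set.InjOn f (Finset.Ico e m) := by
    intro j hj k hk hjk
    apply nn_inj L.prim.pow_eq_one c
    rw [← (hpos j hj).1, ← (hpos k hk).1, hjk]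
  have hsub : (Finset.Ico e m).image f ⊆ Finset.range m := by
    intro l hl
    obtain ⟨k, hk, rfl⟩ := Finset.mem_image.1 hl
    exact Finset.mem_range.2 (hpos k hk).2
  have e1 : ∏ l ∈ (Finset.Ico e m).image f, (Polynomial.X - C (l : ℂ)) =
      ∏ k ∈ Finset.Ico e m, (Polynomial.X - C (nn η e c k : ℂ)) := by
    rw [Finset.prod_image hinj]
    refine Finset.prod_congr rfl fun k hk => ?_
    rw [← (hpos k hk).1]; simp
  rw [← Finset.prod_sdiff hsub, map_mul, Module.End.mul_apply, e1]
  exact aeval_mem (L.nfil m) _ _ h1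

theorem U2 {A : X →ₗ[ℂ] X} (hN : ∀ F, N (A F) = A (N F)) (hσ : ∀ F, σ (A F) = A (σ F))
    (h0 : ∀ F ∈ fil e, A F ∈ fil 0) (h2 : ∀ F ∈ fil (2 * e), A F ∈ fil e) :
    ∀ F ∈ fil e, A F ∈ fil e := by
  intro F hF
  refine L.eig_sum hF ((fil e).comap A) (fun c hc F hF hF' => ?_)
  rw [Submodule.mem_comap]
  have key : ∀ r, r ≤ e → A F ∈ fil r := by
    intro r
    induction r with
    | zero => intro _; exact h0 F hF
    | succ r ih =>
      intro hr
      have ih := ih (by omega)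
      set Q : ℂ[X] := ∏ k ∈ Finset.Ico e (2 * e), (Polynomial.X - C (nn η e c k : ℂ)) with hQ
      have h1 : aeval N Q F ∈ fil (2 * e) := L.prod_mem hc hF hF' (by omega)
      have h3 : aeval N Q (A F) ∈ fil (r + 1) := by
        rw [aeval_comm hN]
        exact L.anti' hr (h2 _ h1)
      have hσ' : σ (A F) = c • A F := by rw [hσ, hF', map_smul]
      have h4 := aeval_congr (L.nfil (r + 1)) (L.loc c hc r _ ih hσ') Q
      have h5 : Q.eval (nn η e c r : ℂ) ≠ 0 := by
        rw [hQ, eval_prod, Finset.prod_ne_zero_iff]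
        intro k hk
        rw [Finset.mem_Ico] at hk
        simp only [eval_sub, eval_X, eval_C]
        rw [sub_ne_zero]
        intro h
        have : nn η e c r = nn η e c k := by exact_mod_cast h
        have := nn_inj L.prim.pow_eq_one c this
        omega
      have h6 := (fil (r + 1)).smul_mem (Q.eval (nn η e c r : ℂ))⁻¹ ((fil (r + 1)).sub_mem h3 h4)
      rw [sub_sub_cancel, smul_smul, inv_mul_cancel₀ h5, one_smul] at h6
      exact h6
  exact key e le_rfl

theorem U3 {Y : X →ₗ[ℂ] X} (hY : ∀ F ∈ fil (e + 1), Y F ∈ fil (e + 1))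
    (h : ∀ n' : ℕ, (n' = 0 ∨ n' = e) → ∀ F ∈ fil e,
      Y (aeval N (∏ l ∈ (Finset.range (e + 1)).erase n', (Polynomial.X - C (l : ℂ))) F)
        ∈ fil (e + 1)) : ∀ F ∈ fil e, Y F ∈ fil (e + 1) := by
  intro F hF
  refine L.eig_sum hF ((fil (e + 1)).comap Y) (fun c hc F hF hF' => ?_)
  rw [Submodule.mem_comap]
  obtain ⟨n', hn', hn⟩ : ∃ n' : ℕ, (n' = 0 ∨ n' = e) ∧ nn η e c e = n' := by
    unfold nn
    split_ifs
    · exact ⟨e, Or.inr rfl, rfl⟩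
    · exact ⟨0, Or.inl rfl, by simp⟩
  set Q : ℂ[X] := ∏ l ∈ (Finset.range (e + 1)).erase n', (Polynomial.X - C (l : ℂ)) with hQ
  have h1 := L.loc c hc e F hF hF'
  rw [hn] at h1
  have h4 := aeval_congr (L.nfil (e + 1)) h1 Q
  have h5 : Q.eval ((n' : ℤ) : ℂ) ≠ 0 := by
    rw [hQ, eval_prod, Finset.prod_ne_zero_iff]
    intro l hl
    simp only [eval_sub, eval_X, eval_C]
    rw [sub_ne_zero]
    intro h
    have : n' = l := by exact_mod_cast h
    exact Finset.ne_of_mem_erase hl this.symm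
  have h6 := hY _ h4
  rw [map_sub, map_smul] at h6
  have h7 := (fil (e + 1)).smul_mem (Q.eval ((n' : ℤ) : ℂ))⁻¹
    ((fil (e + 1)).sub_mem (h n' hn' F hF) h6)
  rw [sub_sub_cancel, smul_smul, inv_mul_cancel₀ h5, one_smul] at h7
  exact h7

end LocSys

end Local

end KZ

namespace KZ

section Conc

open MvPolynomial

variable [FiniteDimensional ℂ V] {W : Subgroup (V →ₗ[ℂ] V)ˣ} [Fintype W]
variable {ι : Type*} [Fintype ι] (b : Module.Basis ι ℂ V)
variable (K : Type*) [Field K] [Algebra (MvPolynomial ι ℂ) K] [IsFractionRing (MvPolynomial ι ℂ) K]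
  [Algebra ℂ K] [IsScalarTower ℂ (MvPolynomial ι ℂ) K]

/-- local data at a hyperplane -/
structure LDat (H : Ar W) (s : W) (ξ : ℂ) (y : V) : Prop where
  fy : frm H y = 1
  ey : toLin W s y = ξ • y
  prim : IsPrimitiveRoot ξ (orderOf s)
  zp : stb H = Subgroup.zpowers s

theorem exists_LDat (H : Ar W) : ∃ (s : W) (ξ : ℂ) (y : V), LDat H s ξ y := by
  obtain ⟨s, ξ, y, h1, h2, h3, h4⟩ := exists_loc H
  exact ⟨s, ξ, y, h1, h2, h3, h4⟩

/-- the local filtration -/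
def fl (H : Ar W) (k : ℕ) : Submodule ℂ (MonoidAlgebra K W) := XS (Ok K (pl_prime b H) k)

theorem fl_anti (H : Ar W) {j k : ℕ} (h : j ≤ k) : fl b K H k ≤ fl b K H j := XS_mono (Ok_anti _ h)

theorem fl_iff (H : Ar W) {k : ℕ} {F : MonoidAlgebra K W} :
    F ∈ fl b K H k ↔ ∃ G ∈ fl b K H 0, F = al K (pl b H) ^ k • G := by
  constructor
  · intro h
    have hne : al K (pl b H) ^ k ≠ 0 := pow_ne_zero _ (pl_ne b K H)
    refine ⟨(al K (pl b H) ^ k)⁻¹ • F, ?_, by rw [smul_smul, mul_inv_cancel₀ hne, one_smul]⟩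
    refine XS_smul (fun f hf => ?_) h
    obtain ⟨g, hg, rfl⟩ := (Ok_iff _).1 hf
    rwa [inv_mul_cancel_left₀ hne]
  · rintro ⟨G, hG, rfl⟩
    refine XS_smul (fun f hf => ?_) hG
    exact (Ok_iff _).2 ⟨f, hf, rfl⟩

theorem fl_cancel (H : Ar W) {j k : ℕ} {F : MonoidAlgebra K W}
    (h : al K (pl b H) ^ j • F ∈ fl b K H (j + k)) : F ∈ fl b K H k := fun w => by
  apply Ok_cancel (pl_prime b H) (j := j)
  simpa using h w

theorem fl_pow (H : Ar W) (j : ℕ) {k : ℕ} {F : MonoidAlgebra K W} (h : F ∈ fl b K H k) :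
    al K (pl b H) ^ j • F ∈ fl b K H (j + k) :=
  XS_smul (fun _ hf => Ok_mul _ (Ok_pow _ j) hf) h

theorem fl_mul (H : Ar W) {j k : ℕ} {F G : MonoidAlgebra K W} (hF : F ∈ fl b K H j)
    (hG : G ∈ fl b K H k) : F * G ∈ fl b K H (j + k) :=
  XS_mul (fun _ hf _ hg => Ok_mul _ hf hg) hF hG

theorem fl_mul0 (H : Ar W) {k : ℕ} {F G : MonoidAlgebra K W} (hF : F ∈ fl b K H 0)
    (hG : G ∈ fl b K H k) : F * G ∈ fl b K H k :=
  XS_mul (fun _ hf _ hg => Ok_mul0 _ hf hg) hF hG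

theorem omr_fl (S : Finset (Ar W)) (H : Ar W) (y : V) : omr b K S H y ∈ fl b K H 0 :=
  omr_Ok b K S H y

theorem fl_smul0 (H : Ar W) {a : K} (ha : a ∈ Ok K (pl_prime b H) 0) {k : ℕ}
    {F : MonoidAlgebra K W} (h : F ∈ fl b K H k) : a • F ∈ fl b K H k :=
  XS_smul (fun _ hf => Ok_mul0 _ ha hf) h

variable (S : Finset (Ar W))

/-- Euler type operator -/
def eu (a : K) (y : V) : MonoidAlgebra K W →ₗ[ℂ] MonoidAlgebra K W :=
  (Algebra.lsmul ℂ ℂ (MonoidAlgebra K W) a) ∘ₗ nb b K S y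

theorem eu_apply (a : K) (y : V) (F : MonoidAlgebra K W) : eu b K S a y F = a • nb b K S y F := rfl

theorem dK_pl {H : Ar W} {y : V} (hy : frm H y = 1) : dK b K y (al K (pl b H)) = 1 := by
  rw [dK_al, pl, dR_lin, hy]; simp

theorem eu_prod {H : Ar W} {y : V} (hy : frm H y = 1) (m : ℕ) (F : MonoidAlgebra K W) :
    Polynomial.aeval (eu b K S (al K (pl b H)) y)
      (∏ l ∈ Finset.range m, (Polynomial.X - Polynomial.C (l : ℂ))) F =
    al K (pl b H) ^ m • (nb b K S y ^ m) F := by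
  induction m with
  | zero => simp
  | succ m ih =>
    rw [Finset.prod_range_succ, mul_comm, map_mul, Module.End.mul_apply, ih, map_sub,
      Polynomial.aeval_X, Polynomial.aeval_C, LinearMap.sub_apply, Module.algebraMap_end_apply,
      eu_apply, nb_smul, pow_succ' (nb b K S y), Module.End.mul_apply, smul_add, smul_smul, smul_smul]
    have h1 : al K (pl b H) * dK b K y (al K (pl b H) ^ m) = algebraMap ℂ K m * al K (pl b H) ^ m := by
      cases m with
      | zero => simp [dK_one]
      | succ m => rw [dK_pow, dK_pl b K hy, pow_succ]; push_cast; ring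
    rw [h1, mul_smul, algebraMap_smul, pow_succ']
    abel

section loc

variable {H : Ar W} {s : W} {ξ : ℂ} {y : V} (L : LDat H s ξ y)
include L

theorem LDat.ms : s ∈ stb H := by rw [L.zp]; exact Subgroup.mem_zpowers s

theorem LDat.frm_inv : frm H ∘ₗ toLin W s⁻¹ = ξ⁻¹ • frm H := by
  have h1 : toLin W s⁻¹ y = ξ⁻¹ • y := by
    have h0 : ξ ≠ 0 := L.prim.ne_zero (orderOf_pos s).ne'
    have := congrArg (toLin W s⁻¹) L.ey
    rw [tl_inv_apply', map_smul] at this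
    have h2 := congrArg (fun x => ξ⁻¹ • x) this
    simp only [smul_smul, inv_mul_cancel₀ h0, one_smul] at h2
    exact h2.symm
  ext x
  have := stb_frm H L.fy ((stb H).inv_mem L.ms) x
  rw [h1, map_smul, L.fy] at this
  simpa using this

theorem LDat.act_pl : act b K s (al K (pl b H)) = algebraMap ℂ K ξ⁻¹ * al K (pl b H) := by
  rw [act_al, pl, sbs_lin, L.frm_inv, lin_smul, map_mul, al_C]

theorem LDat.ca_fl {k : ℕ} {F : MonoidAlgebra K W} (hF : F ∈ fl b K H k) :
    ca b K s F - (ξ⁻¹) ^ k • F ∈ fl b K H (k + 1) := fun w => by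
  have := Ok_sbK b (pl_prime b H) (tl_inv' s) ((mem_stb H s⁻¹).1 ((stb H).inv_mem L.ms))
    L.frm_inv (hF w)
  rw [MonoidAlgebra.coeff_sub, Finsupp.sub_apply, MonoidAlgebra.coeff_smul, Finsupp.smul_apply, ca, coeff_cmap]
  exact this

theorem LDat.st_fl {k : ℕ} {F : MonoidAlgebra K W} (hF : F ∈ fl b K H k) :
    st b K s F - (ξ⁻¹) ^ k • (el K s * F) ∈ fl b K H (k + 1) := by
  have := XS_el_mul s (L.ca_fl b K hF)
  rwa [mul_sub, mul_smul_comm] at this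

theorem LDat.PP_eq : PP H = ∑ i ∈ Finset.range (orderOf s), (1 - el ℂ (s ^ i)) := by
  classical
  rw [PP, ← Finset.sum_filter]
  have : (Finset.univ.filter fun u : W => u ∈ stb H) =
      (Finset.range (orderOf s)).image (fun i => s ^ i) := by
    ext u
    simp only [Finset.mem_filter, Finset.mem_univ, true_and]
    rw [L.zp, mem_zpowers_iff_mem_range_orderOf]
  rw [this, Finset.sum_image]
  intro i hi j hj hij
  exact pow_injOn_Iio_orderOf (by simpa using hi) (by simpa using hj) hij

theorem LDat.PP_mul {k : ℕ} {F : MonoidAlgebra K W} {r : ℂ}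
    (h : el K s * F - r • F ∈ fl b K H k) :
    cst K (PP H) * F - (∑ i ∈ Finset.range (orderOf s), (1 - r ^ i)) • F ∈ fl b K H k := by
  have key : ∀ i : ℕ, el K (s ^ i) * F - r ^ i • F ∈ fl b K H k := by
    intro i
    induction i with
    | zero => simp [← MonoidAlgebra.one_def]
    | succ i ih =>
      have h1 : _ ∈ fl b K H k := XS_el_mul (s ^ i) h
      have h2 := Submodule.smul_mem _ r ih
      have := Submodule.add_mem _ h1 h2
      convert this using 1
      rw [pow_succ, el_mul, mul_sub, mul_assoc, smul_sub, smul_smul, mul_smul_comm, pow_succ']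
      abel
  rw [L.PP_eq, map_sum, Finset.sum_mul, Finset.sum_smul, ← Finset.sum_sub_distrib]
  refine Submodule.sum_mem _ fun i _ => ?_
  have := Submodule.neg_mem _ (key i)
  convert this using 1
  rw [map_sub, cst_one, cst_el, sub_mul, one_mul, sub_smul, one_smul]
  abel

variable {S} (hH : H ∈ S)
include hH

theorem LDat.eu_fl {k : ℕ} {F : MonoidAlgebra K W} (hF : F ∈ fl b K H k) :
    eu b K S (al K (pl b H)) y F - (k : ℂ) • F + cst K (PP H) * F ∈ fl b K H (k + 1) := by
  have h1 : al K (pl b H) • cd b K y F - (k : ℂ) • F ∈ fl b K H (k + 1) := fun w => by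
    have := Ok_euler b (pl_prime b H) L.fy (hF w)
    rw [MonoidAlgebra.coeff_sub, Finsupp.sub_apply, MonoidAlgebra.coeff_smul, MonoidAlgebra.coeff_smul,
      Finsupp.smul_apply, Finsupp.smul_apply, cd, coeff_cmap]
    exact this
  have h2 : al K (pl b H) • (omr b K S H y * F) ∈ fl b K H (k + 1) := by
    have := fl_pow b K H 1 (fl_mul b K H (omr_Ok b K S H y) hF)
    rw [pow_one] at this
    convert this using 2; ring
  have := Submodule.sub_mem _ h1 h2
  convert this using 1
  rw [eu_apply, nb_apply, om_eq_omr b K S hH, add_mul, smul_sub, smul_add, smul_mul_assoc,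
    smul_smul, lgd_mul_pl, L.fy, map_one, one_smul]
  abel

variable (hS : ∀ (w : W) (H : Ar W), H ∈ S → mv w H ∈ S)
include hS

theorem LDat.locSys : LocSys (eu b K S (al K (pl b H)) y) (st b K s) (fl b K H) (orderOf s) ξ⁻¹ where
  epos := orderOf_pos s
  prim := L.prim.inv
  anti k := fl_anti b K H (Nat.le_succ k)
  comm F := by
    have h0 : ξ ≠ 0 := L.prim.ne_zero (orderOf_pos s).ne'
    rw [eu_apply, eu_apply]
    have h1 := st_nb b K hS s y F
    rw [L.ey, nb_csmul] at h1
    rw [st_apply b K s (_ • _), ca_smul, L.act_pl b K, mul_smul_comm, ← st_apply, h1, mul_smul, smul_comm _ ξ,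
      algebraMap_smul, smul_smul, inv_mul_cancel₀ h0, one_smul]
  per F := by
    have : ∀ i : ℕ, (st b K s ^ i) F = st b K (s ^ i) F := by
      intro i
      induction i with
      | zero => simp [st_one]
      | succ i ih => rw [pow_succ', Module.End.mul_apply, ih, ← st_st, ← pow_succ']
    rw [this, pow_orderOf_eq_one, st_one]
  sfil k F hF := by
    have := Submodule.add_mem _ (fl_anti b K H (Nat.le_succ k) (L.st_fl b K hF))
      (Submodule.smul_mem _ (ξ⁻¹ ^ k) (XS_el_mul s hF))
    rwa [sub_add_cancel] at this
  nfil k F hF := by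
    have h1 := fl_anti b K H (Nat.le_succ k) (L.eu_fl b K hH hF)
    have h2 := Submodule.sub_mem _ (Submodule.add_mem _ h1 (Submodule.smul_mem _ (k : ℂ) hF))
      (XS_cst_mul (PP H) hF)
    convert h2 using 1
    abel
  loc c hc k F hF hσ := by
    have h0 : ξ ≠ 0 := L.prim.ne_zero (orderOf_pos s).ne'
    have h1 := L.st_fl b K hF
    rw [hσ] at h1
    set r := ξ ^ k * c with hr
    have h2 : el K s * F - r • F ∈ fl b K H (k + 1) := by
      have := Submodule.smul_mem _ (- (ξ ^ k)) h1
      convert this using 1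
      rw [smul_sub, smul_smul, smul_smul, neg_mul, neg_mul, ← mul_pow, mul_inv_cancel₀ h0, one_pow]
      module
    have h3 := L.PP_mul b K h2
    have h4 := L.eu_fl b K hH hF
    have h5 := Submodule.sub_mem _ h4 h3
    convert h5 using 1
    have hsum : (∑ i ∈ Finset.range (orderOf s), (1 - r ^ i) : ℂ) = k - (nn ξ⁻¹ (orderOf s) c k : ℂ) := by
      rw [Finset.sum_sub_distrib]
      unfold nn
      split_ifs with hck
      · have : r = 1 := by rw [hr, hck, ← mul_pow, mul_inv_cancel₀ h0, one_pow]
        simp [this]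
      · have hr1 : r ≠ 1 := by
          intro h
          apply hck
          rw [inv_pow]
          exact eq_inv_of_mul_eq_one_right h
        have hre : r ^ orderOf s = 1 := by
          rw [hr, mul_pow, hc, ← pow_mul, mul_comm k, pow_mul, L.prim.pow_eq_one]; simp
        rw [geom_sum_eq hr1, hre]
        simp
    rw [hsum]
    module

theorem LDat.nb_pow_fl {F : MonoidAlgebra K W} (hF : F ∈ fl b K H (orderOf s)) (m : ℕ) :
    (nb b K S y ^ m) F ∈ fl b K H 0 := by
  have h1 := (L.locSys b K hH hS).U1 hF m
  rw [eu_prod b K S L.fy] at h1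
  exact fl_cancel b K H (j := m) h1

end loc

end Conc

end KZ

namespace KZ

section Sol

open MvPolynomial

variable [FiniteDimensional ℂ V] {W : Subgroup (V →ₗ[ℂ] V)ˣ} [Fintype W]

/-- generator of the stabilizer -/
def ls (H : Ar W) : W := (exists_LDat H).choose
/-- eigenvalue of the generator -/
def lx (H : Ar W) : ℂ := (exists_LDat H).choose_spec.choose
/-- eigenvector of the generator -/
def ly (H : Ar W) : V := (exists_LDat H).choose_spec.choose_spec.choose

theorem ld (H : Ar W) : LDat H (ls H) (lx H) (ly H) :=
  (exists_LDat H).choose_spec.choose_spec.choose_spec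

/-- order of the stabilizer -/
def eH (H : Ar W) : ℕ := orderOf (ls H)

variable {ι : Type*} [Fintype ι] (b : Module.Basis ι ℂ V)
variable (K : Type*) [Field K] [Algebra (MvPolynomial ι ℂ) K] [IsFractionRing (MvPolynomial ι ℂ) K]
  [Algebra ℂ K] [IsScalarTower ℂ (MvPolynomial ι ℂ) K]
variable (S : Finset (Ar W))

/-- the lattice -/
def Mm : Submodule ℂ (MonoidAlgebra K W) where
  carrier := {F | F ∈ XS (Rd K (Dl b S)) ∧ ∀ H ∈ S, ∀ m : ℕ, (nb b K S (ly H) ^ m) F ∈ fl b K H 0}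
  add_mem' := by
    rintro F G ⟨h1, h2⟩ ⟨h1', h2'⟩
    refine ⟨Submodule.add_mem _ h1 h1', fun H hH m => ?_⟩
    rw [map_add]
    exact Submodule.add_mem _ (h2 H hH m) (h2' H hH m)
  zero_mem' := ⟨Submodule.zero_mem _, fun H hH m => by rw [map_zero]; exact Submodule.zero_mem _⟩
  smul_mem' := by
    rintro c F ⟨h1, h2⟩
    refine ⟨Submodule.smul_mem _ _ h1, fun H hH m => ?_⟩
    rw [map_smul]
    exact Submodule.smul_mem _ _ (h2 H hH m)

theorem Mm_Rs {F : MonoidAlgebra K W} (hF : F ∈ Mm b K S) : F ∈ XS (Rs ι K) :=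
  XS_Rs_of b K S hF.1 fun H hH => by simpa [fl] using hF.2 H hH 0

/-- product of linear forms with multiplicities -/
def DD : MvPolynomial ι ℂ := ∏ H ∈ S, pl b H ^ eH H

/-- total degree -/
def dS : ℕ := ∑ H ∈ S, eH H

theorem DD_ne : DD b S ≠ 0 :=
  Finset.prod_ne_zero_iff.2 fun H _ => pow_ne_zero _ (pl_prime b H).ne_zero

theorem DD_deg : (DD b S).totalDegree ≤ dS S := by
  refine (totalDegree_finset_prod _ _).trans (Finset.sum_le_sum fun H _ => ?_)
  refine (totalDegree_pow _ _).trans ?_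
  rw [pl, lin_totalDegree b (frm_ne H), mul_one]

theorem DD_evp {v : V} (hv : ∀ H : Ar W, v ∉ H.1) : evp b v (DD b S) ≠ 0 := by
  rw [DD, map_prod, Finset.prod_ne_zero_iff]
  intro H _
  rw [map_pow, pl, evp_lin]
  refine pow_ne_zero _ fun h => hv H ((frm_iff H v).1 h)

/-- polynomials vanishing at `v` -/
def Mv (v : V) : Submodule ℂ K :=
  (LinearMap.ker (evp b v).toLinearMap).map (alh K).toLinearMap

theorem Mv_mul (v : V) {f g : K} (hf : f ∈ Mv b K v) (hg : g ∈ Rs ι K) : f * g ∈ Mv b K v := by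
  obtain ⟨p, hp, rfl⟩ := hf
  obtain ⟨q, rfl⟩ := hg
  refine ⟨p * q, ?_, by simp⟩
  have : evp b v p = 0 := hp
  simp [this]

theorem Mv_al (v : V) {p : MvPolynomial ι ℂ} (hp : evp b v p = 0) : al K p ∈ Mv b K v :=
  ⟨p, hp, rfl⟩

theorem Mv_al_iff (v : V) {p : MvPolynomial ι ℂ} (hp : al K p ∈ Mv b K v) : evp b v p = 0 := by
  obtain ⟨q, hq, h⟩ := hp
  have := al_inj K h
  rw [← this]; exact hq

theorem Mv_Rs (v : V) {f : K} (hf : f ∈ Mv b K v) : f ∈ Rs ι K := by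
  obtain ⟨p, hp, rfl⟩ := hf
  exact ⟨p, rfl⟩

theorem nb_pow_Dg (y : V) (m : ℕ) {k : ℤ} {F : MonoidAlgebra K W} (hF : F ∈ XS (Dg ι K k)) :
    (nb b K S y ^ m) F ∈ XS (Dg ι K (k - m)) := by
  induction m with
  | zero => simpa using hF
  | succ m ih =>
    rw [pow_succ', Module.End.mul_apply]
    have := nb_Dg b K S y ih
    convert this using 3
    push_cast; ring

/-- partial Taylor projection -/
def tay (z : K) (y : V) (n : ℕ) (F : MonoidAlgebra K W) : MonoidAlgebra K W :=
  ∑ m ∈ Finset.range n, ((-1) ^ m / (m.factorial : ℂ)) • z ^ m • (nb b K S y ^ m) F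

theorem nb_tay (z : K) (y : V) (hz : dK b K y z = 1) (n : ℕ) (F : MonoidAlgebra K W) :
    nb b K S y (tay b K S z y (n + 1) F) =
      ((-1) ^ n / (n.factorial : ℂ)) • z ^ n • (nb b K S y ^ (n + 1)) F := by
  induction n with
  | zero => simp [tay]
  | succ n ih =>
    rw [tay, Finset.sum_range_succ, map_add, ← tay, ih, map_smul, nb_smul, dK_pow, hz,
      pow_succ' (nb b K S y) (n + 1), Module.End.mul_apply, mul_one]
    have h1 : (((n : K) + 1) * z ^ n) = algebraMap ℂ K (n + 1) * z ^ n := by simp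
    rw [h1, mul_smul, algebraMap_smul, smul_add, smul_smul, ← add_assoc, ← add_smul]
    have h2 : ((-1) ^ n / (n.factorial : ℂ) + (-1) ^ (n + 1) / ((n + 1).factorial : ℂ) * (n + 1)) = 0 := by
      rw [Nat.factorial_succ]
      have h3 : (n.factorial : ℂ) ≠ 0 := by exact_mod_cast n.factorial_ne_zero
      have h4 : ((n : ℂ) + 1) ≠ 0 := by exact_mod_cast n.succ_ne_zero
      push_cast
      field_simp
      ring
    rw [h2, zero_smul, zero_add]

section equi

variable {S} (hS : ∀ (w : W) (H : Ar W), H ∈ S → mv w H ∈ S)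
include hS

theorem nb_pow_comm (y y' : V) (m : ℕ) (F : MonoidAlgebra K W) :
    (nb b K S y ^ m) (nb b K S y' F) = nb b K S y' ((nb b K S y ^ m) F) := by
  induction m with
  | zero => rfl
  | succ m ih => rw [pow_succ', Module.End.mul_apply, ih, nb_comm b K hS]; rfl

theorem Mm_nb (y : V) {F : MonoidAlgebra K W} (hF : F ∈ Mm b K S) : nb b K S y F ∈ Mm b K S := by
  refine ⟨nb_Rd b K S y hF.1, fun H hH m => ?_⟩
  rw [nb_pow_comm b K hS]
  set h := y - frm H y • ly H with hh
  have hh0 : frm H h = 0 := by simp [hh, (ld H).fy]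
  have hy : y = frm H y • ly H + h := by rw [hh]; abel
  rw [hy, nb_add, nb_csmul]
  refine Submodule.add_mem _ (Submodule.smul_mem _ _ ?_) ?_
  · have := hF.2 H hH (m + 1)
    rwa [pow_succ', Module.End.mul_apply] at this
  · have h1 := hF.2 H hH m
    rw [nb_apply, om_eq_omr_h b K S hh0]
    refine Submodule.sub_mem _ (XS_cmap (fun f hf => Ok_dK0 b _ h hf) h1) ?_
    exact fl_mul0 b K H (omr_fl b K S H h) h1

theorem Mm_poly (p : MvPolynomial ι ℂ) {F : MonoidAlgebra K W} (hF : F ∈ Mm b K S) :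
    al K p • F ∈ Mm b K S := by
  refine ⟨XS_smul (fun f hf => Rd_mul (Rd_Rs (Rs_al K p)) hf) hF.1, fun H hH m => ?_⟩
  induction m generalizing F p with
  | zero => exact fl_smul0 b K H (Ok_al _ p) (hF.2 H hH 0)
  | succ m ih =>
    rw [pow_succ, Module.End.mul_apply, nb_smul, map_add, dK_al]
    exact Submodule.add_mem _ (ih _ hF) (ih _ (Mm_nb b K hS _ hF))

theorem Mm_DD : al K (DD b S) • (1 : MonoidAlgebra K W) ∈ Mm b K S := by
  classical
  have h1 : ∀ T : Submodule ℂ K, (1 : K) ∈ T → (1 : MonoidAlgebra K W) ∈ XS T := fun T hT => by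
    rw [← cst_one]; exact XS_cst hT 1
  refine ⟨XS_smul (T := Rs ι K) (fun f hf => Rd_mul (Rd_Rs (Rs_al K _)) (Rd_Rs hf))
    (h1 _ (Rs_one K)), fun H hH m => ?_⟩
  refine (ld H).nb_pow_fl b K hH hS ?_ m
  change _ ∈ fl b K H (eH H)
  rw [DD, ← Finset.mul_prod_erase S _ hH, map_mul, map_pow, mul_smul]
  have h2 : (1 : MonoidAlgebra K W) ∈ fl b K H 0 := h1 _ (Ok_one _)
  have h3 := fl_pow b K H (eH H) (fl_smul0 b K H (Ok_al (pl_prime b H)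
    (∏ x ∈ S.erase H, pl b x ^ eH x)) h2)
  rwa [add_zero] at h3

theorem tay_spec {v : V} {n : ℕ} {F : MonoidAlgebra K W} (hF : F ∈ Mm b K S)
    (hd : F ∈ XS (Dg ι K n)) (h1 : F - 1 ∈ XS (Mv b K v)) (T : Finset ι)
    (hT : ∀ i ∈ T, nb b K S (b i) F = 0) (j : ι) (hj : j ∉ T) :
    ∃ G ∈ Mm b K S, G ∈ XS (Dg ι K n) ∧ G - 1 ∈ XS (Mv b K v) ∧ nb b K S (b j) G = 0 ∧
      ∀ i ∈ T, nb b K S (b i) G = 0 := by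
  classical
  set p : MvPolynomial ι ℂ := X j - C (b.repr v j) with hp
  have hpow : ∀ m, (nb b K S (b j) ^ m) F ∈ Mm b K S := by
    intro m
    induction m with
    | zero => exact hF
    | succ m ih => rw [pow_succ', Module.End.mul_apply]; exact Mm_nb b K hS _ ih
  have hdp : ∀ i, dK b K (b i) (al K p) = if i = j then 1 else 0 := by
    intro i
    rw [dK_al, hp, map_sub, dR_X, dR_C, Module.Basis.repr_self, Finsupp.single_apply]
    split_ifs <;> simp
  have hpd : p.totalDegree ≤ 1 := by
    refine (totalDegree_sub _ _).trans ?_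
    simp
  refine ⟨tay b K S (al K p) (b j) (n + 1) F, ?_, ?_, ?_, ?_, ?_⟩
  · refine Submodule.sum_mem _ fun m _ => Submodule.smul_mem _ _ ?_
    rw [← map_pow]
    exact Mm_poly b K hS _ (hpow m)
  · refine Submodule.sum_mem _ fun m _ => Submodule.smul_mem _ _ ?_
    rw [← map_pow]
    refine XS_smul (fun f hf => ?_) (nb_pow_Dg b K S (b j) m hd)
    have h2 : al K (p ^ m) ∈ Dg ι K m := Dg_al K (by
      have := (totalDegree_pow p m).trans (Nat.mul_le_mul_left m hpd)
      exact_mod_cast (by simpa using this))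
    have := Dg_mul K h2 hf
    convert this using 2
    ring
  · rw [tay, Finset.sum_range_succ']
    have : ∑ m ∈ Finset.range n, ((-1) ^ (m + 1) / ((m + 1).factorial : ℂ)) •
        al K p ^ (m + 1) • (nb b K S (b j) ^ (m + 1)) F ∈ XS (Mv b K v) := by
      refine Submodule.sum_mem _ fun m _ => Submodule.smul_mem _ _ ?_
      rw [← map_pow]
      refine XS_smul (fun f hf => Mv_mul b K v (Mv_al b K v ?_) hf) (Mm_Rs b K S (hpow (m + 1)))
      rw [map_pow, hp]
      simp [evp]
    have := Submodule.add_mem _ this h1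
    simpa [add_sub_assoc] using this
  · rw [nb_tay _ _ _ _ _ (by rw [hdp, if_pos rfl])]
    have : (nb b K S (b j) ^ (n + 1)) F = 0 := by
      apply XS_zero_of (ι := ι) (k := -1) K (by norm_num) (Mm_Rs b K S (hpow (n + 1)))
      have := nb_pow_Dg b K S (b j) (n + 1) hd
      convert this using 3
      push_cast; ring
    rw [this, smul_zero, smul_zero]
  · intro i hi
    have hij : i ≠ j := by rintro rfl; exact hj hi
    rw [tay, map_sum]
    refine Finset.sum_eq_zero fun m _ => ?_
    rw [map_smul, nb_smul, ← nb_pow_comm b K hS, hT i hi, map_zero, smul_zero, add_zero]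
    have : dK b K (b i) (al K p ^ m) = 0 := by
      cases m with
      | zero => simp [dK_one]
      | succ m => rw [dK_pow, hdp, if_neg hij, mul_zero]
    rw [this, zero_smul, smul_zero]

theorem exists_Phi {v : V} (hv : ∀ H : Ar W, v ∉ H.1) :
    ∃ F ∈ Mm b K S, F ∈ XS (Dg ι K (dS S)) ∧ F - 1 ∈ XS (Mv b K v) ∧ ∀ y, nb b K S y F = 0 := by
  classical
  have key : ∀ T : Finset ι, ∃ F ∈ Mm b K S, F ∈ XS (Dg ι K (dS S)) ∧ F - 1 ∈ XS (Mv b K v) ∧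
      ∀ i ∈ T, nb b K S (b i) F = 0 := by
    intro T
    induction T using Finset.induction_on with
    | empty =>
      set c := evp b v (DD b S) with hc
      have hc0 : c ≠ 0 := DD_evp b S hv
      have h1 : ∀ T : Submodule ℂ K, (1 : K) ∈ T → (1 : MonoidAlgebra K W) ∈ XS T := fun T hT => by
        rw [← cst_one]; exact XS_cst hT 1
      refine ⟨c⁻¹ • al K (DD b S) • 1, Submodule.smul_mem _ _ (Mm_DD b K hS), ?_, ?_, by simp⟩
      · refine Submodule.smul_mem _ _ (XS_smul (T := Dg ι K 0) (fun f hf => ?_) (h1 _ (Dg_one K)))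
        have := Dg_mul K (Dg_al K (by exact_mod_cast DD_deg b S) : al K (DD b S) ∈ Dg ι K (dS S)) hf
        simpa using this
      · have : (c⁻¹ • al K (DD b S) • (1 : MonoidAlgebra K W) - 1) =
            c⁻¹ • (al K (DD b S - C c) • (1 : MonoidAlgebra K W)) := by
          rw [map_sub, al_C, sub_smul, smul_sub, algebraMap_smul, smul_smul c⁻¹ c,
            inv_mul_cancel₀ hc0, one_smul]
        rw [this]
        refine Submodule.smul_mem _ _ (XS_smul (fun f hf => Mv_mul b K v (Mv_al b K v ?_) hf)
          (h1 _ (Rs_one (ι := ι) K)))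
        rw [map_sub, ← hc]
        simp [evp]
    | insert j T hj ih =>
      obtain ⟨F, h1, h2, h3, h4⟩ := ih
      obtain ⟨G, g1, g2, g3, g4, g5⟩ := tay_spec b K hS h1 h2 h3 T h4 j hj
      refine ⟨G, g1, g2, g3, fun i hi => ?_⟩
      rcases Finset.mem_insert.1 hi with rfl | hi
      · exact g4
      · exact g5 i hi
  obtain ⟨F, h1, h2, h3, h4⟩ := key Finset.univ
  refine ⟨F, h1, h2, h3, fun y => ?_⟩
  let f : V →ₗ[ℂ] MonoidAlgebra K W :=
    { toFun := fun y => nb b K S y F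
      map_add' := fun y y' => nb_add b K S y y' F
      map_smul' := fun c y => nb_csmul b K S c y F }
  have : f = 0 := b.ext fun i => h4 i (Finset.mem_univ i)
  exact LinearMap.congr_fun this y

end equi

end Sol

end KZ

namespace KZ

section Sol2

open MvPolynomial

variable [FiniteDimensional ℂ V] {W : Subgroup (V →ₗ[ℂ] V)ˣ} [Fintype W]
variable {ι : Type*} [Fintype ι] (b : Module.Basis ι ℂ V)
variable (K : Type*) [Field K] [Algebra (MvPolynomial ι ℂ) K] [IsFractionRing (MvPolynomial ι ℂ) K]
  [Algebra ℂ K] [IsScalarTower ℂ (MvPolynomial ι ℂ) K]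
variable (S : Finset (Ar W))

/-- fundamental solution with its inverse -/
structure FSol (v : V) (F G : MonoidAlgebra K W) : Prop where
  right : F * G = 1
  left : G * F = 1
  flat : ∀ y, nb b K S y F = 0
  rs : F ∈ XS (Rs ι K)
  dg : F ∈ XS (Dg ι K (dS S))
  at1 : F - 1 ∈ XS (Mv b K v)
  inv : al K (DD b S) • G ∈ XS (Rs ι K)

theorem mul_inj_of_at1 {v : V} {F : MonoidAlgebra K W} (h : F - 1 ∈ XS (Mv b K v))
    {G : MonoidAlgebra K W} (hG : F * G = 0) : G = 0 := by
  classical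
  have h1 : ∀ w, ∃ p, evp b v p = (if w = 1 then 1 else 0) ∧ al K p = F.coeff w := by
    intro w
    obtain ⟨p, hp, h2⟩ := h w
    have hp' : evp b v p = 0 := hp
    have h2' : al K p = F.coeff w - (if w = 1 then 1 else 0) := by
      have h3 : al K p = (F - 1).coeff w := h2
      rw [h3, MonoidAlgebra.coeff_sub, Finsupp.sub_apply, MonoidAlgebra.one_def,
        MonoidAlgebra.coeff_single, Finsupp.single_apply]
      simp only [eq_comm]
    refine ⟨p + if w = 1 then 1 else 0, ?_, ?_⟩
    · rw [map_add, hp', zero_add]; split_ifs <;> simp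
    · rw [map_add, h2']; split_ifs <;> simp
  choose p hp1 hp2 using h1
  let m : Matrix W W (MvPolynomial ι ℂ) := Matrix.of fun u w => p (u * w⁻¹)
  have hdet : m.det ≠ 0 := by
    intro h0
    have h2 := congrArg (evp b v) h0
    rw [AlgHom.map_det, map_zero] at h2
    have : (evp b v).mapMatrix m = 1 := by
      ext u w
      simp only [AlgHom.mapMatrix_apply, Matrix.map_apply, Matrix.of_apply, m, hp1,
        Matrix.one_apply, mul_inv_eq_one]
    rw [this, Matrix.det_one] at h2
    exact one_ne_zero h2
  have hdet' : ((al K).mapMatrix m).det ≠ 0 := by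
    rw [← RingHom.map_det]
    exact al_ne_zero hdet
  have h3 : ((al K).mapMatrix m).mulVec (fun w => G.coeff w) = 0 := by
    ext u
    have h4 : (F * G).coeff u = 0 := by rw [hG]; rfl
    rw [coeff_mul'] at h4
    rw [Pi.zero_apply, ← h4, Matrix.mulVec, dotProduct]
    refine Fintype.sum_equiv ((Equiv.inv W).trans (Equiv.mulLeft u)) _ _ fun w => ?_
    simp [m, hp2]
  have h5 := Matrix.eq_zero_of_mulVec_eq_zero hdet' h3
  apply ga_ext
  intro w
  exact congrFun h5 w

theorem exists_inv {v : V} {F : MonoidAlgebra K W} (h : F - 1 ∈ XS (Mv b K v)) :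
    ∃ G, F * G = 1 ∧ G * F = 1 := by
  have hfin : Module.Finite K (MonoidAlgebra K W) :=
    Module.Finite.equiv (MonoidAlgebra.coeffLinearEquiv K : MonoidAlgebra K W ≃ₗ[K] (W →₀ K)).symm
  have hinj : Function.Injective (LinearMap.mulLeft K F) := by
    rw [injective_iff_map_eq_zero]
    intro G hG
    exact mul_inj_of_at1 b K h hG
  obtain ⟨G, hG⟩ := (LinearMap.injective_iff_surjective.1 hinj) 1
  have hG : F * G = 1 := hG
  refine ⟨G, hG, ?_⟩
  apply hinj
  change F * (G * F) = F * 1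
  rw [← mul_assoc, hG, one_mul, mul_one]

variable {S} (hS : ∀ (w : W) (H : Ar W), H ∈ S → mv w H ∈ S)
include hS

theorem exists_FSol {v : V} (hv : ∀ H : Ar W, v ∉ H.1) : ∃ F G, FSol b K S v F G := by
  obtain ⟨F, h1, h2, h3, h4⟩ := exists_Phi b K hS hv
  obtain ⟨G, hG, hG'⟩ := exists_inv b K h3
  refine ⟨F, G, hG, hG', h4, Mm_Rs b K S h1, h2, h3, ?_⟩
  have hcd : ∀ (y : V) (E : MonoidAlgebra K W), cd b K y (G * E) = G * nb b K S y E := by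
    intro y E
    have h5 := nb_mul b K S y F (G * E)
    rw [← mul_assoc, hG, one_mul, h4, zero_mul, zero_add] at h5
    rw [h5, ← mul_assoc, hG', one_mul]
  have key : ∀ n : ℕ, ∀ E ∈ Mm b K S, E ∈ XS (Dg ι K ((n : ℤ) - 1)) → G * E ∈ XS (Rs ι K) := by
    intro n
    induction n with
    | zero =>
      intro E hE hd
      rw [XS_zero_of (ι := ι) K (by norm_num) (Mm_Rs b K S hE) hd, mul_zero]
      exact Submodule.zero_mem _
    | succ n ih =>
      intro E hE hd w
      apply Rs_of_dK b K
      intro y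
      have h6 := ih (nb b K S y E) (Mm_nb b K hS y hE) (by
        have := nb_Dg b K S y hd
        convert this using 3
        push_cast; ring)
      rw [← hcd] at h6
      have := h6 w
      rwa [cd, coeff_cmap] at this
  have h7 := key (dS S + 1) _ (Mm_DD b K hS) (by
    have h1 : (1 : MonoidAlgebra K W) ∈ XS (Dg ι K 0) := by
      rw [← cst_one]; exact XS_cst (Dg_one K) 1
    refine XS_smul (fun f hf => ?_) h1
    have := Dg_mul K (Dg_al K (by exact_mod_cast DD_deg b S) : al K (DD b S) ∈ Dg ι K (dS S)) hf
    convert this using 2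
    push_cast; ring)
  rwa [mul_smul_comm, mul_one] at h7

end Sol2

section FS

open MvPolynomial

variable [FiniteDimensional ℂ V] {W : Subgroup (V →ₗ[ℂ] V)ˣ} [Fintype W]
variable {ι : Type*} [Fintype ι] {b : Module.Basis ι ℂ V}
variable {K : Type*} [Field K] [Algebra (MvPolynomial ι ℂ) K] [IsFractionRing (MvPolynomial ι ℂ) K]
  [Algebra ℂ K] [IsScalarTower ℂ (MvPolynomial ι ℂ) K]
variable {S : Finset (Ar W)} {v : V} {F G : MonoidAlgebra K W} (P : FSol b K S v F G)
include P

theorem FSol.rd : G ∈ XS (Rd K (Dl b S)) := by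
  have hdvd : DD b S ∣ Dl b S ^ (dS S) := by
    rw [DD, Dl, ← Finset.prod_pow]
    refine Finset.prod_dvd_prod_of_dvd _ _ fun H hH => pow_dvd_pow _ ?_
    exact Finset.single_le_sum (f := fun H => eH H) (fun _ _ => Nat.zero_le _) hH
  obtain ⟨q, hq⟩ := hdvd
  intro w
  refine ⟨dS S, ?_⟩
  have h1 := P.inv w
  rw [MonoidAlgebra.coeff_smul, Finsupp.smul_apply, smul_eq_mul] at h1
  rw [← map_pow, hq, map_mul, mul_comm (al K _), mul_assoc]
  exact Rs_mul K (Rs_al K q) h1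

theorem FSol.fl (H : Ar W) : F ∈ fl b K H 0 := fun w => Ok_Rs _ (P.rs w)

theorem FSol.inv_fl {H : Ar W} (hH : H ∈ S) : al K (pl b H) ^ (eH H) • G ∈ KZ.fl b K H 0 := by
  classical
  intro w
  have h1 := P.inv w
  rw [DD, ← Finset.mul_prod_erase S _ hH, map_mul, map_pow] at h1
  rw [MonoidAlgebra.coeff_smul, Finsupp.smul_apply, smul_eq_mul] at h1 ⊢
  set q := ∏ x ∈ S.erase H, pl b x ^ eH x with hq
  have hnd : ¬ pl b H ∣ q := by
    intro hd
    obtain ⟨H', hH', h2⟩ := (pl_prime b H).exists_mem_finset_dvd hd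
    exact pl_not_dvd b (Finset.ne_of_mem_erase hH').symm ((pl_prime b H).dvd_of_dvd_pow h2)
  have hq0 : al K q ≠ 0 := al_ne_zero (by rintro h; rw [h] at hnd; exact hnd (dvd_zero _))
  have h2 := Ok_mul0 _ (Ok_inv (K := K) (pl_prime b H) hnd) (Ok_Rs (pl_prime b H) h1)
  convert h2 using 1
  field_simp

theorem FSol.inv_fl' {H : Ar W} (hH : H ∉ S) : G ∈ KZ.fl b K H 0 := fun w => by
  refine Rd_Ok (pl_prime b H) ?_ (P.rd w)
  intro hd
  obtain ⟨H', hH', h2⟩ := (pl_prime b H).exists_mem_finset_dvd hd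
  exact pl_not_dvd b (by rintro rfl; exact hH hH') h2

theorem FSol.nb_mul_left (y : V) (E : MonoidAlgebra K W) : nb b K S y (F * E) = F * cd b K y E := by
  rw [nb_mul, P.flat, zero_mul, zero_add]

theorem FSol.const {E : MonoidAlgebra K W} (h : ∀ y, nb b K S y E = 0) :
    ∃ a : MonoidAlgebra ℂ W, E = F * cst K a := by
  have h1 : ∀ y, cd b K y (G * E) = 0 := by
    intro y
    have h5 := P.nb_mul_left y (G * E)
    rw [← mul_assoc, P.right, one_mul, h] at h5
    have := congrArg (fun x => G * x) h5
    simp only [← mul_assoc, P.left, one_mul, mul_zero] at this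
    exact this.symm
  have h2 : ∀ w, ∃ c : ℂ, (G * E).coeff w = algebraMap ℂ K c := by
    intro w
    apply const_of_dK b K
    intro y
    have := congrArg (fun x => x.coeff w) (h1 y)
    simpa [cd] using this
  choose c hc using h2
  refine ⟨MonoidAlgebra.ofCoeff (Finsupp.equivFunOnFinite.symm c), ?_⟩
  have : G * E = cst K (MonoidAlgebra.ofCoeff (Finsupp.equivFunOnFinite.symm c)) := by
    apply ga_ext; intro w
    rw [hc, coeff_cst]; rfl
  rw [← this, ← mul_assoc, P.right, one_mul]

theorem FSol.inj {a a' : MonoidAlgebra ℂ W} (h : F * cst K a = F * cst K a') : a = a' := by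
  have := congrArg (fun x => G * x) h
  simp only [← mul_assoc, P.left, one_mul] at this
  exact cst_injective this

variable (hS : ∀ (w : W) (H : Ar W), H ∈ S → mv w H ∈ S)
include hS

theorem FSol.exists_mono (w : W) : ∃ a : MonoidAlgebra ℂ W, st b K w F = F * cst K a := by
  apply P.const
  intro y
  have := st_nb b K hS w (toLin W w⁻¹ y) F
  rw [P.flat, map_zero, tl_inv_apply] at this
  exact this.symm

/-- monodromy -/
def FSol.Th (w : W) : MonoidAlgebra ℂ W := (P.exists_mono hS w).choose

theorem FSol.Th_spec (w : W) : st b K w F = F * cst K (P.Th hS w) :=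
  (P.exists_mono hS w).choose_spec

theorem FSol.Th_one : P.Th hS 1 = 1 := by
  apply P.inj
  rw [← P.Th_spec hS, st_one, cst_one, mul_one]

theorem FSol.Th_mul (w w' : W) : P.Th hS (w * w') = P.Th hS w * P.Th hS w' := by
  apply P.inj
  rw [← P.Th_spec hS, st_st, P.Th_spec hS w', st_mul, P.Th_spec hS w, ca_cst, cst_mul, mul_assoc]

/-- the monodromy homomorphism -/
def FSol.th : MonoidAlgebra ℂ W →ₐ[ℂ] MonoidAlgebra ℂ W :=
  MonoidAlgebra.lift ℂ (MonoidAlgebra ℂ W) W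
    { toFun := P.Th hS, map_one' := P.Th_one hS, map_mul' := P.Th_mul hS }

theorem FSol.th_el (w : W) : P.th hS (el ℂ w) = P.Th hS w := by
  simp [FSol.th, el]

end FS

end KZ

namespace KZ

section Euler

open MvPolynomial

variable {ι : Type*} [Fintype ι] (b : Module.Basis ι ℂ V)

/-- Euler operator -/
def eul : MvPolynomial ι ℂ →ₗ[ℂ] MvPolynomial ι ℂ :=
  ∑ i, LinearMap.mulLeft ℂ (X i) ∘ₗ (dR b (b i)).toLinearMap

theorem eul_apply (p : MvPolynomial ι ℂ) : eul b p = ∑ i, X i * dR b (b i) p := by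
  simp [eul, LinearMap.sum_apply]

theorem eul_hom {n : ℕ} {p : MvPolynomial ι ℂ} (h : p.IsHomogeneous n) :
    eul b p = (n : ℂ) • p := by
  classical
  rw [eul_apply]
  simp only [dR_basis]
  rw [h.sum_X_mul_pderiv]
  rw [← Nat.cast_smul_eq_nsmul ℂ]

theorem hc_eul (k : ℕ) (p : MvPolynomial ι ℂ) :
    homogeneousComponent k (eul b p) = (k : ℂ) • homogeneousComponent k p := by
  have h1 : eul b p = ∑ i ∈ Finset.range (p.totalDegree + 1), (i : ℂ) • homogeneousComponent i p := by
    conv_lhs => rw [← sum_homogeneousComponent p, map_sum]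
    refine Finset.sum_congr rfl fun i _ => ?_
    exact eul_hom b (homogeneousComponent_isHomogeneous i p)
  rw [h1, map_sum]
  simp only [map_smul]
  have h2 : ∀ i, homogeneousComponent k (homogeneousComponent i p) =
      if i = k then homogeneousComponent i p else 0 := by
    intro i
    rw [homogeneousComponent_of_mem (n := i) (homogeneousComponent_mem i p)]
    simp only [eq_comm]
  simp only [h2]
  by_cases hk : k ∈ Finset.range (p.totalDegree + 1)
  · rw [Finset.sum_eq_single k]
    · simp
    · intro i _ hi; simp [hi]
    · intro h; exact absurd hk h
  · rw [homogeneousComponent_eq_zero, smul_zero]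
    · apply Finset.sum_eq_zero
      intro i hi
      rw [if_neg, smul_zero]
      rintro rfl; exact hk hi
    · simpa using hk

theorem evp_smul_hc (c : ℂ) (v : V) (p : MvPolynomial ι ℂ) {D : ℕ} (hD : p.totalDegree ≤ D) :
    evp b (c • v) p = ∑ k ∈ Finset.range (D + 1), c ^ k * evp b v (homogeneousComponent k p) := by
  have h0 : p = ∑ k ∈ Finset.range (D + 1), homogeneousComponent k p := by
    conv_lhs => rw [← sum_homogeneousComponent p]
    apply Finset.sum_subset
    · intro x hx; simp only [Finset.mem_range] at *; omega
    · intro x _ hx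
      apply homogeneousComponent_eq_zero
      simp only [Finset.mem_range] at hx; omega
  conv_lhs => rw [h0, map_sum]
  refine Finset.sum_congr rfl fun k _ => ?_
  have h1 := homogeneousComponent_isHomogeneous k p
  rw [evp, evp, aeval_def, aeval_def, eval₂_eq', eval₂_eq', Finset.mul_sum]
  refine Finset.sum_congr rfl fun m hm => ?_
  have hd := h1 (mem_support_iff.1 hm)
  have hd2 : ∑ i, m i = k := by
    rw [← hd, Finsupp.weight_apply, Finsupp.sum_fintype] <;> simp
  have : ∀ i, b.repr (c • v) i = c * b.repr v i := by intro i; simp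
  simp only [this, mul_pow]
  rw [Finset.prod_mul_distrib, Finset.prod_pow_eq_pow_sum, hd2]
  ring

end Euler

section FS2

open MvPolynomial

variable [FiniteDimensional ℂ V] {W : Subgroup (V →ₗ[ℂ] V)ˣ} [Fintype W]
variable {ι : Type*} [Fintype ι] {b : Module.Basis ι ℂ V}
variable {K : Type*} [Field K] [Algebra (MvPolynomial ι ℂ) K] [IsFractionRing (MvPolynomial ι ℂ) K]
  [Algebra ℂ K] [IsScalarTower ℂ (MvPolynomial ι ℂ) K]
variable {S : Finset (Ar W)} {v : V} {F G : MonoidAlgebra K W} (P : FSol b K S v F G)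

/-- residue sum -/
def cS (S : Finset (Ar W)) : MonoidAlgebra ℂ W := ∑ H ∈ S, PP H

theorem sum_lgd (H : Ar W) : ∑ i, al K (X i) * lgd b K H (b i) = 1 := by
  have h0 := pl_ne b K H
  simp only [lgd, ← mul_assoc]
  rw [← Finset.sum_mul]
  have : ∑ i, al K (X i) * algebraMap ℂ K (frm H (b i)) = al K (pl b H) := by
    rw [pl, lin, map_sum]
    refine Finset.sum_congr rfl fun i _ => ?_
    rw [map_mul, al_C, mul_comm]
  rw [this, mul_inv_cancel₀ h0]

theorem sum_om : ∑ i, al K (X i) • om b K S (b i) = cst K (cS S) := by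
  simp only [om, Finset.smul_sum, smul_smul]
  rw [Finset.sum_comm, cS, map_sum]
  refine Finset.sum_congr rfl fun H _ => ?_
  rw [← Finset.sum_smul, sum_lgd, one_smul]

include P

theorem FSol.exists_f (hS : ∀ (w : W) (H : Ar W), H ∈ S → mv w H ∈ S) :
    ∃ f : ℕ → MonoidAlgebra ℂ W, (∑ k ∈ Finset.range (dS S + 1), f k = 1) ∧
    (∀ k, cS S * f k = (k : ℂ) • f k) ∧
    ∀ (g : W) (ζ : ℂ), toLin W g v = ζ • v → ζ ≠ 0 →
      P.Th hS g = el ℂ g * ∑ k ∈ Finset.range (dS S + 1), (ζ⁻¹ ^ k) • f k := by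
  classical
  choose q hq using P.rs
  let Q : MonoidAlgebra (MvPolynomial ι ℂ) W := MonoidAlgebra.ofCoeff (Finsupp.equivFunOnFinite.symm q)
  have hQc : ∀ w, Q.coeff w = q w := fun w => rfl
  have hQ : cmap (alh K).toLinearMap Q = F := by
    apply ga_ext; intro w
    rw [coeff_cmap, hQc]; exact hq w
  have hdeg : ∀ w, (q w).totalDegree ≤ dS S := by
    intro w
    have h1 : al K (q w) ∈ Dg ι K (dS S) := by
      have := P.dg w
      rw [← hq w] at this; exact this
    rcases Dg_al_iff K h1 with h | h
    · rw [h]; simp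
    · exact_mod_cast h
  have hinj : ∀ Q1 Q2 : MonoidAlgebra (MvPolynomial ι ℂ) W,
      cmap (alh K).toLinearMap Q1 = cmap (alh K).toLinearMap Q2 → Q1 = Q2 := by
    intro Q1 Q2 h
    apply ga_ext; intro w
    have := congrArg (fun x => x.coeff w) h
    simp only [coeff_cmap] at this
    exact alh_inj K this
  have hev : cmap (evp b v).toLinearMap Q = 1 := by
    have h1 : cmap (alh K).toLinearMap (Q - 1) ∈ XS (Mv b K v) := by
      rw [map_sub, hQ, cmap_one]; exact P.at1
    have h2 : cmap (evp b v).toLinearMap (Q - 1) = 0 := by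
      apply ga_ext; intro w
      have h3 := h1 w
      rw [coeff_cmap] at h3
      rw [coeff_cmap]
      exact Mv_al_iff b K v h3
    rw [map_sub, cmap_one, sub_eq_zero] at h2
    exact h2
  have heul : cmap (eul b) Q = cst _ (cS S) * Q := by
    apply hinj
    rw [cmap_mul, cmap_cst, hQ]
    rw [← sum_om (b := b), Finset.sum_mul]
    have : ∀ i, (al K (X i) • om b K S (b i)) * F = al K (X i) • cd b K (b i) F := by
      intro i
      have := P.flat (b i)
      rw [nb_apply, sub_eq_zero] at this
      rw [smul_mul_assoc, this]
    rw [Finset.sum_congr rfl fun i _ => this i]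
    apply ga_ext; intro w
    rw [coeff_cmap, coeff_cmap, MonoidAlgebra.coeff_sum, Finsupp.finset_sum_apply]
    simp only [MonoidAlgebra.coeff_smul, Finsupp.smul_apply, cd, coeff_cmap, smul_eq_mul]
    have e : ∀ w, F.coeff w = al K (q w) := fun w => (hq w).symm
    simp only [e, dK_al, hQc, eul_apply, AlgHom.toLinearMap_apply, alh_apply, map_sum, map_mul]
  refine ⟨fun k => cmap ((evp b v).toLinearMap ∘ₗ homogeneousComponent k) Q, ?_, ?_, ?_⟩
  · rw [← hev]
    apply ga_ext; intro w
    rw [MonoidAlgebra.coeff_sum, Finsupp.finset_sum_apply]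
    simp only [coeff_cmap]
    have := evp_smul_hc b 1 v (q w) (hdeg w)
    simp only [one_smul, one_pow, one_mul] at this
    exact this.symm
  · intro k
    have h1 := cmap_cst_mul ((evp b v).toLinearMap ∘ₗ homogeneousComponent k) (cS S) Q
    rw [← heul] at h1
    have h2 : ∀ x : MonoidAlgebra ℂ W, cst ℂ x = x := fun x => cmap_id x
    rw [h2] at h1
    rw [← h1]
    apply ga_ext; intro w
    rw [MonoidAlgebra.coeff_smul, Finsupp.smul_apply]
    simp only [coeff_cmap, LinearMap.comp_apply, hc_eul, map_smul]
  · intro g ζ hg hζ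
    have h1 : el _ g * cmap (sbs b (toLin W g⁻¹)).toLinearMap Q = Q * cst _ (P.Th hS g) := by
      apply hinj
      rw [cmap_mul, cmap_mul, cmap_cst, hQ, ← P.Th_spec hS, st_apply, ← cst_el, cmap_cst, cst_el]
      congr 1
      apply ga_ext; intro w
      rw [ca, coeff_cmap, coeff_cmap, coeff_cmap, ← hq w]
      exact (act_al b K g (q w)).symm
    have h2 := congrArg (cmap (evp b v).toLinearMap) h1
    have h3 : ∀ x : MonoidAlgebra ℂ W, cst ℂ x = x := fun x => cmap_id x
    rw [cmap_mul, cmap_mul, cmap_cst, hev, one_mul, h3, ← cst_el, cmap_cst, h3] at h2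
    rw [← h2]
    congr 1
    have hgi : toLin W g⁻¹ v = ζ⁻¹ • v := by
      have := tl_inv_apply' g v
      rw [hg, map_smul] at this
      rw [← this, smul_smul, inv_mul_cancel₀ hζ, one_smul, this]
    apply ga_ext; intro w
    rw [MonoidAlgebra.coeff_sum, Finsupp.finset_sum_apply]
    simp only [coeff_cmap, MonoidAlgebra.coeff_smul, Finsupp.smul_apply]
    have := evp_smul_hc b ζ⁻¹ v (q w) (hdeg w)
    rw [← hgi, ← evp_sbs] at this
    exact this

end FS2

end KZ

namespace KZ

section Ext

variable {G : Type*} [Group G] [Fintype G] {A B : Type*} [CommRing A] [Algebra ℂ A]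
  [CommRing B] [Algebra ℂ B]

/-- the basis of group elements -/
def bs (A : Type*) [CommRing A] : Module.Basis G A (MonoidAlgebra A G) :=
  Module.Basis.ofRepr (MonoidAlgebra.coeffLinearEquiv A)

theorem bs_apply (w : G) : bs A w = el A w := by
  simp [bs, el]

theorem ga_sum (F : MonoidAlgebra A G) : F = ∑ w, F.coeff w • el A w := by
  conv_lhs => rw [← (bs A).sum_repr F]
  refine Finset.sum_congr rfl fun w _ => ?_
  rw [bs_apply]; rfl

theorem tr_eq (f : MonoidAlgebra A G →ₗ[A] MonoidAlgebra A G) :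
    LinearMap.trace A _ f = ∑ w, (f (el A w)).coeff w := by
  classical
  rw [LinearMap.trace_eq_matrix_trace A (bs A), Matrix.trace]
  refine Finset.sum_congr rfl fun w _ => ?_
  rw [Matrix.diag_apply, LinearMap.toMatrix_apply, bs_apply]; rfl

/-- extension of scalars -/
def ext (A : Type*) [CommRing A] [Algebra ℂ A]
    (φ : MonoidAlgebra ℂ G →ₗ[ℂ] MonoidAlgebra ℂ G) : MonoidAlgebra A G →ₗ[A] MonoidAlgebra A G :=
  (bs A).constr A (fun w => cst A (φ (el ℂ w)))

variable (φ ψ : MonoidAlgebra ℂ G →ₗ[ℂ] MonoidAlgebra ℂ G)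

theorem ext_el (w : G) : ext A φ (el A w) = cst A (φ (el ℂ w)) := by
  rw [← bs_apply, ext, Module.Basis.constr_basis]

theorem ext_eq (F : MonoidAlgebra A G) :
    ext A φ F = ∑ w, F.coeff w • cst A (φ (el ℂ w)) := by
  conv_lhs => rw [ga_sum F, map_sum]
  refine Finset.sum_congr rfl fun w _ => ?_
  rw [map_smul, ext_el]

theorem ext_cst (a : MonoidAlgebra ℂ G) : ext A φ (cst A a) = cst A (φ a) := by
  rw [ext_eq]
  conv_rhs => rw [ga_sum a, map_sum, map_sum]
  refine Finset.sum_congr rfl fun w _ => ?_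
  rw [map_smul, map_smul, coeff_cst, algebraMap_smul]

theorem ext_comp (F : MonoidAlgebra A G) : ext A φ (ext A ψ F) = ext A (φ ∘ₗ ψ) F := by
  rw [ext_eq ψ, map_sum, ext_eq (φ ∘ₗ ψ)]
  refine Finset.sum_congr rfl fun w _ => ?_
  rw [map_smul, ext_cst]; rfl

theorem cmap_smul_cst (ρ : A →ₗ[ℂ] B) (f : A) (a : MonoidAlgebra ℂ G) :
    cmap ρ (f • cst A a) = ρ f • cst B a := by
  apply ga_ext; intro w
  rw [coeff_cmap, MonoidAlgebra.coeff_smul, Finsupp.smul_apply, MonoidAlgebra.coeff_smul,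
    Finsupp.smul_apply, coeff_cst, coeff_cst, smul_eq_mul, smul_eq_mul, mul_comm,
    ← Algebra.smul_def, map_smul, Algebra.smul_def, mul_comm]

theorem ext_cmap (ρ : A →ₗ[ℂ] B) (F : MonoidAlgebra A G) :
    cmap ρ (ext A φ F) = ext B φ (cmap ρ F) := by
  rw [ext_eq, map_sum, ext_eq]
  refine Finset.sum_congr rfl fun w _ => ?_
  rw [cmap_smul_cst, coeff_cmap]

theorem ext_mulLeft {a : MonoidAlgebra ℂ G} (h : ∀ x, φ (a * x) = a * φ x) (F : MonoidAlgebra A G) :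
    ext A φ (cst A a * F) = cst A a * ext A φ F := by
  conv_lhs => rw [ga_sum F, Finset.mul_sum, map_sum]
  rw [ext_eq, Finset.mul_sum]
  refine Finset.sum_congr rfl fun w _ => ?_
  rw [mul_smul_comm, map_smul, mul_smul_comm, ← cst_el, ← cst_mul, ext_cst, h, cst_mul]

theorem XS_ext {T : Submodule ℂ A} {F : MonoidAlgebra A G} (hF : F ∈ XS T) : ext A φ F ∈ XS T := by
  rw [ext_eq]
  refine Submodule.sum_mem _ fun w _ => ?_
  intro u
  rw [MonoidAlgebra.coeff_smul, Finsupp.smul_apply, coeff_cst, smul_eq_mul, mul_comm,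
    ← Algebra.smul_def]
  exact T.smul_mem _ (hF w)

theorem ext_trace : LinearMap.trace A _ (ext A φ) = algebraMap ℂ A (LinearMap.trace ℂ _ φ) := by
  rw [tr_eq, tr_eq, map_sum]
  refine Finset.sum_congr rfl fun w _ => ?_
  rw [ext_el, coeff_cst]

theorem tr_mulLeft (a : MonoidAlgebra ℂ G) :
    LinearMap.trace ℂ _ (LinearMap.mulLeft ℂ a) = Fintype.card G * a.coeff 1 := by
  rw [tr_eq]
  have : ∀ w, (LinearMap.mulLeft ℂ a (el ℂ w)).coeff w = a.coeff 1 := by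
    intro w
    rw [LinearMap.mulLeft_apply, MonoidAlgebra.coeff_mul_single_apply, mul_inv_cancel, mul_one]
  simp [this]

end Ext

section FS3

open MvPolynomial

variable [FiniteDimensional ℂ V] {W : Subgroup (V →ₗ[ℂ] V)ˣ} [Fintype W]
variable {ι : Type*} [Fintype ι] {b : Module.Basis ι ℂ V}
variable {K : Type*} [Field K] [Algebra (MvPolynomial ι ℂ) K] [IsFractionRing (MvPolynomial ι ℂ) K]
  [Algebra ℂ K] [IsScalarTower ℂ (MvPolynomial ι ℂ) K]
variable {S : Finset (Ar W)} {v : V} {F G : MonoidAlgebra K W}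

/-- conjugate operator -/
def cj (F G : MonoidAlgebra K W) (φ : MonoidAlgebra ℂ W →ₗ[ℂ] MonoidAlgebra ℂ W) :
    MonoidAlgebra K W →ₗ[K] MonoidAlgebra K W :=
  LinearMap.mulLeft K F ∘ₗ ext K φ ∘ₗ LinearMap.mulLeft K G

theorem cj_apply (φ : MonoidAlgebra ℂ W →ₗ[ℂ] MonoidAlgebra ℂ W) (E : MonoidAlgebra K W) :
    cj F G φ E = F * ext K φ (G * E) := rfl

variable (P : FSol b K S v F G)
include P

theorem FSol.mul_left (E : MonoidAlgebra K W) : G * (F * E) = E := by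
  rw [← mul_assoc, P.left, one_mul]

theorem FSol.mul_right (E : MonoidAlgebra K W) : F * (G * E) = E := by
  rw [← mul_assoc, P.right, one_mul]

theorem FSol.cd_inv (y : V) (E : MonoidAlgebra K W) : G * nb b K S y E = cd b K y (G * E) := by
  have := P.nb_mul_left y (G * E)
  rw [P.mul_right] at this
  rw [this, P.mul_left]

theorem FSol.cj_nb (φ : MonoidAlgebra ℂ W →ₗ[ℂ] MonoidAlgebra ℂ W) (y : V) (E : MonoidAlgebra K W) :
    nb b K S y (cj F G φ E) = cj F G φ (nb b K S y E) := by
  rw [cj_apply, cj_apply, P.nb_mul_left, P.cd_inv, cd, ext_cmap]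

theorem FSol.cj_trace (φ ψ : MonoidAlgebra ℂ W →ₗ[ℂ] MonoidAlgebra ℂ W) :
    LinearMap.trace K _ (cj F G φ * cj F G ψ) = algebraMap ℂ K (LinearMap.trace ℂ _ (φ * ψ)) := by
  have h1 : cj F G φ * cj F G ψ = LinearMap.mulLeft K F * (ext K (φ * ψ) * LinearMap.mulLeft K G) := by
    refine LinearMap.ext fun E => ?_
    change cj F G φ (cj F G ψ E) = F * ext K (φ ∘ₗ ψ) (G * E)
    rw [cj_apply, cj_apply, P.mul_left, ext_comp]
  rw [h1, LinearMap.trace_mul_comm]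
  have h2 : ext K (φ * ψ) * LinearMap.mulLeft K G * LinearMap.mulLeft K F = ext K (φ * ψ) := by
    refine LinearMap.ext fun E => ?_
    change ext K (φ ∘ₗ ψ) (G * (F * E)) = _
    rw [P.mul_left]; rfl
  rw [h2, ext_trace]

variable (hS : ∀ (w : W) (H : Ar W), H ∈ S → mv w H ∈ S)
include hS

theorem FSol.st_inv (w : W) (E : MonoidAlgebra K W) :
    G * st b K w E = cst K (P.Th hS w) * ca b K w (G * E) := by
  conv_lhs => rw [← P.mul_right E, st_mul, P.Th_spec hS, mul_assoc, P.mul_left]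

theorem FSol.cj_st {φ : MonoidAlgebra ℂ W →ₗ[ℂ] MonoidAlgebra ℂ W} {w : W}
    (h : ∀ x, φ (P.Th hS w * x) = P.Th hS w * φ x) (E : MonoidAlgebra K W) :
    st b K w (cj F G φ E) = cj F G φ (st b K w E) := by
  rw [cj_apply, cj_apply, st_mul, P.Th_spec hS, P.st_inv hS, ext_mulLeft φ h, ca, ext_cmap, mul_assoc]

/-- commutation with the monodromy of a stabilizer generator gives regularity -/
theorem FSol.cj_fl {φ : MonoidAlgebra ℂ W →ₗ[ℂ] MonoidAlgebra ℂ W} {H : Ar W}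
    (h : H ∈ S → ∀ x, φ (P.Th hS (ls H) * x) = P.Th hS (ls H) * φ x) {k : ℕ} {E : MonoidAlgebra K W}
    (hE : E ∈ KZ.fl b K H k) : cj F G φ E ∈ KZ.fl b K H k := by
  have red : ∀ j, (∀ E ∈ KZ.fl b K H j, cj F G φ E ∈ KZ.fl b K H j) →
      ∀ k, ∀ E ∈ KZ.fl b K H k, cj F G φ E ∈ KZ.fl b K H k := by
    intro j hj k E hE
    obtain ⟨E', hE', rfl⟩ := (fl_iff b K H).1 hE
    rw [map_smul]
    have h1 := hj _ (by have := fl_pow b K H j hE'; rwa [add_zero] at this)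
    rw [map_smul] at h1
    have h2 := fl_cancel b K H (j := j) (k := 0) (by rwa [add_zero])
    have := fl_pow b K H k h2
    rwa [add_zero] at this
  by_cases hH : H ∈ S
  · refine red (eH H) ?_ k E hE
    have L := (ld H).locSys b K hH hS
    refine L.U2 (A := (cj F G φ).restrictScalars ℂ) ?_ ?_ ?_ ?_
    · intro E
      simp only [LinearMap.restrictScalars_apply, eu_apply, map_smul, P.cj_nb]
    · intro E
      exact P.cj_st hS (h hH) E
    · intro E hE
      change cj F G φ E ∈ _
      obtain ⟨E', hE', rfl⟩ := (fl_iff b K H).1 hE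
      rw [cj_apply, mul_smul_comm, ← smul_mul_assoc]
      exact fl_mul0 b K H (P.fl H) (XS_ext φ (fl_mul0 b K H (P.inv_fl hH) hE'))
    · intro E hE
      change cj F G φ E ∈ _
      obtain ⟨E', hE', rfl⟩ := (fl_iff b K H).1 hE
      rw [two_mul, pow_add, mul_smul, map_smul]
      rw [show orderOf (ls H) = orderOf (ls H) + 0 from rfl]
      apply fl_pow
      rw [cj_apply, mul_smul_comm, ← smul_mul_assoc]
      exact fl_mul0 b K H (P.fl H) (XS_ext φ (fl_mul0 b K H (P.inv_fl hH) hE'))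
  · refine red 0 ?_ k E hE
    intro E hE
    exact fl_mul0 b K H (P.fl H) (XS_ext φ (fl_mul0 b K H (P.inv_fl' hH) hE))

theorem FSol.cj_Rs {φ : MonoidAlgebra ℂ W →ₗ[ℂ] MonoidAlgebra ℂ W}
    (h : ∀ w x, φ (P.Th hS w * x) = P.Th hS w * φ x) {E : MonoidAlgebra K W}
    (hE : E ∈ XS (Rs ι K)) : cj F G φ E ∈ XS (Rs ι K) := by
  apply XS_Rs_of b K S
  · have h1 : F ∈ XS (Rd K (Dl b S)) := fun w => Rd_Rs (P.rs w)
    have h2 : E ∈ XS (Rd K (Dl b S)) := fun w => Rd_Rs (hE w)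
    exact XS_mul (fun _ h _ h' => Rd_mul h h') h1
      (XS_ext φ (XS_mul (fun _ h _ h' => Rd_mul h h') P.rd h2))
  · intro H hH
    exact P.cj_fl hS (fun _ => h (ls H)) (fun w => Ok_Rs _ (hE w))

theorem FSol.end_eq {φ : MonoidAlgebra ℂ W →ₗ[ℂ] MonoidAlgebra ℂ W}
    (h : ∀ w x, φ (P.Th hS w * x) = P.Th hS w * φ x) : ∃ r, ∀ x, φ x = x * r := by
  classical
  have one_Rs : ∀ w : W, el K w ∈ XS (Rs ι K) := fun w => by
    rw [← cst_el]; exact XS_cst (Rs_one K) _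
  -- value at the origin
  choose q hq using P.cj_Rs hS h (one_Rs 1)
  let r : MonoidAlgebra ℂ W := MonoidAlgebra.ofCoeff (Finsupp.equivFunOnFinite.symm
    (fun w => evp b 0 (q w)))
  have hr : ∀ w, r.coeff w = evp b 0 (q w) := fun w => rfl
  let φ' := φ - LinearMap.mulRight ℂ r
  have hφ'a : ∀ x, φ' x = φ x - x * r := fun x => rfl
  have hφ' : ∀ w x, φ' (P.Th hS w * x) = P.Th hS w * φ' x := by
    intro w x
    rw [hφ'a, hφ'a, h, mul_sub, mul_assoc]
  have hA : ∀ E, cj F G φ' E = cj F G φ E - E * cst K r := by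
    intro E
    have : ext K φ' (G * E) = ext K φ (G * E) - G * E * cst K r := by
      conv_rhs => rw [ga_sum (G * E)]
      conv_lhs => rw [ga_sum (G * E)]
      rw [map_sum, map_sum, Finset.sum_mul, ← Finset.sum_sub_distrib]
      refine Finset.sum_congr rfl fun w _ => ?_
      rw [map_smul, map_smul, smul_mul_assoc, ← smul_sub, ext_el, ext_el, hφ'a, map_sub, cst_mul, cst_el]
    rw [cj_apply, this, cj_apply, mul_sub, mul_assoc G, P.mul_right]
  have hM : ∀ w, cj F G φ' (el K w) ∈ XS (Mv b K 0) := by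
    intro w
    have e1 : el K w = st b K w (el K 1) := by
      rw [st_apply, ca_el, ← el_mul, mul_one]
    have e2 : cj F G φ' (el K w) = st b K w (cj F G φ' (el K 1)) := by
      conv_lhs => rw [e1]
      rw [P.cj_st hS (hφ' w)]
    rw [e2, st_apply]
    apply XS_el_mul
    have h3 : cj F G φ' (el K 1) ∈ XS (Mv b K 0) := by
      intro u
      have e3 : (cj F G φ' (el K 1)).coeff u = al K (q u - C (evp b 0 (q u))) := by
        have : (el K (1 : W)) * cst K r = cst K r := by
          rw [show el K (1 : W) = 1 from rfl, one_mul]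
        rw [hA, this, MonoidAlgebra.coeff_sub, Finsupp.sub_apply, coeff_cst, hr, map_sub, al_C, ← hq u]
        rfl
      rw [e3]
      apply Mv_al
      rw [map_sub]
      simp [evp]
    refine XS_cmap (fun f hf => ?_) h3
    obtain ⟨p, hp, rfl⟩ := hf
    have hp : evp b 0 p = 0 := hp
    change act b K w (al K p) ∈ _
    rw [act_al]
    apply Mv_al
    rw [evp_sbs, map_zero, hp]
  have hM' : ∀ E ∈ XS (Rs ι K), cj F G φ' E ∈ XS (Mv b K 0) := by
    intro E hE
    rw [ga_sum E, map_sum]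
    refine Submodule.sum_mem _ fun w _ => ?_
    rw [map_smul]
    refine XS_smul (fun f hf => ?_) (hM w)
    rw [mul_comm]
    exact Mv_mul b K 0 hf (hE w)
  have htr : ∀ ψ : MonoidAlgebra ℂ W →ₗ[ℂ] MonoidAlgebra ℂ W,
      (∀ w x, ψ (P.Th hS w * x) = P.Th hS w * ψ x) → LinearMap.trace ℂ _ (φ' * ψ) = 0 := by
    intro ψ hψ
    have h4 := P.cj_trace φ' ψ
    have h5 : LinearMap.trace K _ (cj F G φ' * cj F G ψ) ∈ Mv b K 0 := by
      rw [tr_eq]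
      refine Submodule.sum_mem _ fun w _ => ?_
      exact hM' _ (P.cj_Rs hS hψ (one_Rs w)) w
    rw [h4, ← al_C (ι := ι)] at h5
    have := Mv_al_iff b K 0 h5
    simpa [evp] using this
  have hall : ∀ f : MonoidAlgebra ℂ W →ₗ[ℂ] MonoidAlgebra ℂ W, LinearMap.trace ℂ _ (φ' * f) = 0 := by
    intro f
    let fb : MonoidAlgebra ℂ W →ₗ[ℂ] MonoidAlgebra ℂ W := ∑ w : W,
      LinearMap.mulLeft ℂ (P.Th hS w⁻¹) * (f * LinearMap.mulLeft ℂ (P.Th hS w))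
    have hfb : ∀ x, fb x = ∑ w : W, P.Th hS w⁻¹ * f (P.Th hS w * x) := by
      intro x
      simp [fb, LinearMap.sum_apply]
    have h6 := htr fb (by
      intro w x
      rw [hfb, hfb, Finset.mul_sum]
      refine Fintype.sum_equiv (Equiv.mulRight w) _ _ fun u => ?_
      rw [Equiv.coe_mulRight, ← mul_assoc (P.Th hS w), ← P.Th_mul, mul_inv_rev, mul_inv_cancel_left,
        P.Th_mul, mul_assoc])
    have h7 : LinearMap.trace ℂ _ (φ' * fb) = ∑ w : W, LinearMap.trace ℂ _ (φ' * f) := by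
      simp only [fb]
      rw [Finset.mul_sum, map_sum]
      refine Finset.sum_congr rfl fun w _ => ?_
      have : φ' * (LinearMap.mulLeft ℂ (P.Th hS w⁻¹) * (f * LinearMap.mulLeft ℂ (P.Th hS w))) =
          LinearMap.mulLeft ℂ (P.Th hS w⁻¹) * (φ' * f * LinearMap.mulLeft ℂ (P.Th hS w)) := by
        refine LinearMap.ext fun x => ?_
        exact hφ' w⁻¹ _
      rw [this, LinearMap.trace_mul_comm]
      congr 1
      refine LinearMap.ext fun x => ?_
      change φ' (f (P.Th hS w * (P.Th hS w⁻¹ * x))) = φ' (f x)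
      rw [← mul_assoc, ← P.Th_mul, mul_inv_cancel, P.Th_one, one_mul]
    rw [h6, Finset.sum_const, Finset.card_univ, nsmul_eq_mul] at h7
    have : (Fintype.card W : ℂ) ≠ 0 := by exact_mod_cast Fintype.card_ne_zero
    rcases mul_eq_zero.1 h7.symm with h | h
    · exact absurd h this
    · exact h
  have hfin : Module.Finite ℂ (MonoidAlgebra ℂ W) := Module.Finite.of_basis (bs ℂ)
  have hfree : Module.Free ℂ (MonoidAlgebra ℂ W) := Module.Free.of_basis (bs ℂ)
  refine ⟨r, fun x => ?_⟩
  rw [← sub_eq_zero, ← hφ'a]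
  refine (Module.forall_dual_apply_eq_zero_iff ℂ _).1 fun lam => ?_
  have h8 := hall (lam.smulRight x)
  rw [LinearMap.trace_mul_comm] at h8
  have h9 : lam.smulRight x * φ' = (lam ∘ₗ φ').smulRight x := by
    refine LinearMap.ext fun y => ?_; rfl
  rw [h9, LinearMap.trace_smulRight] at h8
  exact h8

theorem FSol.th_surj : Function.Surjective (P.th hS) := by
  classical
  have hfin : Module.Finite ℂ (MonoidAlgebra ℂ W) := Module.Finite.of_basis (bs ℂ)
  have hfree : Module.Free ℂ (MonoidAlgebra ℂ W) := Module.Free.of_basis (bs ℂ)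
  have : LinearMap.range (P.th hS).toLinearMap = ⊤ := by
    by_contra hne
    obtain ⟨lam, hlam, hle⟩ := Submodule.exists_le_ker_of_lt_top _ (lt_top_iff_ne_top.2 hne)
    apply hlam
    refine LinearMap.ext fun x => ?_
    have hz : ∀ w, lam (P.Th hS w) = 0 := fun w => by
      rw [← P.th_el]; exact hle ⟨_, rfl⟩
    let f : MonoidAlgebra ℂ W →ₗ[ℂ] MonoidAlgebra ℂ W := lam.smulRight x
    let fb : MonoidAlgebra ℂ W →ₗ[ℂ] MonoidAlgebra ℂ W := ∑ w : W,
      LinearMap.mulLeft ℂ (P.Th hS w⁻¹) * (f * LinearMap.mulLeft ℂ (P.Th hS w))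
    have hfb : ∀ x, fb x = ∑ w : W, P.Th hS w⁻¹ * f (P.Th hS w * x) := by
      intro x
      simp [fb, LinearMap.sum_apply]
    obtain ⟨r, hr⟩ := P.end_eq hS (φ := fb) (by
      intro w x
      rw [hfb, hfb, Finset.mul_sum]
      refine Fintype.sum_equiv (Equiv.mulRight w) _ _ fun u => ?_
      rw [Equiv.coe_mulRight, ← mul_assoc (P.Th hS w), ← P.Th_mul, mul_inv_rev, mul_inv_cancel_left,
        P.Th_mul, mul_assoc])
    have h1 : fb 1 = 0 := by
      rw [hfb]
      refine Finset.sum_eq_zero fun w _ => ?_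
      rw [mul_one, LinearMap.smulRight_apply, hz, zero_smul, mul_zero]
    have h2 : r = 0 := by rw [hr, one_mul] at h1; exact h1
    have h3 : fb = 0 := by refine LinearMap.ext fun y => (by rw [hr, h2, mul_zero]; rfl)
    have h7 : LinearMap.trace ℂ _ fb = ∑ w : W, lam x := by
      simp only [fb]
      rw [map_sum]
      refine Finset.sum_congr rfl fun w _ => ?_
      rw [LinearMap.trace_mul_comm, ← LinearMap.trace_smulRight lam x]
      congr 1
      refine LinearMap.ext fun y => ?_
      change f (P.Th hS w * (P.Th hS w⁻¹ * y)) = f y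
      rw [← mul_assoc, ← P.Th_mul, mul_inv_cancel, P.Th_one, one_mul]
    rw [h3, map_zero, Finset.sum_const, Finset.card_univ, nsmul_eq_mul] at h7
    have : (Fintype.card W : ℂ) ≠ 0 := by exact_mod_cast Fintype.card_ne_zero
    rcases mul_eq_zero.1 h7.symm with h | h
    · exact absurd h this
    · exact h
  exact LinearMap.range_eq_top.1 this

theorem FSol.th_tau (a : MonoidAlgebra ℂ W) : (P.th hS a).coeff 1 = a.coeff 1 := by
  have hfin : Module.Finite ℂ (MonoidAlgebra ℂ W) := Module.Finite.of_basis (bs ℂ)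
  have hsurj : Function.Surjective (P.th hS).toLinearMap := P.th_surj hS
  have hinj := LinearMap.injective_iff_surjective.2 hsurj
  let e := LinearEquiv.ofBijective (P.th hS).toLinearMap ⟨hinj, hsurj⟩
  have he : ∀ x, e x = P.th hS x := fun x => rfl
  have h1 : e.conj (LinearMap.mulLeft ℂ a) = LinearMap.mulLeft ℂ (P.th hS a) := by
    refine LinearMap.ext fun x => ?_
    rw [LinearEquiv.conj_apply_apply, LinearMap.mulLeft_apply, he, map_mul, ← he (e.symm x),
      LinearEquiv.apply_symm_apply, LinearMap.mulLeft_apply]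
  have h2 := LinearMap.trace_conj' (LinearMap.mulLeft ℂ a) e
  rw [h1, tr_mulLeft, tr_mulLeft] at h2
  exact mul_left_cancel₀ (by exact_mod_cast Fintype.card_ne_zero) h2

end FS3

end KZ

namespace KZ

section Loc

open MvPolynomial

variable [FiniteDimensional ℂ V] {W : Subgroup (V →ₗ[ℂ] V)ˣ} [Fintype W]
variable {ι : Type*} [Fintype ι] {b : Module.Basis ι ℂ V}
variable {K : Type*} [Field K] [Algebra (MvPolynomial ι ℂ) K] [IsFractionRing (MvPolynomial ι ℂ) K]
  [Algebra ℂ K] [IsScalarTower ℂ (MvPolynomial ι ℂ) K]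
variable {S : Finset (Ar W)} {v : V} {F G : MonoidAlgebra K W}

theorem nb_empty (y : V) (E : MonoidAlgebra K W) : nb b K ∅ y E = cd b K y E := by
  simp [nb_apply, om]

theorem cd_euler {H : Ar W} {y : V} (hy : frm H y = 1) {k : ℕ} {E : MonoidAlgebra K W}
    (hE : E ∈ fl b K H k) :
    eu b K ∅ (al K (pl b H)) y E - (k : ℂ) • E ∈ fl b K H (k + 1) := fun w => by
  have := Ok_euler b (pl_prime b H) hy (hE w)
  rw [eu_apply, nb_empty, MonoidAlgebra.coeff_sub, Finsupp.sub_apply, MonoidAlgebra.coeff_smul,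
    MonoidAlgebra.coeff_smul, Finsupp.smul_apply, Finsupp.smul_apply, cd, coeff_cmap]
  exact this

theorem cd_eu_fl {H : Ar W} {y : V} (hy : frm H y = 1) {k : ℕ} {E : MonoidAlgebra K W}
    (hE : E ∈ fl b K H k) :
    eu b K ∅ (al K (pl b H)) y E ∈ fl b K H k := by
  have h1 := fl_anti b K H (Nat.le_succ k) (cd_euler hy hE)
  have h2 := Submodule.add_mem _ h1 (Submodule.smul_mem _ (k : ℂ) hE)
  rwa [sub_add_cancel] at h2

theorem raise {H : Ar W} {y : V} (hy : frm H y = 1) {j m n : ℕ} {c : ℕ} {E : MonoidAlgebra K W}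
    (hE : E ∈ fl b K H j) (hjm : j ≤ m) (hmn : m ≤ n)
    (hN : eu b K ∅ (al K (pl b H)) y E - (c : ℂ) • E ∈ fl b K H n)
    (hc : ∀ k, j ≤ k → k < m → k ≠ c) : E ∈ fl b K H m := by
  induction m with
  | zero => obtain rfl : j = 0 := by omega
            exact hE
  | succ m ih =>
    rcases Nat.eq_or_lt_of_le hjm with h | h
    · rwa [← h]
    have h1 : E ∈ fl b K H m := ih (by omega) (by omega) fun k hk hk' => hc k hk (by omega)
    have h2 := cd_euler hy h1
    have h3 := fl_anti b K H hmn hN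
    have h4 := Submodule.sub_mem _ h2 h3
    have h5 : ((c : ℂ) - m) ≠ 0 := by
      rw [sub_ne_zero]
      exact_mod_cast (hc m (by omega) (by omega)).symm
    have h6 : E = ((c : ℂ) - m)⁻¹ • (eu b K ∅ (al K (pl b H)) y E - (m : ℂ) • E -
        (eu b K ∅ (al K (pl b H)) y E - (c : ℂ) • E)) := by
      rw [eq_inv_smul_iff₀ h5, sub_smul]; abel
    rw [h6]
    exact Submodule.smul_mem _ _ h4

variable (P : FSol b K S v F G)
variable (hS : ∀ (w : W) (H : Ar W), H ∈ S → mv w H ∈ S)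

theorem LDat.ca_mem {H : Ar W} {s : W} {ξ : ℂ} {y : V} (L : LDat H s ξ y) {k : ℕ}
    {E : MonoidAlgebra K W} (hE : E ∈ fl b K H k) : ca b K s E ∈ fl b K H k := by
  have h1 := fl_anti b K H (Nat.le_succ k) (L.ca_fl b K hE)
  have h2 := Submodule.add_mem _ h1 (Submodule.smul_mem _ ((ξ⁻¹) ^ k) hE)
  rwa [sub_add_cancel] at h2

theorem LDat.ca_eu {H : Ar W} {s : W} {ξ : ℂ} {y : V} (L : LDat H s ξ y) (E : MonoidAlgebra K W) :
    eu b K ∅ (al K (pl b H)) y (ca b K s E) = ca b K s (eu b K ∅ (al K (pl b H)) y E) := by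
  have h0 : ξ ≠ 0 := L.prim.ne_zero (orderOf_pos s).ne'
  have h1 : cd b K (ξ • y) (ca b K s E) = ξ • cd b K y (ca b K s E) := by
    rw [← nb_empty, ← nb_empty, nb_csmul]
  rw [eu_apply, eu_apply, nb_empty, nb_empty, ca_smul, ca_cd, L.act_pl b K, L.ey, h1, mul_smul,
    smul_comm _ ξ, algebraMap_smul, smul_smul, inv_mul_cancel₀ h0, one_smul]

/-- conjugated monodromy -/
def FSol.Bw (w : W) : MonoidAlgebra K W := F * cst K (P.Th hS w) * G

theorem FSol.Bw_one : P.Bw hS 1 = 1 := by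
  rw [FSol.Bw, P.Th_one, cst_one, mul_one, P.right]

theorem FSol.Bw_mul (w w' : W) : P.Bw hS (w * w') = P.Bw hS w * P.Bw hS w' := by
  rw [FSol.Bw, FSol.Bw, FSol.Bw, P.Th_mul, cst_mul]
  simp only [mul_assoc, P.mul_left]

/-- key identity -/
theorem FSol.Z_eq (s : W) (E : MonoidAlgebra K W) :
    F * ca b K s (G * E) = P.Bw hS s⁻¹ * st b K s E := by
  rw [FSol.Bw, mul_assoc _ G, P.st_inv hS, ← mul_assoc, mul_assoc F, ← cst_mul, ← P.Th_mul,
    inv_mul_cancel, P.Th_one, cst_one, mul_one]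

theorem FSol.loc_gen (H : Ar W) : P.Bw hS (ls H)⁻¹ - el K (ls H)⁻¹ ∈ KZ.fl b K H 1 := by
  set s := ls H with hs
  have L : LDat H s (lx H) (ly H) := ld H
  suffices h : F * ca b K s G - 1 ∈ KZ.fl b K H 1 by
    have h1 := P.Z_eq hS s 1
    rw [mul_one] at h1
    have h2 : st b K s (1 : MonoidAlgebra K W) = el K s := by
      rw [st_apply, ← cst_one, ca_cst, cst_one, mul_one]
    rw [h1, h2] at h
    have h3 := XS_mul_cst (el ℂ s⁻¹) h
    rw [cst_el, sub_mul, mul_assoc, ← el_mul, mul_inv_cancel, one_mul] at h3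
    rwa [show el K (1 : W) = 1 from rfl, mul_one] at h3
  by_cases hH : H ∈ S
  swap
  · have h1 := L.ca_fl b K (P.inv_fl' hH)
    rw [pow_zero, one_smul] at h1
    have h2 := fl_mul0 b K H (P.fl H) h1
    rwa [mul_sub, P.right] at h2
  have LS := L.locSys b K hH hS
  set e := orderOf s with he
  set α := al K (pl b H) with hα
  -- the operator Z
  let Z : MonoidAlgebra K W →ₗ[ℂ] MonoidAlgebra K W :=
    LinearMap.mulLeft ℂ F ∘ₗ ca b K s ∘ₗ LinearMap.mulLeft ℂ G
  have hZ : ∀ E, Z E = F * ca b K s (G * E) := fun E => rfl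
  have hZ2 : ∀ k, ∀ E ∈ KZ.fl b K H k, Z E ∈ KZ.fl b K H k := by
    intro k E hE
    have h1 : st b K s E ∈ KZ.fl b K H k := LS.sfil k E hE
    have h2 := P.cj_fl hS (φ := LinearMap.mulLeft ℂ (P.Th hS s⁻¹)) (H := H) (by
      intro _ x
      simp only [LinearMap.mulLeft_apply, ← mul_assoc, ← P.Th_mul]
      rw [← hs]; simp) h1
    have h3 : cj F G (LinearMap.mulLeft ℂ (P.Th hS s⁻¹)) (st b K s E) = Z E := by
      have h4 : ∀ X : MonoidAlgebra K W,
          ext K (LinearMap.mulLeft ℂ (P.Th hS s⁻¹)) X = cst K (P.Th hS s⁻¹) * X := by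
        intro X
        rw [ext_eq]
        conv_rhs => rw [ga_sum X, Finset.mul_sum]
        refine Finset.sum_congr rfl fun w _ => ?_
        rw [LinearMap.mulLeft_apply, cst_mul, cst_el, mul_smul_comm]
      rw [hZ, P.Z_eq hS, cj_apply, h4, FSol.Bw]
      simp only [mul_assoc]
    rwa [h3] at h2
  have hU := LS.U3 (Y := Z - LinearMap.id) (by
    intro E hE
    exact Submodule.sub_mem _ (hZ2 _ _ hE) hE) (by
    intro n' hn' E hE
    set p := ∏ l ∈ (Finset.range (e + 1)).erase n', (Polynomial.X - Polynomial.C (l : ℂ)) with hp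
    set g := Polynomial.aeval (eu b K ∅ α (ly H)) p (G * E) with hg
    have hintw : ∀ (p : Polynomial ℂ) (E : MonoidAlgebra K W),
        G * Polynomial.aeval (eu b K S α (ly H)) p E =
          Polynomial.aeval (eu b K ∅ α (ly H)) p (G * E) := by
      intro p
      have hone : ∀ E, G * eu b K S α (ly H) E = eu b K ∅ α (ly H) (G * E) := by
        intro E
        rw [eu_apply, eu_apply, nb_empty, mul_smul_comm, P.cd_inv]
      induction p using Polynomial.induction_on' with
      | add p q hp hq =>
        intro E
        rw [map_add, map_add, LinearMap.add_apply, LinearMap.add_apply, mul_add, hp, hq]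
      | monomial n a =>
        intro E
        simp only [Polynomial.aeval_monomial, Module.End.mul_apply, Module.algebraMap_end_apply]
        rw [mul_smul_comm]
        congr 1
        induction n generalizing E with
        | zero => simp
        | succ n ih => rw [pow_succ, pow_succ, Module.End.mul_apply, Module.End.mul_apply, ih, hone]
    have hval : Polynomial.aeval (eu b K S α (ly H)) p E = F * g := by
      rw [hg, ← hintw, P.mul_right]
    have hGE : G * E ∈ KZ.fl b K H 0 := by
      obtain ⟨E', hE', rfl⟩ := (fl_iff b K H).1 hE
      rw [mul_smul_comm, ← smul_mul_assoc]
      exact fl_mul0 b K H (P.inv_fl hH) hE'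
    have hg0 : g ∈ KZ.fl b K H 0 :=
      aeval_mem (fun X hX => cd_eu_fl L.fy hX) p _ hGE
    have hn'' : n' ∈ Finset.range (e + 1) := by
      rcases hn' with rfl | rfl <;> simp
    have hgN : eu b K ∅ α (ly H) g - (n' : ℂ) • g ∈ KZ.fl b K H (e + 1) := by
      have h1 := eu_prod b K ∅ L.fy (e + 1) (G * E)
      rw [← Finset.mul_prod_erase _ _ hn'', map_mul (Polynomial.aeval _), Module.End.mul_apply] at h1
      have h2 : eu b K ∅ α (ly H) g - (n' : ℂ) • g =
          Polynomial.aeval (eu b K ∅ α (ly H)) (Polynomial.X - Polynomial.C (n' : ℂ)) g := by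
        rw [map_sub, Polynomial.aeval_X, Polynomial.aeval_C, LinearMap.sub_apply, Module.algebraMap_end_apply]
      rw [h2, hg, hp, h1]
      have h3 : (nb b K ∅ (ly H) ^ (e + 1)) (G * E) ∈ KZ.fl b K H 0 := by
        have : ∀ m, (nb b K ∅ (ly H) ^ m) (G * E) ∈ KZ.fl b K H 0 := by
          intro m
          induction m with
          | zero => simpa using hGE
          | succ m ih =>
            rw [pow_succ', Module.End.mul_apply, nb_empty]
            exact XS_cmap (fun f hf => Ok_dK0 b _ _ hf) ih
        exact this _
      have := fl_pow b K H (e + 1) h3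
      rwa [add_zero] at this
    have hgn : g ∈ KZ.fl b K H n' := by
      refine raise L.fy hg0 (Nat.zero_le _) (n := e + 1) ?_ hgN (by intros; omega)
      rcases hn' with rfl | rfl <;> omega
    rw [hval, LinearMap.sub_apply, LinearMap.id_apply, hZ, P.mul_left, ← mul_sub]
    apply fl_mul0 b K H (P.fl H)
    have hca := L.ca_fl b K hgn
    rcases hn' with rfl | rfl
    · rw [pow_zero, one_smul, zero_add] at hca
      refine raise L.fy hca (by omega) (le_refl (e + 1)) (c := 0) ?_ (by intros; omega)
      rw [Nat.cast_zero, zero_smul, sub_zero] at hgN ⊢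
      rw [map_sub, L.ca_eu]
      exact Submodule.sub_mem _ (L.ca_mem hgN) hgN
    · rwa [L.prim.inv.pow_eq_one, one_smul] at hca)
  have h1 : α ^ e • (1 : MonoidAlgebra K W) ∈ KZ.fl b K H e := by
    have h2 : (1 : MonoidAlgebra K W) ∈ KZ.fl b K H 0 := by
      rw [← cst_one]; exact XS_cst (Ok_one _) 1
    have := fl_pow b K H e h2
    rwa [add_zero] at this
  have h2 := hU _ h1
  apply fl_cancel b K H (j := e)
  have h3 : act b K s (α ^ e) = α ^ e := by
    rw [map_pow, L.act_pl b K, mul_pow, ← map_pow, L.prim.inv.pow_eq_one, map_one, one_mul]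
  rw [LinearMap.sub_apply, LinearMap.id_apply, hZ, mul_smul_comm, ca_smul, h3, mul_one, mul_smul_comm,
    ← smul_sub] at h2
  exact h2

theorem FSol.loc_stb {H : Ar W} {s : W} (hs : s ∈ stb H) : P.Bw hS s - el K s ∈ KZ.fl b K H 1 := by
  classical
  have h1 : ∃ n : ℕ, ((ls H)⁻¹) ^ n = s := by
    rw [(ld H).zp, ← Subgroup.zpowers_inv] at hs
    exact (isOfFinOrder_of_finite _).mem_zpowers_iff_mem_range_orderOf.1 hs |> fun h => by
      obtain ⟨n, _, hn⟩ := Finset.mem_image.1 h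
      exact ⟨n, hn⟩
  obtain ⟨n, rfl⟩ := h1
  have hel : ∀ w : W, el K w ∈ KZ.fl b K H 0 := fun w => by
    rw [← cst_el]; exact XS_cst (Ok_one _) _
  induction n with
  | zero => rw [pow_zero, P.Bw_one, show el K (1 : W) = 1 from rfl, sub_self]; exact Submodule.zero_mem _
  | succ n ih =>
    have h2 := P.loc_gen hS H
    have h0 := Subgroup.pow_mem (stb H) (Subgroup.inv_mem _ (ld H).ms) n
    have h3 := ih h0
    set t := (ls H)⁻¹
    have h4 : P.Bw hS t ∈ KZ.fl b K H 0 := by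
      have := Submodule.add_mem _ (fl_anti b K H zero_le_one h2) (hel t)
      rwa [sub_add_cancel] at this
    have h5 : P.Bw hS (t ^ (n + 1)) - el K (t ^ (n + 1)) =
        (P.Bw hS (t ^ n) - el K (t ^ n)) * P.Bw hS t + el K (t ^ n) * (P.Bw hS t - el K t) := by
      rw [pow_succ, P.Bw_mul, el_mul]; noncomm_ring
    rw [h5]
    refine Submodule.add_mem _ ?_ (fl_mul0 b K H (hel _) h2)
    have h6 := fl_mul b K H h3 h4
    rwa [add_zero] at h6

/-- trace symmetric -/
theorem tau_comm {A : Type*} [CommRing A] [Algebra ℂ A] {Γ : Type*} [Group Γ] [Fintype Γ] (a c : MonoidAlgebra A Γ) :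
    (a * c).coeff 1 = (c * a).coeff 1 := by
  rw [coeff_mul', coeff_mul']
  refine Fintype.sum_equiv (Equiv.inv Γ) _ _ fun u => ?_
  simp [mul_comm]

theorem FSol.tau_Th {H : Ar W} {s : W} (hs : s ∈ stb H) {a : MonoidAlgebra ℂ W}
    (ha : ∀ x, a * x = x * a) : (P.Th hS s * a).coeff 1 = (el ℂ s * a).coeff 1 := by
  have h1 := P.loc_stb hS hs
  have h2 := XS_mul_cst a h1 1
  have hac : ∀ X : MonoidAlgebra K W, cst K a * X = X * cst K a := by
    intro X
    rw [ga_sum X, Finset.mul_sum, Finset.sum_mul]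
    refine Finset.sum_congr rfl fun w _ => ?_
    rw [mul_smul_comm, smul_mul_assoc, ← cst_el, ← cst_mul, ← cst_mul, ha]
  have h3 : (P.Bw hS s * cst K a).coeff 1 = algebraMap ℂ K ((P.Th hS s * a).coeff 1) := by
    rw [FSol.Bw, mul_assoc _ G, ← hac G, mul_assoc, ← mul_assoc _ _ G, tau_comm, mul_assoc, P.left, mul_one,
      ← cst_mul, coeff_cst]
  rw [sub_mul, MonoidAlgebra.coeff_sub, Finsupp.sub_apply, h3, ← cst_el, ← cst_mul, coeff_cst, ← map_sub] at h2
  exact sub_eq_zero.1 (Ok_const _ h2)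

/-- central reflection sums are fixed by the monodromy homomorphism -/
theorem FSol.th_central (T : Finset W) (hT : ∀ t ∈ T, ∃ H : Ar W, t ∈ stb H)
    (hconj : ∀ w, ∀ t ∈ T, w * t * w⁻¹ ∈ T) :
    P.th hS (∑ t ∈ T, el ℂ t) = ∑ t ∈ T, el ℂ t := by
  classical
  have hcent : ∀ z : MonoidAlgebra ℂ W, (∀ w, el ℂ w * z = z * el ℂ w) → ∀ x, z * x = x * z := by
    intro z hz x
    rw [ga_sum x, Finset.mul_sum, Finset.sum_mul]
    refine Finset.sum_congr rfl fun w _ => ?_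
    rw [mul_smul_comm, smul_mul_assoc, hz]
  have hzc : ∀ x, (∑ t ∈ T, el ℂ t) * x = x * ∑ t ∈ T, el ℂ t := by
    apply hcent
    intro w
    rw [Finset.mul_sum, Finset.sum_mul]
    refine Finset.sum_bij (fun t _ => w * t * w⁻¹) (fun t ht => hconj w t ht) ?_ ?_ ?_
    · intro t _ t' _ h; simpa using h
    · intro t ht
      refine ⟨w⁻¹ * t * w, ?_, by group⟩
      have := hconj w⁻¹ t ht
      rwa [inv_inv] at this
    · intro t _
      rw [← el_mul, ← el_mul]; group
  set z := ∑ t ∈ T, el ℂ t with hz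
  have hthc : ∀ x, P.th hS z * x = x * P.th hS z := by
    intro x
    obtain ⟨y, rfl⟩ := P.th_surj hS x
    rw [← map_mul, ← map_mul, hzc]
  -- pairing with central elements
  have hpair : ∀ a : MonoidAlgebra ℂ W, (∀ x, a * x = x * a) →
      (P.th hS z * a).coeff 1 = (z * a).coeff 1 := by
    intro a ha
    rw [hz, map_sum, Finset.sum_mul, Finset.sum_mul, MonoidAlgebra.coeff_sum, MonoidAlgebra.coeff_sum,
      Finsupp.finset_sum_apply, Finsupp.finset_sum_apply]
    refine Finset.sum_congr rfl fun t ht => ?_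
    obtain ⟨H, hH⟩ := hT t ht
    rw [P.th_el, P.tau_Th hS hH ha]
  -- class sums
  apply ga_ext
  intro u
  let a : MonoidAlgebra ℂ W := ∑ h : W, el ℂ (h * u⁻¹ * h⁻¹)
  have ha : ∀ x, a * x = x * a := by
    apply hcent
    intro w
    simp only [a]
    rw [Finset.mul_sum, Finset.sum_mul]
    refine Fintype.sum_equiv (Equiv.mulLeft w) _ _ fun h => ?_
    rw [← el_mul, ← el_mul, Equiv.coe_mulLeft]; group
  have hcoef : ∀ x : MonoidAlgebra ℂ W, (∀ y, x * y = y * x) →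
      (x * a).coeff 1 = Fintype.card W * x.coeff u := by
    intro x hx
    simp only [a]
    rw [Finset.mul_sum, MonoidAlgebra.coeff_sum, Finsupp.finset_sum_apply]
    have : ∀ h : W, (x * el ℂ (h * u⁻¹ * h⁻¹)).coeff 1 = x.coeff u := by
      intro h
      have h1 : x * el ℂ (h * u⁻¹ * h⁻¹) = el ℂ h * (x * el ℂ u⁻¹) * el ℂ h⁻¹ := by
        rw [el_mul, el_mul, ← mul_assoc, ← mul_assoc, hx (el ℂ h), mul_assoc (el ℂ h)]
      rw [h1, tau_comm, ← mul_assoc, ← el_mul, inv_mul_cancel, show el ℂ (1 : W) = 1 from rfl, one_mul,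
        MonoidAlgebra.coeff_mul_single_apply, mul_one, one_mul, inv_inv]
    simp [this]
  have h9 := hpair a ha
  rw [hcoef _ hthc, hcoef _ hzc] at h9
  exact mul_left_cancel₀ (by exact_mod_cast Fintype.card_ne_zero) h9

end Loc

end KZ

namespace KZ

section Comb

open scoped ComplexOrder

variable {Γ : Type*} [Group Γ] [Fintype Γ]

/-- sum of the elements of a finset in the group algebra -/
def zz (T : Finset Γ) : MonoidAlgebra ℂ Γ := ∑ t ∈ T, el ℂ t

theorem coeff_zz_mul (T : Finset Γ) (x : MonoidAlgebra ℂ Γ) (w : Γ) :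
    (zz T * x).coeff w = ∑ t ∈ T, x.coeff (t⁻¹ * w) := by
  rw [zz, Finset.sum_mul, MonoidAlgebra.coeff_sum, Finsupp.finset_sum_apply]
  refine Finset.sum_congr rfl fun t _ => ?_
  rw [MonoidAlgebra.coeff_single_mul_apply, one_mul]

theorem zz_pow_fwd (T : Finset Γ) (m : ℕ) (x : MonoidAlgebra ℂ Γ) (w : Γ)
    (h : (zz T ^ m * x).coeff w ≠ 0) :
    ∃ l : List Γ, l.length = m ∧ (∀ t ∈ l, t ∈ T) ∧ x.coeff (l.prod⁻¹ * w) ≠ 0 := by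
  induction m generalizing w with
  | zero => exact ⟨[], rfl, by simp, by simpa using h⟩
  | succ m ih =>
    rw [pow_succ', mul_assoc, coeff_zz_mul] at h
    obtain ⟨t, ht, hne⟩ := Finset.exists_ne_zero_of_sum_ne_zero h
    obtain ⟨l, h1, h2, h3⟩ := ih _ hne
    refine ⟨t :: l, by simp [h1], ?_, ?_⟩
    · intro u hu
      rcases List.mem_cons.1 hu with rfl | hu
      · exact ht
      · exact h2 u hu
    · rw [List.prod_cons, mul_inv_rev, mul_assoc]; exact h3

theorem zz_cent (T : Finset Γ) (hconj : ∀ w, ∀ t ∈ T, w * t * w⁻¹ ∈ T) (x : MonoidAlgebra ℂ Γ) :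
    zz T * x = x * zz T := by
  rw [ga_sum x, Finset.mul_sum, Finset.sum_mul]
  refine Finset.sum_congr rfl fun w _ => ?_
  rw [mul_smul_comm, smul_mul_assoc]
  congr 1
  rw [zz, Finset.mul_sum, Finset.sum_mul]
  symm
  refine Finset.sum_bij (fun t _ => w * t * w⁻¹) (fun t ht => hconj w t ht) ?_ ?_ ?_
  · intro t _ t' _ h; simpa using h
  · intro t ht
    refine ⟨w⁻¹ * t * w, ?_, by group⟩
    have := hconj w⁻¹ t ht
    rwa [inv_inv] at this
  · intro t _
    simp only [el, MonoidAlgebra.single_mul_single, mul_one]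
    congr 1; group

theorem zz_nonneg (T : Finset Γ) {x : MonoidAlgebra ℂ Γ} (hx : ∀ w, 0 ≤ x.coeff w) (w : Γ) :
    0 ≤ (zz T * x).coeff w := by
  rw [coeff_zz_mul]
  exact Finset.sum_nonneg fun t _ => hx _

theorem zz_pos (T : Finset Γ) {x : MonoidAlgebra ℂ Γ} (hx : ∀ w, 0 ≤ x.coeff w) {w t : Γ} (ht : t ∈ T)
    (h : 0 < x.coeff w) : 0 < (zz T * x).coeff (t * w) := by
  rw [coeff_zz_mul]
  refine Finset.sum_pos' (fun t _ => hx _) ⟨t, ht, ?_⟩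
  rwa [inv_mul_cancel_left]

open Classical in
theorem zz_list (T T' : Finset Γ) (hc : ∀ x, zz T * x = x * zz T) (l : List Γ)
    (hl : ∀ t ∈ l, t ∈ T ∨ t ∈ T') (hd : ∀ t ∈ T, t ∉ T') :
    (∀ w, 0 ≤ (zz T ^ (l.countP (· ∈ T)) * zz T' ^ (l.countP (· ∈ T'))).coeff w) ∧
    0 < (zz T ^ (l.countP (· ∈ T)) * zz T' ^ (l.countP (· ∈ T'))).coeff l.prod := by
  induction l with
  | nil =>
    constructor
    · intro w
      simp only [List.countP_nil, pow_zero, mul_one]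
      rw [MonoidAlgebra.one_def, MonoidAlgebra.coeff_single, Finsupp.single_apply]
      split_ifs <;> simp
    · simp [MonoidAlgebra.one_def]
  | cons t l ih =>
    obtain ⟨h1, h2⟩ := ih fun u hu => hl u (List.mem_cons_of_mem _ hu)
    have hcp : ∀ m x, zz T ^ m * x = x * zz T ^ m := fun m x =>
      (Commute.pow_left (show Commute (zz T) x from hc x) m).eq
    rw [List.prod_cons]
    by_cases ht : t ∈ T
    · have ht' := hd t ht
      rw [List.countP_cons_of_pos (by simpa using ht), List.countP_cons_of_neg (by simpa using ht'),
        pow_succ', mul_assoc]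
      exact ⟨zz_nonneg T h1, zz_pos T h1 ht h2⟩
    · have ht' : t ∈ T' := (hl t List.mem_cons_self).resolve_left ht
      rw [List.countP_cons_of_neg (by simpa using ht), List.countP_cons_of_pos (by simpa using ht'),
        pow_succ', ← mul_assoc, hcp, mul_assoc]
      exact ⟨zz_nonneg T' h1, zz_pos T' h1 ht' h2⟩

theorem coeff_ne {x : ℂ} (h : 0 < x) : x ≠ 0 := h.ne'

theorem card_ofFn {α : Type*} (p : α → Prop) [DecidablePred p] (N : ℕ) (f : Fin N → α) :
    (Finset.univ.filter fun i => p (f i)).card = (List.ofFn f).countP (fun a => p a) := by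
  induction N with
  | zero => simp
  | succ N ih =>
    rw [Fin.card_filter_univ_succ, List.ofFn_succ, List.countP_cons, ih (fun i => f i.succ)]
    simp only [decide_eq_true_eq]
    split_ifs <;> rfl

end Comb

section Refl

variable [FiniteDimensional ℂ V] {W : Subgroup (V →ₗ[ℂ] V)ˣ} [Fintype W]

theorem stb_iff (H : Ar W) (t : W) :
    (t ∈ stb H ∧ t ≠ 1) ↔ (t ∈ refls W ∧ fixedSpace (t : (V →ₗ[ℂ] V)ˣ) = H.1) := by
  obtain ⟨t0, ht0, h0⟩ := H.2
  have hrk : Module.finrank ℂ V = Module.finrank ℂ H.1 + 1 := by rw [h0]; exact ht0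
  constructor
  · rintro ⟨h1, h2⟩
    have hle : H.1 ≤ fixedSpace (t : (V →ₗ[ℂ] V)ˣ) := fun x hx => (mem_fixedSpace t x).2 (h1 x hx)
    have hlt : fixedSpace (t : (V →ₗ[ℂ] V)ˣ) < ⊤ := by
      rw [lt_top_iff_ne_top]
      intro h
      apply h2
      apply tl_ext
      intro x
      have : x ∈ fixedSpace (t : (V →ₗ[ℂ] V)ˣ) := by rw [h]; trivial
      exact (mem_fixedSpace t x).1 this
    have h3 := Submodule.finrank_lt hlt.ne
    have h4 : H.1 = fixedSpace (t : (V →ₗ[ℂ] V)ˣ) := Submodule.eq_of_le_of_finrank_le hle (by omega)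
    refine ⟨?_, h4.symm⟩
    change Module.finrank ℂ V = _
    rw [← h4, hrk]
  · rintro ⟨h1, h2⟩
    refine ⟨fun x hx => ?_, ?_⟩
    · rw [← h2] at hx
      exact (mem_fixedSpace t x).1 hx
    · rintro rfl
      have h3 : fixedSpace ((1 : W) : (V →ₗ[ℂ] V)ˣ) = ⊤ := by
        rw [eq_top_iff]; intro x _; exact (mem_fixedSpace 1 x).2 rfl
      have h1 : Module.finrank ℂ V = Module.finrank ℂ (fixedSpace ((1 : W) : (V →ₗ[ℂ] V)ˣ)) + 1 := h1
      rw [h3, finrank_top] at h1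
      omega

open Classical in
/-- reflections with hyperplane in `C` -/
def TC (W : Subgroup (V →ₗ[ℂ] V)ˣ) [Fintype W] (C : Set (Submodule ℂ V)) : Finset W :=
  Finset.univ.filter fun t => t ∈ refls W ∧ fixedSpace (t : (V →ₗ[ℂ] V)ˣ) ∈ C

open Classical in
/-- hyperplanes in `C` -/
def SC (W : Subgroup (V →ₗ[ℂ] V)ˣ) [Fintype W] (C : Set (Submodule ℂ V)) : Finset (Ar W) :=
  (Set.toFinite {H : Ar W | H.1 ∈ C}).toFinset

variable (C : Set (Submodule ℂ V))

theorem mem_TC (t : W) : t ∈ TC W C ↔ t ∈ refls W ∧ fixedSpace (t : (V →ₗ[ℂ] V)ˣ) ∈ C := by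
  classical
  simp [TC]

theorem mem_SC (H : Ar W) : H ∈ SC W C ↔ H.1 ∈ C := by
  simp [SC]

theorem eH_eq (H : Ar W) : eH H = (ptStab W H.1).ncard := by
  have h : ptStab W H.1 = (Subgroup.zpowers (ls H) : Set W) := by
    rw [← (ld H).zp]; rfl
  rw [h, eH, ← Nat.card_zpowers]
  rfl

theorem eH_mv (w : W) (H : Ar W) : (ptStab W (mv w H).1).ncard = (ptStab W H.1).ncard := by
  symm
  refine Set.ncard_congr (fun s _ => w * s * w⁻¹) ?_ ?_ ?_
  · intro s hs
    rw [ptStab_mv]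
    simpa [mul_assoc] using hs
  · intro s s' _ _ h; simpa using h
  · intro s hs
    refine ⟨w⁻¹ * s * w, (ptStab_mv w H s).1 hs, by group⟩

theorem cS_eq : cS (SC W C) = ((TC W C).card : ℂ) • 1 - zz (TC W C) := by
  classical
  have h1 : cS (SC W C) = ∑ t ∈ TC W C, (1 - el ℂ t) := by
    unfold cS PP
    rw [Finset.sum_comm, TC, Finset.sum_filter]
    refine Finset.sum_congr rfl fun s _ => ?_
    by_cases hs : s = 1
    · subst hs
      simp [MonoidAlgebra.one_def]
    by_cases hr : s ∈ refls W ∧ fixedSpace (s : (V →ₗ[ℂ] V)ˣ) ∈ C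
    · rw [if_pos hr]
      let H0 : Ar W := ⟨fixedSpace (s : (V →ₗ[ℂ] V)ˣ), s, hr.1, rfl⟩
      rw [Finset.sum_eq_single H0]
      · rw [if_pos ((stb_iff H0 s).2 ⟨hr.1, rfl⟩).1]
      · intro H _ hne
        rw [if_neg]
        intro h
        exact hne (Subtype.ext ((stb_iff H s).1 ⟨h, hs⟩).2.symm)
      · intro h
        exact absurd ((mem_SC C H0).2 hr.2) h
    · rw [if_neg hr]
      refine Finset.sum_eq_zero fun H hH => ?_
      rw [if_neg]
      intro h
      have h2 := (stb_iff H s).1 ⟨h, hs⟩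
      refine hr ⟨h2.1, ?_⟩
      rw [h2.2]
      exact (mem_SC C H).1 hH
  rw [h1, Finset.sum_sub_distrib, Finset.sum_const, zz, Nat.cast_smul_eq_nsmul]

theorem dS_univ : dS (SC W (Set.univ : Set (Submodule ℂ V))) =
    (refls W).ncard + (arrangement W).ncard := by
  classical
  have h1 : (arrangement W).ncard = (SC W (Set.univ : Set (Submodule ℂ V))).card := by
    rw [← Nat.card_coe_set_eq, ← Set.ncard_univ, SC, ← Set.ncard_eq_toFinset_card]
    congr 1
  have h2 : (refls W).ncard = (TC W (Set.univ : Set (Submodule ℂ V))).card := by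
    rw [← Set.ncard_coe_finset]
    congr 1
    ext t; simp [mem_TC]
  have h3 : (TC W (Set.univ : Set (Submodule ℂ V))).card =
      ∑ H ∈ SC W (Set.univ : Set (Submodule ℂ V)), (eH H - 1) := by
    have : TC W (Set.univ : Set (Submodule ℂ V)) =
        (SC W (Set.univ : Set (Submodule ℂ V))).biUnion fun H =>
          (Finset.univ.filter fun s => s ∈ stb H).erase 1 := by
      ext t
      simp only [mem_TC, Set.mem_univ, and_true, Finset.mem_biUnion, Finset.mem_erase, Finset.mem_filter,
        Finset.mem_univ, true_and, mem_SC]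
      constructor
      · intro ht
        have h := (stb_iff ⟨fixedSpace (t : (V →ₗ[ℂ] V)ˣ), t, ht, rfl⟩ t).2 ⟨ht, rfl⟩
        exact ⟨_, h.2, h.1⟩
      · rintro ⟨H, h, h'⟩
        exact ((stb_iff H t).1 ⟨h', h⟩).1
    rw [this, Finset.card_biUnion]
    · refine Finset.sum_congr rfl fun H _ => ?_
      rw [Finset.card_erase_of_mem (by simp [one_mem]), eH_eq, ← Set.ncard_coe_finset]
      congr 2
      ext s
      simp only [Finset.coe_filter, Finset.mem_univ, true_and]
      rfl
    · intro H _ H' _ hne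
      rw [Function.onFun, Finset.disjoint_left]
      intro t ht ht'
      simp only [Finset.mem_erase, Finset.mem_filter, Finset.mem_univ, true_and] at ht ht'
      apply hne
      apply Subtype.ext
      rw [← ((stb_iff H t).1 ⟨ht.2, ht.1⟩).2, ← ((stb_iff H' t).1 ⟨ht'.2, ht'.1⟩).2]
  rw [h1, h2, h3, dS, Finset.card_eq_sum_ones, ← Finset.sum_add_distrib]
  refine Finset.sum_congr rfl fun H _ => ?_
  have : 0 < eH H := orderOf_pos _
  omega

theorem dS_compl : dS (SC W C) + dS (SC W Cᶜ) = (refls W).ncard + (arrangement W).ncard := by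
  classical
  rw [← dS_univ, dS, dS, dS, ← Finset.sum_union]
  · refine Finset.sum_congr ?_ fun _ _ => rfl
    ext H; simp [mem_SC, em]
  · rw [Finset.disjoint_left]
    intro H h h'
    rw [mem_SC] at h h'
    exact h' h

theorem dS_orbit (H : Ar W) : dS (SC W (orbitOf W H.1)) =
    (ptStab W H.1).ncard * (orbitOf W H.1).ncard := by
  have h1 : (orbitOf W H.1).ncard = (SC W (orbitOf W H.1)).card := by
    rw [SC, ← Set.ncard_eq_toFinset_card]
    symm
    refine Set.ncard_congr (fun H' _ => H'.1) ?_ ?_ ?_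
    · intro H' h; exact h
    · intro a b _ _ h; exact Subtype.ext h
    · rintro _ ⟨w, rfl⟩
      exact ⟨mv w H, ⟨w, rfl⟩, rfl⟩
  rw [h1, dS, mul_comm, ← smul_eq_mul]
  refine Finset.sum_eq_card_nsmul fun H' h' => ?_
  obtain ⟨w, hw⟩ := (mem_SC _ _).1 h'
  have : H' = mv w H := Subtype.ext hw
  rw [eH_eq, this, eH_mv]

end Refl

section Main

variable [FiniteDimensional ℂ V] {W : Subgroup (V →ₗ[ℂ] V)ˣ} [Fintype W]
variable (C : Set (Submodule ℂ V)) (hC : ∀ (w : W) (H : Submodule ℂ V), H ∈ C → H.map (toLin W w) ∈ C)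

include hC

theorem compl_stable (w : W) (H : Submodule ℂ V) (hH : H ∈ Cᶜ) : H.map (toLin W w) ∈ Cᶜ := by
  intro h
  apply hH
  have := hC w⁻¹ _ h
  rwa [← Submodule.map_comp, tl_inv', Submodule.map_id] at this

theorem TC_conj (w t : W) (ht : t ∈ TC W C) : w * t * w⁻¹ ∈ TC W C := by
  rw [mem_TC] at ht ⊢
  refine ⟨refls_conj w ht.1, ?_⟩
  rw [fixedSpace_conj]
  exact hC w _ ht.2

omit hC in
theorem TC_stb (t : W) (ht : t ∈ TC W C) : ∃ H : Ar W, t ∈ stb H := by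
  rw [mem_TC] at ht
  exact ⟨⟨_, t, ht.1, rfl⟩, ((stb_iff ⟨_, t, ht.1, rfl⟩ t).2 ⟨ht.1, rfl⟩).1⟩

theorem SC_stable (w : W) (H : Ar W) (h : H ∈ SC W C) : mv w H ∈ SC W C := by
  rw [mem_SC] at h ⊢
  exact hC w _ h

/-- key vanishing -/
theorem vanish {g : W} {d : ℕ} {ζ : ℂ} {v : V} (hζ : IsPrimitiveRoot ζ d) (hd : 0 < d)
    (hgv : toLin W g v = ζ • v) (hv : ∀ H : Ar W, v ∉ H.1) (j : ℕ) (q : Polynomial ℂ)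
    (hq : ∀ k ∈ Finset.range (dS (SC W C) + 1), d ∣ k → q.eval (k : ℂ) = 0) :
    (Polynomial.aeval (cS (SC W C)) q * zz (TC W Cᶜ) ^ j).coeff g = 0 := by
  classical
  let b := Module.finBasis ℂ V
  let K := FractionRing (MvPolynomial (Fin (Module.finrank ℂ V)) ℂ)
  have hS := SC_stable C hC
  obtain ⟨F, G, P⟩ := exists_FSol b K hS hv
  obtain ⟨f, hf1, hf2, hf3⟩ := P.exists_f hS
  set D := dS (SC W C)
  set c := cS (SC W C) with hc
  set z := zz (TC W C)
  set z' := zz (TC W Cᶜ)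
  have hce := cS_eq (W := W) C
  rw [← hc] at hce
  have hthz : P.th hS z = z := P.th_central hS _ (TC_stb C) (fun w t => TC_conj C hC w t)
  have hthz' : P.th hS z' = z' := P.th_central hS _ (TC_stb _)
    (fun w t => TC_conj _ (compl_stable C hC) w t)
  have hthc : P.th hS c = c := by
    rw [hce, map_sub, hthz, map_smul, map_one]
  have hcc : ∀ x, c * x = x * c := by
    intro x
    rw [hce, sub_mul, mul_sub, smul_mul_assoc, mul_smul_comm, one_mul, mul_one,
      zz_cent _ (fun w t => TC_conj C hC w t)]
  have hpf : ∀ (p : Polynomial ℂ) k, f k * Polynomial.aeval c p = p.eval (k : ℂ) • f k := by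
    intro p k
    induction p using Polynomial.induction_on' with
    | add p q hp hq => rw [map_add, mul_add, hp, hq, Polynomial.eval_add, add_smul]
    | monomial n a =>
      have h1 : ∀ n : ℕ, f k * c ^ n = ((k : ℂ) ^ n) • f k := by
        intro n
        induction n with
        | zero => simp
        | succ n ih => rw [pow_succ, ← mul_assoc, ih, smul_mul_assoc, ← hcc, hf2, smul_smul, pow_succ]
      rw [Polynomial.aeval_monomial, ← Algebra.smul_def, mul_smul_comm, h1, smul_smul, Polynomial.eval_monomial]
  have hζ0 : ζ ≠ 0 := hζ.ne_zero hd.ne'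
  have hgv' : toLin W g⁻¹ v = ζ⁻¹ • v := by
    have h1 := congrArg (toLin W g⁻¹) hgv
    rw [tl_inv_apply', map_smul] at h1
    rw [eq_inv_smul_iff₀ hζ0]
    exact h1.symm
  have hTh := hf3 g⁻¹ ζ⁻¹ hgv' (inv_ne_zero hζ0)
  rw [inv_inv] at hTh
  let x : ℕ → ℂ := fun k => (el ℂ g⁻¹ * (f k * z' ^ j)).coeff 1
  have hexp : ∀ (α : ℕ → ℂ) (p : Polynomial ℂ),
      (el ℂ g⁻¹ * ((∑ k ∈ Finset.range (D + 1), α k • f k) * (Polynomial.aeval c p * z' ^ j))).coeff 1 =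
      ∑ k ∈ Finset.range (D + 1), α k * (p.eval (k : ℂ) * x k) := by
    intro α p
    rw [Finset.sum_mul, Finset.mul_sum, MonoidAlgebra.coeff_sum, Finsupp.finset_sum_apply]
    refine Finset.sum_congr rfl fun k _ => ?_
    rw [smul_mul_assoc, ← mul_assoc (f k), hpf, smul_mul_assoc, mul_smul_comm, mul_smul_comm,
      MonoidAlgebra.coeff_smul, MonoidAlgebra.coeff_smul, Finsupp.smul_apply, Finsupp.smul_apply,
      smul_eq_mul, smul_eq_mul]
  have hone : ∀ p : Polynomial ℂ, (el ℂ g⁻¹ * (Polynomial.aeval c p * z' ^ j)).coeff 1 =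
      ∑ k ∈ Finset.range (D + 1), p.eval (k : ℂ) * x k := by
    intro p
    have := hexp (fun _ => 1) p
    simp only [one_smul, one_mul, hf1] at this
    exact this
  have heq : ∀ p : Polynomial ℂ, ∑ k ∈ Finset.range (D + 1), ζ ^ k * (p.eval (k : ℂ) * x k) =
      ∑ k ∈ Finset.range (D + 1), p.eval (k : ℂ) * x k := by
    intro p
    rw [← hexp, ← hone, ← mul_assoc, ← hTh, ← P.th_el hS]
    have h1 : P.th hS (Polynomial.aeval c p * z' ^ j) = Polynomial.aeval c p * z' ^ j := by
      rw [map_mul, map_pow, hthz', ← Polynomial.aeval_algHom_apply, hthc]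
    conv_lhs => rw [← h1, ← map_mul]
    exact P.th_tau hS _
  have hx : ∀ k ∈ Finset.range (D + 1), ¬ d ∣ k → x k = 0 := by
    intro k hk hdk
    have h1 := heq (∏ i ∈ (Finset.range (D + 1)).erase k, (Polynomial.X - Polynomial.C (i : ℂ)))
    have h2 : ∀ i ∈ Finset.range (D + 1), i ≠ k → Polynomial.eval (i : ℂ)
        (∏ i ∈ (Finset.range (D + 1)).erase k, (Polynomial.X - Polynomial.C (i : ℂ))) = 0 := by
      intro i hi hik
      rw [Polynomial.eval_prod]
      exact Finset.prod_eq_zero (Finset.mem_erase.2 ⟨hik, hi⟩) (by simp)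
    have h3 : Polynomial.eval (k : ℂ)
        (∏ i ∈ (Finset.range (D + 1)).erase k, (Polynomial.X - Polynomial.C (i : ℂ))) ≠ 0 := by
      rw [Polynomial.eval_prod, Finset.prod_ne_zero_iff]
      intro i hi
      have := (Finset.mem_erase.1 hi).1
      simp only [Polynomial.eval_sub, Polynomial.eval_X, Polynomial.eval_C, ne_eq, sub_eq_zero]
      exact_mod_cast this.symm
    rw [Finset.sum_eq_single_of_mem k hk, Finset.sum_eq_single_of_mem k hk] at h1
    · by_contra hne
      have h4 : ζ ^ k = 1 := by
        have := mul_ne_zero h3 hne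
        exact mul_right_cancel₀ this (by rw [h1, one_mul])
      exact hdk (hζ.dvd_of_pow_eq_one k h4)
    · intro i hi hik; rw [h2 i hi hik, zero_mul]
    · intro i hi hik; rw [h2 i hi hik, zero_mul, mul_zero]
  have hfin := hone q
  rw [MonoidAlgebra.coeff_single_mul_apply, one_mul, inv_inv, mul_one] at hfin
  rw [hfin]
  refine Finset.sum_eq_zero fun k hk => ?_
  by_cases h : d ∣ k
  · rw [hq k hk h, zero_mul]
  · rw [hx k hk h, mul_zero]

/-- bounding the exponent -/
theorem bound_exp {g : W} {d : ℕ} {ζ : ℂ} {v : V} (hζ : IsPrimitiveRoot ζ d) (hd : 0 < d)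
    (hgv : toLin W g v = ζ • v) (hv : ∀ H : Ar W, v ∉ H.1) (j : ℕ) (m : ℕ)
    (hm : (zz (TC W C) ^ m * zz (TC W Cᶜ) ^ j).coeff g ≠ 0) :
    ∃ n, d * n ≤ dS (SC W C) ∧ (zz (TC W C) ^ n * zz (TC W Cᶜ) ^ j).coeff g ≠ 0 := by
  by_contra hcon
  push Not at hcon
  apply hm
  set z := zz (TC W C) with hz
  set z' := zz (TC W Cᶜ) with hz'
  set D := dS (SC W C) with hD
  set N : ℂ := ((TC W C).card : ℂ) with hN
  set Q : Polynomial ℂ := ∏ i ∈ Finset.range (D / d + 1), (Polynomial.X - Polynomial.C (N - (d * i : ℕ))) with hQ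
  have hQm : Q.Monic := Polynomial.monic_prod_X_sub_C _ _
  have hQd : Q.natDegree = D / d + 1 := by
    rw [hQ, Polynomial.natDegree_finset_prod_X_sub_C_eq_card, Finset.card_range]
  have hzc : z = Polynomial.aeval (cS (SC W C)) (Polynomial.C N - Polynomial.X : Polynomial ℂ) := by
    rw [map_sub, Polynomial.aeval_C, Polynomial.aeval_X, cS_eq, Algebra.algebraMap_eq_smul_one]
    abel
  have hmul : ∀ p : Polynomial ℂ, (Polynomial.aeval z (Q * p) * z' ^ j).coeff g = 0 := by
    intro p
    rw [hzc, ← Polynomial.aeval_comp]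
    apply vanish C hC hζ hd hgv hv
    intro k hk hdk
    obtain ⟨i, rfl⟩ := hdk
    rw [Polynomial.eval_comp, Polynomial.eval_mul, hQ, Polynomial.eval_prod]
    apply mul_eq_zero_of_left
    apply Finset.prod_eq_zero (i := i)
    · rw [Finset.mem_range] at hk ⊢
      have : i ≤ D / d := (Nat.le_div_iff_mul_le hd).2 (by rw [mul_comm]; omega)
      omega
    · simp
  have hsmall : ∀ p : Polynomial ℂ, p.natDegree < D / d + 1 →
      (Polynomial.aeval z p * z' ^ j).coeff g = 0 := by
    intro p hp
    rw [Polynomial.aeval_eq_sum_range, Finset.sum_mul, MonoidAlgebra.coeff_sum, Finsupp.finset_sum_apply]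
    refine Finset.sum_eq_zero fun i hi => ?_
    rw [smul_mul_assoc, MonoidAlgebra.coeff_smul, Finsupp.smul_apply, hcon i, smul_zero]
    rw [Finset.mem_range] at hi
    have : i ≤ D / d := by omega
    have := (Nat.le_div_iff_mul_le hd).1 this
    rwa [mul_comm]
  have h1 : (Polynomial.X ^ m : Polynomial ℂ) = (Polynomial.X ^ m) %ₘ Q + Q * (Polynomial.X ^ m /ₘ Q) :=
    (Polynomial.modByMonic_add_div _ _).symm
  have h2 : z ^ m = Polynomial.aeval z ((Polynomial.X ^ m : Polynomial ℂ) %ₘ Q) +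
      Polynomial.aeval z (Q * (Polynomial.X ^ m /ₘ Q)) := by
    rw [← map_add, ← h1, map_pow, Polynomial.aeval_X]
  rw [h2, add_mul, MonoidAlgebra.coeff_add, Finsupp.add_apply, hmul, add_zero]
  apply hsmall
  rw [← hQd]
  apply Polynomial.natDegree_modByMonic_lt _ hQm
  intro h
  rw [h, Polynomial.natDegree_one] at hQd
  exact absurd hQd (Nat.succ_ne_zero _).symm

open Classical in
/-- factorizations with few factors in `C` -/
theorem exists_fac {g : W} {d : ℕ} {ζ : ℂ} {v : V} (hζ : IsPrimitiveRoot ζ d) (hd : 0 < d)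
    (hgv : toLin W g v = ζ • v) (hv : ∀ H : Ar W, v ∉ H.1) (N : ℕ) (f : Fin N → W)
    (hf : IsReflFac W g N f) :
    ∃ m, d * m ≤ dS (SC W C) ∧ ∃ f' : Fin
      (m + (Finset.univ.filter fun i => fixedSpace (f i : (V →ₗ[ℂ] V)ˣ) ∈ Cᶜ).card) → W,
      IsReflFac W g _ f' ∧
      (Finset.univ.filter fun i => fixedSpace (f' i : (V →ₗ[ℂ] V)ˣ) ∈ C).card = m := by
  have hmem : ∀ t ∈ List.ofFn f, t ∈ refls W := by
    intro t ht
    obtain ⟨i, rfl⟩ := (List.mem_ofFn' _ _).1 ht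
    exact hf.1 i
  have h0 := zz_list (TC W C) (TC W Cᶜ) (zz_cent _ (fun w t => TC_conj C hC w t)) (List.ofFn f) (by
    intro t ht
    rw [mem_TC, mem_TC]
    by_cases h : fixedSpace (t : (V →ₗ[ℂ] V)ˣ) ∈ C
    · exact Or.inl ⟨hmem t ht, h⟩
    · exact Or.inr ⟨hmem t ht, h⟩) (by
    intro t h1 h2
    rw [mem_TC] at h1 h2
    exact h2.2 h1.2)
  have h1 := coeff_ne h0.2
  rw [hf.2] at h1
  obtain ⟨m, hm, h2⟩ := bound_exp C hC hζ hd hgv hv _ _ h1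
  obtain ⟨l1, hl1, ht1, h3⟩ := zz_pow_fwd _ _ _ _ h2
  rw [← mul_one (zz (TC W Cᶜ) ^ _)] at h3
  obtain ⟨l2, hl2, ht2, h4⟩ := zz_pow_fwd _ _ _ _ h3
  have h5 : (l1 ++ l2).prod = g := by
    rw [MonoidAlgebra.one_def, MonoidAlgebra.coeff_single, Finsupp.single_apply] at h4
    have h6 : (1 : W) = l2.prod⁻¹ * (l1.prod⁻¹ * g) := by
      by_contra h
      exact h4 (if_neg h)
    rw [List.prod_append]
    rw [eq_comm, inv_mul_eq_one, eq_inv_mul_iff_mul_eq] at h6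
    exact h6
  have hj : (Finset.univ.filter fun i => fixedSpace (f i : (V →ₗ[ℂ] V)ˣ) ∈ Cᶜ).card = l2.length := by
    rw [hl2, card_ofFn (fun t : W => fixedSpace (t : (V →ₗ[ℂ] V)ˣ) ∈ Cᶜ)]
    apply List.countP_congr
    intro t ht
    simp [mem_TC, hmem t ht]
  refine ⟨m, hm, ?_⟩
  rw [hj, ← hl1, ← List.length_append]
  refine ⟨(l1 ++ l2).get, ⟨?_, ?_⟩, ?_⟩
  · intro i
    rcases List.mem_append.1 (List.get_mem (l1 ++ l2) i) with h | h
    · exact ((mem_TC _ _).1 (ht1 _ h)).1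
    · exact ((mem_TC _ _).1 (ht2 _ h)).1
  · rw [List.ofFn_get, h5]
  · rw [card_ofFn (fun t : W => fixedSpace (t : (V →ₗ[ℂ] V)ˣ) ∈ C), List.ofFn_get, List.countP_append]
    have e1 : l1.countP (fun t : W => fixedSpace (t : (V →ₗ[ℂ] V)ˣ) ∈ C) = l1.length := by
      rw [List.countP_eq_length]
      intro t ht
      simpa using ((mem_TC _ _).1 (ht1 _ ht)).2
    have e2 : l2.countP (fun t : W => fixedSpace (t : (V →ₗ[ℂ] V)ˣ) ∈ C) = 0 := by
      rw [List.countP_eq_zero]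
      intro t ht
      simpa using ((mem_TC _ _).1 (ht2 _ ht)).2
    rw [e1, e2, add_zero]

end Main

end KZ

/-- Bounds for the minimal orbit-count `n_C(g)`: for `W` irreducible and `g` regular
of order `d`, every orbit `C` (of a hyperplane `H`) satisfies
`d·n_C(g) ≤ e_C·ω_C` and `d·l_R(g) + e_C·ω_C ≤ d·n_C(g) + |R| + |A|`
(the latter being `n_C(g) ≥ l_R(g) − (|R| + |A| − e_C·ω_C)/d`). -/
theorem min_orbit_count_bounds
    (V : Type*) [AddCommGroup V] [Module ℂ V] [FiniteDimensional ℂ V]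
    (W : Subgroup (V →ₗ[ℂ] V)ˣ) [Finite W]
    (hgen : Subgroup.closure (refls W) = ⊤)
    (hirr : IsIrredAction W)
    (d : ℕ) (g : W) (hg : IsRegularElt W g d)
    (lg : ℕ) (hlg : IsReflLength W g lg)
    (H : Submodule ℂ V) (hH : H ∈ arrangement W)
    (nc : ℕ) (hnc : IsMinOrbitCount W g (orbitOf W H) nc) :
    d * nc ≤ (ptStab W H).ncard * (orbitOf W H).ncard ∧
      d * lg + (ptStab W H).ncard * (orbitOf W H).ncard ≤
        d * nc + (refls W).ncard + (arrangement W).ncard := by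
  classical
  haveI : Fintype W := Fintype.ofFinite W
  obtain ⟨hord, ζ, v, -, hζ, hgv, hv⟩ := hg
  have hd : 0 < d := hord ▸ orderOf_pos g
  have hv' : ∀ H : KZ.Ar W, v ∉ H.1 := fun H => hv H.1 H.2
  have hC : ∀ (w : W) (H' : Submodule ℂ V), H' ∈ orbitOf W H → H'.map (toLin W w) ∈ orbitOf W H := by
    rintro w _ ⟨w', rfl⟩
    exact ⟨w * w', by rw [KZ.tl_mul, Submodule.map_comp]⟩
  obtain ⟨⟨N, f, hf, hcard⟩, hmin⟩ := hnc
  have horb := KZ.dS_orbit (W := W) ⟨H, hH⟩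
  have hcompl := KZ.dS_compl (W := W) (orbitOf W H)
  simp only at horb
  rw [← horb]
  constructor
  · obtain ⟨m, hm, f', hf', hc⟩ := KZ.exists_fac (orbitOf W H) hC hζ hd hgv hv' N f hf
    have h1 := hmin _ f' hf'
    have h2 : nc ≤ m := h1.trans (le_of_eq (by convert hc))
    exact (Nat.mul_le_mul_left d h2).trans hm
  · obtain ⟨m, hm, f', hf', -⟩ := KZ.exists_fac (orbitOf W H)ᶜ (KZ.compl_stable _ hC) hζ hd hgv hv' N f hf
    have h1 := hlg.2 _ f' hf'
    simp only [compl_compl] at h1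
    have h2 : lg ≤ m + nc := h1.trans (le_of_eq (by rw [← hcard]))
    have h3 := Nat.mul_le_mul_left d h2
    rw [mul_add] at h3
    omega
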